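/- arXiv:0904.2582 — 7 statements merged into one kernel-verified Lean document; each statement's English description precedes it below -/
import Mathlib

section
/- Let φ = (1 + √5)/2 and let A be a real number with A > 22π²/(√15·φ). In the setup take a = φ, q_def the constant function with value 22π²/(√5·φ), and q_per the φ-periodic function with q_per(x) = −A for 0 ≤ x < φ/2 and q_per(x) = A for φ/2 ≤ x < φ. Then infinitely many gaps contain exactly two defect eigenvalues: the collection of bounded connected components G of {E : ℝ | k(E)² > 4} such that the set {E ∈ G | E is a defect eigenvalue} has exactly two elements is infinite. -/
open Matrix MeasureTheory

/-- A set `S ⊆ ℝ` is locally finite if every point has a neighborhood meeting `S` in a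
finite set. -/
def LocallyFiniteSet (S : Set ℝ) : Prop :=
  ∀ x : ℝ, ∃ U ∈ nhds x, (S ∩ U).Finite

/-- A function is piecewise continuous if it is continuous off a locally finite set. -/
def PiecewiseContinuous (f : ℝ → ℝ) : Prop :=
  ∃ S : Set ℝ, LocallyFiniteSet S ∧ ContinuousOn f Sᶜ

/-- `W` is the fundamental solution matrix of `-u'' + p u = E u`, i.e. the continuous
solution of `W x = 1 + ∫₀ˣ !![0, 1; p s - E, 0] * W s ds` (read entrywise). -/
def IsFundamentalSolution (p : ℝ → ℝ) (E : ℝ)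
    (W : ℝ → Matrix (Fin 2) (Fin 2) ℝ) : Prop :=
  (∀ i j, Continuous fun x => W x i j) ∧
    ∀ (x : ℝ) (i j : Fin 2), W x i j =
      (1 : Matrix (Fin 2) (Fin 2) ℝ) i j +
        ∫ s in (0:ℝ)..x, (!![0, 1; p s - E, 0] * W s) i j

/-- `E` is a defect eigenvalue for the potential `q`: there is a differentiable,
not identically zero, square-integrable function `u` with
`u' x = u' 0 + ∫₀ˣ (q s - E) u s ds` for all `x` (i.e. `-u'' + q u = E u`). -/
def IsDefectEigenvalue (q : ℝ → ℝ) (E : ℝ) : Prop :=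
  ∃ u : ℝ → ℝ, Differentiable ℝ u ∧ u ≠ 0 ∧
    Integrable (fun x => (u x) ^ 2) ∧
    ∀ x : ℝ, deriv u x = deriv u 0 + ∫ s in (0:ℝ)..x, (q s - E) * u s

/-- `G` is a gap of the Floquet discriminant `k`: a bounded connected component of
`{E | k E ^ 2 > 4}`. -/
def IsGap (k : ℝ → ℝ) (G : Set ℝ) : Prop :=
  Bornology.IsBounded G ∧
    ∃ E ∈ {E : ℝ | k E ^ 2 > 4}, G = connectedComponentIn {E : ℝ | k E ^ 2 > 4} E

/-- For `a : ℝ`, `Fset a` is the set of `y : ℝ` such that for every `δ > 0` there are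
infinitely many pairs of integers `(N, M)` with `M ≥ 1` and `|y - M * (N - M * a)| < δ`. -/
def Fset (a : ℝ) : Set ℝ :=
  {y | ∀ δ > 0,
    {p : ℤ × ℤ | 1 ≤ p.2 ∧ |y - (p.2 : ℝ) * ((p.1 : ℝ) - (p.2 : ℝ) * a)| < δ}.Infinite}

/-- A pair `(u, w)` solving `u' = w`, `w' = (p - E) u` off the exceptional set `S`. -/
structure IsSolutionPair (p : ℝ → ℝ) (E : ℝ) (S : Set ℝ) (u w : ℝ → ℝ) : Prop where
  deriv_fst : ∀ x, HasDerivAt u (w x) x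
  cont_snd : Continuous w
  deriv_snd : ∀ x ∉ S, HasDerivAt w ((p x - E) * u x) x

lemma IsSolutionPair.cont_fst {p : ℝ → ℝ} {E : ℝ} {S : Set ℝ} {u w : ℝ → ℝ}
    (h : IsSolutionPair p E S u w) : Continuous u :=
  continuous_iff_continuousAt.2 fun x => (h.deriv_fst x).continuousAt

lemma intervalIntegrable_of_measurable_bounded {p : ℝ → ℝ} (hm : Measurable p) {C : ℝ}
    (hC : ∀ x, |p x| ≤ C) (a b : ℝ) : IntervalIntegrable p volume a b := by
  rw [intervalIntegrable_iff]
  refine Measure.integrableOn_of_bounded (M := C) ?_ hm.aestronglyMeasurable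
    (Filter.Eventually.of_forall fun x => by simpa using hC x)
  simp [Set.uIoc]

lemma intervalIntegrable_potential_mul {p u : ℝ → ℝ}
    (hp : ∀ a b, IntervalIntegrable p volume a b) (hu : Continuous u) (E a b : ℝ) :
    IntervalIntegrable (fun s => (p s - E) * u s) volume a b :=
  ((hp a b).sub intervalIntegrable_const).mul_continuousOn hu.continuousOn

/-- Passing from the integral equation to the differential equation. -/
lemma isSolutionPair_of_integral {p : ℝ → ℝ} {E : ℝ} {S : Set ℝ} {u w : ℝ → ℝ}
    (hm : Measurable p) (hp : ∀ a b, IntervalIntegrable p volume a b)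
    (hS : ∀ x ∉ S, ContinuousAt p x) (hu : ∀ x, HasDerivAt u (w x) x)
    (hw : ∀ x, w x = w 0 + ∫ s in (0:ℝ)..x, (p s - E) * u s) :
    IsSolutionPair p E S u w := by
  have huc : Continuous u := continuous_iff_continuousAt.2 fun x => (hu x).continuousAt
  have hi := intervalIntegrable_potential_mul hp huc E
  have hw' : w = fun x => w 0 + ∫ s in (0:ℝ)..x, (p s - E) * u s := funext hw
  refine ⟨hu, ?_, fun x hx => ?_⟩
  · rw [hw']
    exact continuous_const.add (intervalIntegral.continuous_primitive hi 0)
  · have h1 : HasDerivAt (fun y => ∫ s in (0:ℝ)..y, (p s - E) * u s) ((p x - E) * u x) x :=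
      intervalIntegral.integral_hasDerivAt_right (hi 0 x)
        (((hm.sub_const E).mul huc.measurable).stronglyMeasurable.stronglyMeasurableAtFilter)
        (((hS x hx).sub continuousAt_const).mul huc.continuousAt)
    rw [hw']
    exact h1.const_add _

lemma IsSolutionPair.integral_eq {p : ℝ → ℝ} {E : ℝ} {S : Set ℝ} {u w : ℝ → ℝ}
    (h : IsSolutionPair p E S u w) (hp : ∀ a b, IntervalIntegrable p volume a b)
    (hS : S.Countable) (x : ℝ) : w x = w 0 + ∫ s in (0:ℝ)..x, (p s - E) * u s := by
  rw [integral_eq_of_hasDerivAt_off_countable w _ hS h.cont_snd.continuousOn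
    (fun y hy => h.deriv_snd y hy.2) (intervalIntegrable_potential_mul hp h.cont_fst E 0 x)]
  ring

lemma IsSolutionPair.lin {p : ℝ → ℝ} {E : ℝ} {S : Set ℝ} {u w u' w' : ℝ → ℝ}
    (h : IsSolutionPair p E S u w) (h' : IsSolutionPair p E S u' w') (a b : ℝ) :
    IsSolutionPair p E S (fun x => u x * a + u' x * b) (fun x => w x * a + w' x * b) := by
  refine ⟨fun x => ((h.deriv_fst x).mul_const a).add ((h'.deriv_fst x).mul_const b),
    (h.cont_snd.mul_const a).add (h'.cont_snd.mul_const b), fun x hx => ?_⟩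
  refine (((h.deriv_snd x hx).mul_const a).add ((h'.deriv_snd x hx).mul_const b)).congr_deriv ?_
  ring

/-- The columns of the fundamental matrix are solution pairs. -/
lemma IsFundamentalSolution.column {p : ℝ → ℝ} {E : ℝ} {S : Set ℝ}
    {W : ℝ → Matrix (Fin 2) (Fin 2) ℝ} (hW : IsFundamentalSolution p E W)
    (hm : Measurable p) (hp : ∀ a b, IntervalIntegrable p volume a b)
    (hS : ∀ x ∉ S, ContinuousAt p x) (j : Fin 2) :
    IsSolutionPair p E S (fun x => W x 0 j) (fun x => W x 1 j) := by
  obtain ⟨hc, hi⟩ := hW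
  have h0 : ∀ i, W 0 i j = (1 : Matrix (Fin 2) (Fin 2) ℝ) i j := fun i => by simpa using hi 0 i j
  refine isSolutionPair_of_integral hm hp hS (fun x => ?_) (fun x => ?_)
  · have h1 : (fun x => W x 0 j) =
        fun x => (1 : Matrix (Fin 2) (Fin 2) ℝ) 0 j + ∫ s in (0:ℝ)..x, W s 1 j := by
      funext x
      rw [hi x 0 j]
      simp [Matrix.mul_apply, Fin.sum_univ_two]
    rw [h1]
    exact (intervalIntegral.integral_hasDerivAt_right ((hc 1 j).intervalIntegrable _ _)
      ((hc 1 j).stronglyMeasurableAtFilter _ _) (hc 1 j).continuousAt).const_add _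
  · rw [h0 1, hi x 1 j]
    simp [Matrix.mul_apply, Fin.sum_univ_two]

lemma eq_of_hasDerivAt_zero_Ioo {f : ℝ → ℝ} (hf : Continuous f) {a b : ℝ}
    (h : ∀ x ∈ Set.Ioo a b, HasDerivAt f 0 x) {x : ℝ} (hx : x ∈ Set.Icc a b) : f x = f a := by
  rcases hx.1.eq_or_lt with rfl | hlt
  · rfl
  · obtain ⟨c, -, hc⟩ := exists_hasDerivAt_eq_slope f (fun _ => 0) hlt hf.continuousOn
      fun y hy => h y ⟨hy.1, hy.2.trans_le hx.2⟩
    have : x - a ≠ 0 := (sub_pos.2 hlt).ne'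
    field_simp at hc
    linarith

/-- Explicit propagation of a solution pair over an interval of constant potential. -/
lemma propagate {u w : ℝ → ℝ} {ω x₀ l : ℝ} (hω : ω ≠ 0) (hu : ∀ x, HasDerivAt u (w x) x)
    (hw : Continuous w)
    (hw' : ∀ x ∈ Set.Ioo x₀ (x₀ + l), HasDerivAt w (-(ω ^ 2) * u x) x) {t : ℝ}
    (ht : t ∈ Set.Icc 0 l) :
    u (x₀ + t) = Real.cos (ω * t) * u x₀ + Real.sin (ω * t) / ω * w x₀ ∧
      w (x₀ + t) = -(ω * Real.sin (ω * t)) * u x₀ + Real.cos (ω * t) * w x₀ := by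
  have huc : Continuous u := continuous_iff_continuousAt.2 fun x => (hu x).continuousAt
  have hl : ∀ x, HasDerivAt (fun y => ω * (y - x₀)) ω x := fun x => by
    simpa using ((hasDerivAt_id x).sub_const x₀).const_mul ω
  have hmem : x₀ + t ∈ Set.Icc x₀ (x₀ + l) := ⟨by linarith [ht.1], by linarith [ht.2]⟩
  have h1 := eq_of_hasDerivAt_zero_Ioo (a := x₀) (b := x₀ + l)
    (f := fun x => Real.cos (ω * (x - x₀)) * u x - Real.sin (ω * (x - x₀)) / ω * w x)
    (by fun_prop) (fun x hx => by
      refine (((hl x).cos.mul (hu x)).sub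
        (((hl x).sin.div_const ω).mul (hw' x hx))).congr_deriv ?_
      field_simp
      ring) hmem
  have h2 := eq_of_hasDerivAt_zero_Ioo (a := x₀) (b := x₀ + l)
    (f := fun x => ω * Real.sin (ω * (x - x₀)) * u x + Real.cos (ω * (x - x₀)) * w x)
    (by fun_prop) (fun x hx => by
      refine ((((hl x).sin.const_mul ω).mul (hu x)).add
        ((hl x).cos.mul (hw' x hx))).congr_deriv ?_
      ring) hmem
  simp only [add_sub_cancel_left, sub_self, mul_zero, Real.cos_zero, Real.sin_zero, zero_div,
    zero_mul, sub_zero, one_mul, zero_add] at h1 h2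
  have hcs := Real.sin_sq_add_cos_sq (ω * t)
  generalize Real.sin (ω * t) = S at *
  generalize Real.cos (ω * t) = C at *
  constructor
  · rw [← h1, ← h2]
    field_simp
    linear_combination -u (x₀ + t) * ω * hcs
  · rw [← h1, ← h2]
    field_simp
    linear_combination -w (x₀ + t) * hcs

section Gluing

/-- Gluing two differentiable functions at a point. -/
lemma hasDerivAt_glue {f g f' g' : ℝ → ℝ} (a : ℝ) (hf : ∀ x, HasDerivAt f (f' x) x)
    (hg : ∀ x, HasDerivAt g (g' x) x) (h : f a = g a) (h' : f' a = g' a) (x : ℝ) :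
    HasDerivAt (fun x => if x ≤ a then f x else g x) (if x ≤ a then f' x else g' x) x := by
  rcases lt_trichotomy x a with hx | rfl | hx
  · rw [if_pos hx.le]
    refine (hf x).congr_of_eventuallyEq ?_
    filter_upwards [Iio_mem_nhds hx] with y hy
    rw [if_pos (le_of_lt hy)]
  · rw [if_pos le_rfl, ← hasDerivWithinAt_univ, ← Set.Iic_union_Ici (a := x)]
    refine HasDerivWithinAt.union ?_ ?_
    · refine (hf x).hasDerivWithinAt.congr (fun y hy => if_pos hy) (if_pos le_rfl)
    · rw [h']
      refine (hg x).hasDerivWithinAt.congr (fun y hy => ?_) (by rw [if_pos le_rfl, h])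
      rcases (show x ≤ y from hy).eq_or_lt with rfl | hlt
      · rw [if_pos le_rfl, h]
      · rw [if_neg (not_le.2 hlt)]
  · rw [if_neg (not_le.2 hx)]
    refine (hg x).congr_of_eventuallyEq ?_
    filter_upwards [Ioi_mem_nhds hx] with y hy
    rw [if_neg (not_le.2 hy)]

lemma hasDerivAt_glue_left {f g : ℝ → ℝ} {a x c : ℝ} (hx : x < a) (hf : HasDerivAt f c x) :
    HasDerivAt (fun x => if x ≤ a then f x else g x) c x := by
  refine hf.congr_of_eventuallyEq ?_
  filter_upwards [Iio_mem_nhds hx] with y hy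
  rw [if_pos (le_of_lt hy)]

lemma hasDerivAt_glue_right {f g : ℝ → ℝ} {a x c : ℝ} (hx : a < x) (hg : HasDerivAt g c x) :
    HasDerivAt (fun x => if x ≤ a then f x else g x) c x := by
  refine hg.congr_of_eventuallyEq ?_
  filter_upwards [Ioi_mem_nhds hx] with y hy
  rw [if_neg (not_le.2 hy)]

end Gluing

/-- The `2 * b`-periodic potential with value `-A` on `[0, b)` and `A` on `[b, 2 * b)`. -/
structure IsStepPotential (A b : ℝ) (f : ℝ → ℝ) : Prop where
  pos : 0 < b
  per : ∀ x, f (x + 2 * b) = f x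
  low : ∀ x, 0 ≤ x → x < b → f x = -A
  high : ∀ x, b ≤ x → x < 2 * b → f x = A

namespace IsStepPotential

variable {A b : ℝ} {f : ℝ → ℝ}

lemma eq_low (h : IsStepPotential A b f) (m : ℤ) {x : ℝ} (h1 : m * (2 * b) ≤ x)
    (h2 : x < m * (2 * b) + b) : f x = -A := by
  have hp : Function.Periodic f (2 * b) := h.per
  rw [← hp.sub_int_mul_eq m]
  exact h.low _ (by linarith) (by linarith)

lemma eq_high (h : IsStepPotential A b f) (m : ℤ) {x : ℝ} (h1 : m * (2 * b) + b ≤ x)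
    (h2 : x < m * (2 * b) + 2 * b) : f x = A := by
  have hp : Function.Periodic f (2 * b) := h.per
  rw [← hp.sub_int_mul_eq m]
  exact h.high _ (by linarith) (by linarith)

lemma exists_cell (h : IsStepPotential A b f) (x : ℝ) :
    ∃ m : ℤ, m * (2 * b) ≤ x ∧ x < m * (2 * b) + 2 * b := by
  have hb : 0 < 2 * b := by linarith [h.pos]
  refine ⟨⌊x / (2 * b)⌋, (le_div_iff₀ hb).1 (Int.floor_le _), ?_⟩
  have := (div_lt_iff₀ hb).1 (Int.lt_floor_add_one (x / (2 * b)))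
  linarith

lemma eq_fract (h : IsStepPotential A b f) :
    f = fun x => if Int.fract (x / (2 * b)) < 1 / 2 then -A else A := by
  have hb := h.pos
  funext x
  obtain ⟨m, h1, h2⟩ := h.exists_cell x
  have hx : Int.fract (x / (2 * b)) = x / (2 * b) - m := by
    rw [Int.fract_eq_iff]
    refine ⟨?_, ?_, m, by ring⟩
    · rw [sub_nonneg, le_div_iff₀ (by linarith)]; exact h1
    · rw [sub_lt_iff_lt_add, div_lt_iff₀ (by linarith)]; linarith
  have hiff : Int.fract (x / (2 * b)) < 1 / 2 ↔ x < m * (2 * b) + b := by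
    rw [hx, sub_lt_iff_lt_add, div_lt_iff₀ (by linarith)]
    constructor <;> intro <;> linarith
  by_cases hc : x < m * (2 * b) + b
  · rw [if_pos (hiff.2 hc), h.eq_low m h1 hc]
  · rw [if_neg (fun h' => hc (hiff.1 h')), h.eq_high m (not_lt.1 hc) h2]

lemma measurable (h : IsStepPotential A b f) : Measurable f := by
  rw [h.eq_fract]
  exact Measurable.ite (measurableSet_lt (by fun_prop) measurable_const) measurable_const
    measurable_const

lemma abs_le (h : IsStepPotential A b f) (x : ℝ) : |f x| ≤ |A| := by
  rw [h.eq_fract]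
  dsimp only
  split_ifs <;> simp

lemma intervalIntegrable (h : IsStepPotential A b f) (x y : ℝ) :
    IntervalIntegrable f volume x y :=
  intervalIntegrable_of_measurable_bounded h.measurable h.abs_le x y

end IsStepPotential

/-- The jump points of the step potential. -/
def jumpSet (b : ℝ) : Set ℝ := Set.range fun m : ℤ => (m : ℝ) * b

lemma countable_jumpSet (b : ℝ) : (jumpSet b).Countable := Set.countable_range _

lemma not_mem_jumpSet {b x : ℝ} (hb : 0 < b) (m : ℤ) (h1 : m * b < x) (h2 : x < m * b + b) :
    x ∉ jumpSet b := by
  rintro ⟨n, rfl⟩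
  simp only at h1 h2
  have h3 : (m : ℝ) < n := lt_of_mul_lt_mul_right h1 hb.le
  have h4 : (n : ℝ) < m + 1 := by
    refine lt_of_mul_lt_mul_right ?_ hb.le
    linarith
  have h5 : m < n := by exact_mod_cast h3
  have h6 : n < m + 1 := by exact_mod_cast h4
  omega

lemma IsStepPotential.continuousAt {A b : ℝ} {f : ℝ → ℝ} (h : IsStepPotential A b f) {x : ℝ}
    (hx : x ∉ jumpSet b) : ContinuousAt f x := by
  obtain ⟨m, h1, h2⟩ := h.exists_cell x
  have h1' : m * (2 * b) < x := lt_of_le_of_ne h1 fun he =>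
    hx ⟨2 * m, by push_cast; linarith⟩
  have h3 : x ≠ m * (2 * b) + b := fun he => hx ⟨2 * m + 1, by push_cast; linarith⟩
  rcases lt_or_gt_of_ne h3 with h3 | h3
  · refine (continuousAt_const (y := -A)).congr ?_
    filter_upwards [Ioo_mem_nhds h1' h3] with y hy
    exact (h.eq_low m hy.1.le hy.2).symm
  · refine (continuousAt_const (y := A)).congr ?_
    filter_upwards [Ioo_mem_nhds h3 h2] with y hy
    exact (h.eq_high m hy.1.le hy.2).symm

/-- `(u, w)` solves the first order system over the cell `[x₀, x₀ + 2 * b]`, where the frequency is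
`p` on the first half and `r` on the second half. -/
def SolvesCell (b p r : ℝ) (u w : ℝ → ℝ) (x₀ : ℝ) : Prop :=
  (∀ x ∈ Set.Ioo x₀ (x₀ + b), HasDerivAt w (-(p ^ 2) * u x) x) ∧
    ∀ x ∈ Set.Ioo (x₀ + b) (x₀ + b + b), HasDerivAt w (-(r ^ 2) * u x) x

/-- Entries of the monodromy matrix of a cell. -/
noncomputable def monodromy (b p r : ℝ) : Matrix (Fin 2) (Fin 2) ℝ :=
  !![Real.cos (r * b) * Real.cos (p * b) - p / r * Real.sin (r * b) * Real.sin (p * b),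
    Real.cos (r * b) * Real.sin (p * b) / p + Real.sin (r * b) * Real.cos (p * b) / r;
    -(r * Real.sin (r * b) * Real.cos (p * b) + p * Real.cos (r * b) * Real.sin (p * b)),
    Real.cos (r * b) * Real.cos (p * b) - r / p * Real.sin (r * b) * Real.sin (p * b)]

lemma det_monodromy {b p r : ℝ} (hp : p ≠ 0) (hr : r ≠ 0) :
    monodromy b p r 0 0 * monodromy b p r 1 1 - monodromy b p r 0 1 * monodromy b p r 1 0 = 1 := by
  have h1 := Real.sin_sq_add_cos_sq (r * b)
  have h2 := Real.sin_sq_add_cos_sq (p * b)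
  simp only [monodromy, Matrix.of_apply, Matrix.cons_val', Matrix.cons_val_zero,
    Matrix.cons_val_one, Matrix.cons_val_fin_one]
  generalize Real.sin (r * b) = s at *
  generalize Real.cos (r * b) = c at *
  generalize Real.sin (p * b) = s' at *
  generalize Real.cos (p * b) = c' at *
  field_simp
  linear_combination (p * r) * (s' ^ 2 + c' ^ 2) * h1 + (p * r) * h2

section Cell

variable {b p r x₀ : ℝ} {u w : ℝ → ℝ}

lemma SolvesCell.step (h : SolvesCell b p r u w x₀) (hb : 0 < b) (hp : p ≠ 0) (hr : r ≠ 0)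
    (hu : ∀ x, HasDerivAt u (w x) x) (hw : Continuous w) :
    u (x₀ + 2 * b) = monodromy b p r 0 0 * u x₀ + monodromy b p r 0 1 * w x₀ ∧
      w (x₀ + 2 * b) = monodromy b p r 1 0 * u x₀ + monodromy b p r 1 1 * w x₀ := by
  obtain ⟨h1, h2⟩ := propagate hp hu hw h.1 (t := b) ⟨hb.le, le_rfl⟩
  obtain ⟨h3, h4⟩ := propagate hr hu hw h.2 (t := b) ⟨hb.le, le_rfl⟩
  rw [h1, h2, show x₀ + b + b = x₀ + 2 * b by ring] at h3 h4
  rw [h3, h4]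
  simp only [monodromy, Matrix.of_apply, Matrix.cons_val', Matrix.cons_val_zero,
    Matrix.cons_val_one, Matrix.cons_val_fin_one]
  constructor <;> field_simp <;> ring

lemma half_cell_bound {ω S C U W : ℝ} (hω : 0 < ω) (hS : |S| ≤ 1) (hC : |C| ≤ 1) :
    |C * U + S / ω * W| + |-(ω * S) * U + C * W| ≤ (1 + ω + 1 / ω) * (|U| + |W|) := by
  have h1 : |C * U| ≤ |U| := by
    rw [abs_mul]; exact mul_le_of_le_one_left (abs_nonneg _) hC
  have h2 : |S / ω * W| ≤ 1 / ω * |W| := by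
    rw [abs_mul, abs_div, abs_of_pos hω]; gcongr
  have h3 : |-(ω * S) * U| ≤ ω * |U| := by
    rw [abs_mul, abs_neg, abs_mul, abs_of_pos hω]
    nlinarith [abs_nonneg U, mul_nonneg hω.le (abs_nonneg U)]
  have h4 : |C * W| ≤ |W| := by
    rw [abs_mul]; exact mul_le_of_le_one_left (abs_nonneg _) hC
  have h5 := abs_add_le (C * U) (S / ω * W)
  have h6 := abs_add_le (-(ω * S) * U) (C * W)
  have h7 : 0 ≤ ω * |W| := by positivity
  have h8 : 0 ≤ 1 / ω * |U| := by positivity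
  nlinarith

lemma SolvesCell.bound (h : SolvesCell b p r u w x₀) (hb : 0 < b) (hp : 0 < p) (hr : 0 < r)
    (hu : ∀ x, HasDerivAt u (w x) x) (hw : Continuous w) {t : ℝ} (ht : t ∈ Set.Icc 0 (2 * b)) :
    |u (x₀ + t)| ≤ (1 + r + 1 / r) * (1 + p + 1 / p) * (|u x₀| + |w x₀|) := by
  have hr' : 0 < 1 / r := by positivity
  have hp' : 0 < 1 / p := by positivity
  have key : ∀ t ∈ Set.Icc 0 b,
      |u (x₀ + t)| + |w (x₀ + t)| ≤ (1 + p + 1 / p) * (|u x₀| + |w x₀|) := fun t ht => by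
    obtain ⟨h1, h2⟩ := propagate hp.ne' hu hw h.1 ht
    rw [h1, h2]
    exact half_cell_bound hp (Real.abs_sin_le_one _) (Real.abs_cos_le_one _)
  have h0 : 0 ≤ (1 + p + 1 / p) * (|u x₀| + |w x₀|) := by positivity
  rcases le_total t b with htb | htb
  · have := key t ⟨ht.1, htb⟩
    nlinarith [abs_nonneg (w (x₀ + t))]
  · obtain ⟨h3, h4⟩ := propagate hr.ne' hu hw h.2 (t := t - b)
      ⟨by linarith, by linarith [ht.2]⟩
    have h5 := half_cell_bound (U := u (x₀ + b)) (W := w (x₀ + b)) hr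
      (Real.abs_sin_le_one (r * (t - b))) (Real.abs_cos_le_one (r * (t - b)))
    rw [← h3, ← h4, show x₀ + b + (t - b) = x₀ + t by ring] at h5
    have h6 := key b ⟨hb.le, le_rfl⟩
    have h7 : (1 + r + 1 / r) * (|u (x₀ + b)| + |w (x₀ + b)|) ≤
        (1 + r + 1 / r) * ((1 + p + 1 / p) * (|u x₀| + |w x₀|)) := by gcongr
    nlinarith [abs_nonneg (w (x₀ + t))]

end Cell

/-- A square-integrable continuous function cannot reproduce itself, up to factors of modulus at
least one, on infinitely many disjoint intervals. -/
lemma eq_zero_of_expanding {f g : ℝ → ℝ} (hf : Integrable fun x => f x ^ 2) {b μ : ℝ} (hb : 0 < b)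
    (hμ : 1 ≤ μ ^ 2) (x : ℕ → ℝ)
    (hx : Pairwise (Function.onFun Disjoint fun m => Set.Ioc (x m) (x m + b)))
    (hg : Continuous g) (h : ∀ m, ∀ t ∈ Set.Icc 0 b, f (x m + t) = μ ^ m * g t) {t : ℝ}
    (ht : t ∈ Set.Icc 0 b) : g t = 0 := by
  by_contra hne
  have hpos : 0 < ∫ t in (0:ℝ)..b, g t ^ 2 :=
    intervalIntegral.integral_pos hb (by fun_prop) (fun _ _ => sq_nonneg _) ⟨t, ht, by positivity⟩
  have hsum := (hasSum_integral_iUnion (fun m => measurableSet_Ioc) hx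
    (hf.integrableOn (s := ⋃ m, Set.Ioc (x m) (x m + b)))).summable
  have hlim := hsum.tendsto_atTop_zero
  have hge : ∀ m, (∫ t in (0:ℝ)..b, g t ^ 2) ≤ ∫ y in Set.Ioc (x m) (x m + b), f y ^ 2 := by
    intro m
    rw [← intervalIntegral.integral_of_le (by linarith)]
    have h1 : ∫ y in (x m)..(x m + b), f y ^ 2 = ∫ t in (0:ℝ)..b, f (x m + t) ^ 2 := by
      rw [intervalIntegral.integral_comp_add_left (fun y => f y ^ 2) (x m), add_zero]
    have h2 : ∫ t in (0:ℝ)..b, f (x m + t) ^ 2 = (μ ^ 2) ^ m * ∫ t in (0:ℝ)..b, g t ^ 2 := by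
      rw [← intervalIntegral.integral_const_mul]
      refine intervalIntegral.integral_congr fun t ht => ?_
      rw [Set.uIcc_of_le hb.le] at ht
      simp only [h m t ht]
      ring
    rw [h1, h2]
    exact le_mul_of_one_le_left hpos.le (one_le_pow₀ hμ)
  have := ge_of_tendsto' hlim hge
  linarith

/-- A continuous function decaying geometrically along consecutive cells is integrable there. -/
lemma integrableOn_of_geometric {f : ℝ → ℝ} (hf : Continuous f) {c C ρ : ℝ} (hc : 0 < c)
    (hρ0 : 0 ≤ ρ) (hρ : ρ < 1) (x : ℕ → ℝ)
    (h : ∀ m, ∀ t ∈ Set.Icc 0 c, |f (x m + t)| ≤ C * ρ ^ m) :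
    IntegrableOn f (⋃ m, Set.Ioc (x m) (x m + c)) := by
  refine integrableOn_iUnion_of_summable_integral_norm (fun m => ?_) ?_
  · exact (hf.integrableOn_Icc (a := x m) (b := x m + c)).mono_set Set.Ioc_subset_Icc_self
  · refine Summable.of_nonneg_of_le (fun m => by positivity) (fun m => ?_)
      ((summable_geometric_of_lt_one hρ0 hρ).mul_left (C * c))
    have h1 : ∀ y ∈ Set.Ioc (x m) (x m + c), ‖‖f y‖‖ ≤ C * ρ ^ m := fun y hy => by
      have := h m (y - x m) ⟨by linarith [hy.1], by linarith [hy.2]⟩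
      simpa using this
    have h2 := norm_setIntegral_le_of_norm_le_const (μ := volume)
      (show volume (Set.Ioc (x m) (x m + c)) < ⊤ by simp) h1
    refine (le_abs_self _).trans (h2.trans (le_of_eq ?_))
    simp [Measure.real, hc.le]
    ring

lemma IsStepPotential.solvesCell {A b E p r : ℝ} {f u w : ℝ → ℝ} (h : IsStepPotential A b f)
    (hp : p ^ 2 = E + A) (hr : r ^ 2 = E - A) (hs : IsSolutionPair f E (jumpSet b) u w) (m : ℤ) :
    SolvesCell b p r u w (m * (2 * b)) := by
  have hb := h.pos
  refine ⟨fun x hx => ?_, fun x hx => ?_⟩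
  · convert hs.deriv_snd x (not_mem_jumpSet hb (2 * m) ?_ ?_) using 1
    · rw [h.eq_low m hx.1.le hx.2, hp]; ring
    · push_cast; linarith [hx.1]
    · push_cast; linarith [hx.2]
  · convert hs.deriv_snd x (not_mem_jumpSet hb (2 * m + 1) ?_ ?_) using 1
    · rw [h.eq_high m hx.1.le (by linarith [hx.2]), hr]; ring
    · push_cast; linarith [hx.1]
    · push_cast; linarith [hx.2]

/-- The potential with a defect inserted in `(0, 1)`. -/
structure IsDefectPotential (A b Q : ℝ) (qp q : ℝ → ℝ) : Prop where
  step : IsStepPotential A b qp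
  eq : ∀ x, q x = if x ≤ 0 then qp x else if x < 1 then Q else qp (x - 1)

/-- The points where the potential with a defect may fail to be continuous. -/
def defectJumpSet (b : ℝ) : Set ℝ :=
  {x | ¬(x < 0 ∧ x ∉ jumpSet b) ∧ ¬(0 < x ∧ x < 1) ∧ ¬(1 < x ∧ x - 1 ∉ jumpSet b)}

lemma countable_defectJumpSet (b : ℝ) : (defectJumpSet b).Countable := by
  refine (((countable_jumpSet b).union (Set.countable_insert.2 (Set.countable_singleton (1:ℝ)))).union
    ((countable_jumpSet b).image fun x => x + 1)).mono
    (s₂ := (jumpSet b ∪ {0, 1}) ∪ (fun x => x + 1) '' jumpSet b) ?_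
  rintro x ⟨h1, h2, h3⟩
  by_cases hx0 : x = 0
  · simp [hx0]
  by_cases hx1 : x = 1
  · simp [hx1]
  rcases lt_or_gt_of_ne hx0 with hlt | hgt
  · left; left
    by_contra hc
    exact h1 ⟨hlt, hc⟩
  · rcases lt_or_gt_of_ne hx1 with hlt | hgt'
    · exact absurd ⟨hgt, hlt⟩ h2
    · right
      refine ⟨x - 1, ?_, by ring⟩
      by_contra hc
      exact h3 ⟨hgt', hc⟩

namespace IsDefectPotential

variable {A b Q E p r : ℝ} {qp q u w : ℝ → ℝ}

lemma measurable (h : IsDefectPotential A b Q qp q) : Measurable q := by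
  rw [funext h.eq]
  exact Measurable.ite measurableSet_Iic h.step.measurable
    (Measurable.ite measurableSet_Iio measurable_const
      (h.step.measurable.comp (measurable_id.sub_const 1)))

lemma intervalIntegrable (h : IsDefectPotential A b Q qp q) (x y : ℝ) :
    IntervalIntegrable q volume x y := by
  refine intervalIntegrable_of_measurable_bounded h.measurable (C := |A| + |Q|) (fun x => ?_) x y
  have h1 := h.step.abs_le x
  have h2 := h.step.abs_le (x - 1)
  have h3 := abs_nonneg A
  have h4 := abs_nonneg Q
  rw [h.eq]
  split_ifs <;> linarith

lemma eq_left (h : IsDefectPotential A b Q qp q) {x : ℝ} (hx : x < 0) : q x = qp x := by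
  rw [h.eq, if_pos hx.le]

lemma eq_mid (h : IsDefectPotential A b Q qp q) {x : ℝ} (h0 : 0 < x) (h1 : x < 1) : q x = Q := by
  rw [h.eq, if_neg (not_le.2 h0), if_pos h1]

lemma eq_right (h : IsDefectPotential A b Q qp q) {x : ℝ} (hx : 1 < x) : q x = qp (x - 1) := by
  rw [h.eq, if_neg (by linarith), if_neg (by linarith)]

lemma continuousAt (h : IsDefectPotential A b Q qp q) {x : ℝ} (hx : x ∉ defectJumpSet b) :
    ContinuousAt q x := by
  have hcases : (x < 0 ∧ x ∉ jumpSet b) ∨ (0 < x ∧ x < 1) ∨ (1 < x ∧ x - 1 ∉ jumpSet b) := by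
    by_contra hc
    exact hx ⟨fun h => hc (.inl h), fun h => hc (.inr (.inl h)), fun h => hc (.inr (.inr h))⟩
  rcases hcases with ⟨h1, h2⟩ | ⟨h1, h2⟩ | ⟨h1, h2⟩
  · refine (h.step.continuousAt h2).congr ?_
    filter_upwards [Iio_mem_nhds h1] with y hy
    exact (h.eq_left hy).symm
  · refine (continuousAt_const (y := Q)).congr ?_
    filter_upwards [Ioo_mem_nhds h1 h2] with y hy
    exact (h.eq_mid hy.1 hy.2).symm
  · have h3 : ContinuousAt (fun y => qp (y - 1)) x :=
      ContinuousAt.comp (f := fun y : ℝ => y - 1) (h.step.continuousAt h2) (by fun_prop)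
    refine h3.congr ?_
    filter_upwards [Ioi_mem_nhds h1] with y hy
    exact (h.eq_right hy).symm

lemma solvesCell_left (h : IsDefectPotential A b Q qp q)
    (hp : p ^ 2 = E + A) (hr : r ^ 2 = E - A)
    (hs : IsSolutionPair q E (defectJumpSet b) u w) (m : ℕ) :
    SolvesCell b p r u w (-((m : ℝ) + 1) * (2 * b)) := by
  have hb := h.step.pos
  have hm : 0 ≤ (m : ℝ) * b := by positivity
  have hcast : ((-((m : ℤ) + 1) : ℤ) : ℝ) = -((m : ℝ) + 1) := by push_cast; ring
  have key : ∀ x, ∀ j : ℤ, x < 0 → j * b < x → x < j * b + b →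
      HasDerivAt w ((qp x - E) * u x) x := fun x j h0 h1 h2 => by
    rw [← h.eq_left h0]
    exact hs.deriv_snd x fun hx => hx.1 ⟨h0, not_mem_jumpSet hb j h1 h2⟩
  refine ⟨fun x hx => ?_, fun x hx => ?_⟩
  · convert key x (2 * -((m : ℤ) + 1)) (by nlinarith [hx.2]) ?_ ?_ using 1
    · rw [h.step.eq_low (-((m : ℤ) + 1)) (by rw [hcast]; exact hx.1.le)
        (by rw [hcast]; exact hx.2), hp]; ring
    · push_cast; linarith [hx.1]
    · push_cast; linarith [hx.2]
  · convert key x (2 * -((m : ℤ) + 1) + 1) (by nlinarith [hx.2]) ?_ ?_ using 1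
    · rw [h.step.eq_high (-((m : ℤ) + 1)) (by rw [hcast]; exact hx.1.le)
        (by rw [hcast]; linarith [hx.2]), hr]; ring
    · push_cast; linarith [hx.1]
    · push_cast; linarith [hx.2]

lemma solvesCell_right (h : IsDefectPotential A b Q qp q)
    (hp : p ^ 2 = E + A) (hr : r ^ 2 = E - A)
    (hs : IsSolutionPair q E (defectJumpSet b) u w) (m : ℕ) :
    SolvesCell b p r u w (1 + m * (2 * b)) := by
  have hb := h.step.pos
  have hm : 0 ≤ (m : ℝ) * b := by positivity
  have key : ∀ x, ∀ j : ℤ, 1 < x → j * b < x - 1 → x - 1 < j * b + b →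
      HasDerivAt w ((qp (x - 1) - E) * u x) x := fun x j h0 h1 h2 => by
    rw [← h.eq_right h0]
    exact hs.deriv_snd x fun hx => hx.2.2 ⟨h0, not_mem_jumpSet hb j h1 h2⟩
  refine ⟨fun x hx => ?_, fun x hx => ?_⟩
  · convert key x (2 * (m : ℤ)) (by nlinarith [hx.1]) ?_ ?_ using 1
    · rw [h.step.eq_low (m : ℤ) (by push_cast; linarith [hx.1])
        (by push_cast; linarith [hx.2]), hp]; ring
    · push_cast; linarith [hx.1]
    · push_cast; linarith [hx.2]
  · convert key x (2 * (m : ℤ) + 1) (by nlinarith [hx.1]) ?_ ?_ using 1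
    · rw [h.step.eq_high (m : ℤ) (by push_cast; linarith [hx.1])
        (by push_cast; linarith [hx.2]), hr]; ring
    · push_cast; linarith [hx.1]
    · push_cast; linarith [hx.2]

end IsDefectPotential

lemma eq_zero_of_expanding_cells {f : ℝ → ℝ} (hf : Integrable fun x => f x ^ 2) {b p μ : ℝ}
    (hb : 0 < b) (hp : 0 < p) (hμ : 1 ≤ μ ^ 2) (x : ℕ → ℝ)
    (hx : Pairwise (Function.onFun Disjoint fun m => Set.Ioc (x m) (x m + b))) (α β : ℕ → ℝ)
    (hα : ∀ m, α (m + 1) = μ * α m) (hβ : ∀ m, β (m + 1) = μ * β m)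
    (h : ∀ m, ∀ t ∈ Set.Icc 0 b,
      f (x m + t) = Real.cos (p * t) * α m + Real.sin (p * t) / p * β m) :
    α 0 = 0 ∧ β 0 = 0 := by
  have hα' : ∀ m, α m = μ ^ m * α 0 := fun m => by
    induction m with
    | zero => simp
    | succ n ih => rw [hα, ih]; ring
  have hβ' : ∀ m, β m = μ ^ m * β 0 := fun m => by
    induction m with
    | zero => simp
    | succ n ih => rw [hβ, ih]; ring
  have key : ∀ t ∈ Set.Icc 0 b, Real.cos (p * t) * α 0 + Real.sin (p * t) / p * β 0 = 0 :=
    fun t ht => eq_zero_of_expanding hf (g := fun t =>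
      Real.cos (p * t) * α 0 + Real.sin (p * t) / p * β 0) hb hμ x hx (by fun_prop)
      (fun m t ht => by rw [h m t ht, hα' m, hβ' m]; ring) ht
  have h0 : α 0 = 0 := by simpa using key 0 ⟨le_rfl, hb.le⟩
  refine ⟨h0, ?_⟩
  have hπ := Real.pi_pos
  have ht0 : 0 < min b (Real.pi / (2 * p)) := lt_min hb (by positivity)
  have h1 := key (min b (Real.pi / (2 * p))) ⟨ht0.le, min_le_left _ _⟩
  have h2 : p * min b (Real.pi / (2 * p)) ≤ Real.pi / 2 := by
    calc p * min b (Real.pi / (2 * p)) ≤ p * (Real.pi / (2 * p)) := by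
          gcongr; exact min_le_right _ _
      _ = Real.pi / 2 := by field_simp
  have h3 : 0 < Real.sin (p * min b (Real.pi / (2 * p))) :=
    Real.sin_pos_of_pos_of_lt_pi (by positivity) (by linarith)
  rw [h0, mul_zero, zero_add] at h1
  rcases mul_eq_zero.1 h1 with h4 | h4
  · exact absurd h4 (div_pos h3 hp).ne'
  · exact h4

lemma pairwise_disjoint_cells {b : ℝ} (hb : 0 < b) (c : ℝ) (ε : ℤ) (d : ℤ) (hε : ε ≠ 0) :
    Pairwise (Function.onFun Disjoint fun m : ℕ =>
      Set.Ioc (c + ((ε * m + d : ℤ) : ℝ) * (2 * b)) (c + ((ε * m + d : ℤ) : ℝ) * (2 * b) + b)) := by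
  intro m n hmn
  rw [Function.onFun, Set.disjoint_left]
  rintro x ⟨h1, h2⟩ ⟨h3, h4⟩
  have hne : ε * (m : ℤ) + d ≠ ε * n + d := by
    intro he
    have : ε * ((m : ℤ) - n) = 0 := by linarith
    rcases mul_eq_zero.1 this with h | h
    · exact hε h
    · exact hmn (by omega)
  generalize ε * (m : ℤ) + d = i at *
  generalize ε * (n : ℤ) + d = j at *
  rcases lt_or_gt_of_ne hne with h | h
  · have : (i : ℝ) + 1 ≤ j := by exact_mod_cast h
    nlinarith
  · have : (j : ℝ) + 1 ≤ i := by exact_mod_cast h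
    nlinarith

lemma integrable_sq_shift {u : ℝ → ℝ} (hu : Continuous u) (hi : Integrable fun x => u x ^ 2)
    (c l : ℝ) : Integrable fun x => (u (x + c) - l * u x) ^ 2 := by
  have h1 : Integrable fun x => u (x + c) ^ 2 := hi.comp_add_right c
  refine ((h1.const_mul 2).add (hi.const_mul (2 * l ^ 2))).mono'
    (by fun_prop) (Filter.Eventually.of_forall fun x => ?_)
  rw [Real.norm_of_nonneg (sq_nonneg _)]
  simp only [Pi.add_apply]
  nlinarith [sq_nonneg (u (x + c) + l * u x)]

namespace IsDefectPotential

variable {A b Q E p r κ lam mu : ℝ} {qp q u w : ℝ → ℝ}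

/-- A square-integrable solution has its data at `1` in the contracting eigenspace. -/
lemma right_data (h : IsDefectPotential A b Q qp q) (hp0 : 0 < p) (hr0 : 0 < r)
    (hp : p ^ 2 = E + A) (hr : r ^ 2 = E - A)
    (hsum : lam + mu = monodromy b p r 0 0 + monodromy b p r 1 1) (hprod : lam * mu = 1)
    (hmu : 1 ≤ mu ^ 2)
    (hs : IsSolutionPair q E (defectJumpSet b) u w) (hi : Integrable fun x => u x ^ 2) :
    monodromy b p r 0 0 * u 1 + monodromy b p r 0 1 * w 1 = lam * u 1 ∧
      monodromy b p r 1 0 * u 1 + monodromy b p r 1 1 * w 1 = lam * w 1 := by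
  have hb := h.step.pos
  have hdet := det_monodromy (b := b) hp0.ne' hr0.ne'
  have hstep : ∀ m : ℕ, _ := fun m =>
    (h.solvesCell_right hp hr hs m).step hb hp0.ne' hr0.ne' hs.deriv_fst hs.cont_snd
  have hhalf : ∀ m : ℕ, ∀ t ∈ Set.Icc 0 b, _ := fun m t ht =>
    (propagate hp0.ne' hs.deriv_fst hs.cont_snd (h.solvesCell_right hp hr hs m).1 ht).1
  have hnext : ∀ m : ℕ, 1 + (m : ℝ) * (2 * b) + 2 * b = 1 + ((m + 1 : ℕ) : ℝ) * (2 * b) :=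
    fun m => by push_cast; ring
  have hx0 : 1 + ((0 : ℕ) : ℝ) * (2 * b) = 1 := by simp
  have h01 := hstep 0
  simp only [hnext] at hstep
  generalize monodromy b p r 0 0 = a₁ at *
  generalize monodromy b p r 0 1 = a₂ at *
  generalize monodromy b p r 1 0 = a₃ at *
  generalize monodromy b p r 1 1 = a₄ at *
  have key := eq_zero_of_expanding_cells (integrable_sq_shift hs.cont_fst hi (2 * b) lam) hb hp0 hmu
    (fun m => 1 + (m : ℝ) * (2 * b))
    (by simpa using pairwise_disjoint_cells hb 1 1 0 one_ne_zero)
    (fun m => u (1 + ((m + 1 : ℕ) : ℝ) * (2 * b)) - lam * u (1 + (m : ℝ) * (2 * b)))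
    (fun m => w (1 + ((m + 1 : ℕ) : ℝ) * (2 * b)) - lam * w (1 + (m : ℝ) * (2 * b)))
    (fun m => by
      obtain ⟨e1, e2⟩ := hstep m
      obtain ⟨e3, e4⟩ := hstep (m + 1)
      rw [e3, e1, e2]
      generalize u (1 + (m : ℝ) * (2 * b)) = U
      generalize w (1 + (m : ℝ) * (2 * b)) = W
      linear_combination (-(a₁ * U + a₂ * W)) * hsum - U * hdet + U * hprod)
    (fun m => by
      obtain ⟨e1, e2⟩ := hstep m
      obtain ⟨e3, e4⟩ := hstep (m + 1)
      rw [e4, e1, e2]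
      generalize u (1 + (m : ℝ) * (2 * b)) = U
      generalize w (1 + (m : ℝ) * (2 * b)) = W
      linear_combination (-(a₃ * U + a₄ * W)) * hsum - W * hdet + W * hprod)
    (fun m t ht => by
      have e1 := hhalf m t ht
      have e2 := hhalf (m + 1) t ht
      rw [← hnext m] at e2 ⊢
      rw [show 1 + (m : ℝ) * (2 * b) + t + 2 * b = 1 + (m : ℝ) * (2 * b) + 2 * b + t by ring,
        e1, e2]
      ring)
  obtain ⟨k1, k2⟩ := key
  obtain ⟨e1, e2⟩ := hstep 0
  simp only [e1, e2, hx0] at k1 k2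
  exact ⟨by linarith, by linarith⟩

/-- A square-integrable solution has its data at `0` in the expanding eigenspace. -/
lemma left_data (h : IsDefectPotential A b Q qp q) (hp0 : 0 < p) (hr0 : 0 < r)
    (hp : p ^ 2 = E + A) (hr : r ^ 2 = E - A)
    (hsum : lam + mu = monodromy b p r 0 0 + monodromy b p r 1 1) (hprod : lam * mu = 1)
    (hmu : 1 ≤ mu ^ 2)
    (hs : IsSolutionPair q E (defectJumpSet b) u w) (hi : Integrable fun x => u x ^ 2) :
    monodromy b p r 0 0 * u 0 + monodromy b p r 0 1 * w 0 = mu * u 0 ∧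
      monodromy b p r 1 0 * u 0 + monodromy b p r 1 1 * w 0 = mu * w 0 := by
  have hb := h.step.pos
  have hdet := det_monodromy (b := b) hp0.ne' hr0.ne'
  have hnext : ∀ m : ℕ, -((m + 1 : ℕ) : ℝ) * (2 * b) + 2 * b = -(m : ℝ) * (2 * b) :=
    fun m => by push_cast; ring
  have hcast : ∀ m : ℕ, -((m : ℝ) + 1) * (2 * b) = -((m + 1 : ℕ) : ℝ) * (2 * b) :=
    fun m => by push_cast; ring
  have hstep : ∀ m : ℕ, _ := fun m =>
    (h.solvesCell_left hp hr hs m).step hb hp0.ne' hr0.ne' hs.deriv_fst hs.cont_snd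
  have hhalf : ∀ m : ℕ, ∀ t ∈ Set.Icc 0 b, _ := fun m t ht =>
    (propagate hp0.ne' hs.deriv_fst hs.cont_snd (h.solvesCell_left hp hr hs m).1 ht).1
  simp only [hcast, hnext] at hstep hhalf
  generalize monodromy b p r 0 0 = a₁ at *
  generalize monodromy b p r 0 1 = a₂ at *
  generalize monodromy b p r 1 0 = a₃ at *
  generalize monodromy b p r 1 1 = a₄ at *
  have key := eq_zero_of_expanding_cells (integrable_sq_shift hs.cont_fst hi (2 * b) mu) hb hp0 hmu
    (fun m => -((m + 1 + 1 : ℕ) : ℝ) * (2 * b))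
    (by
      have := pairwise_disjoint_cells hb 0 (-1) (-2) (by norm_num)
      convert this using 4 <;> push_cast <;> ring)
    (fun m => u (-((m + 1 : ℕ) : ℝ) * (2 * b)) - mu * u (-((m + 1 + 1 : ℕ) : ℝ) * (2 * b)))
    (fun m => w (-((m + 1 : ℕ) : ℝ) * (2 * b)) - mu * w (-((m + 1 + 1 : ℕ) : ℝ) * (2 * b)))
    (fun m => by
      obtain ⟨e1, e2⟩ := hstep (m + 1)
      obtain ⟨e3, e4⟩ := hstep (m + 1 + 1)
      rw [e1, e3, e4]
      generalize u (-((m + 1 + 1 + 1 : ℕ) : ℝ) * (2 * b)) = U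
      generalize w (-((m + 1 + 1 + 1 : ℕ) : ℝ) * (2 * b)) = W
      linear_combination (mu * (a₁ * U + a₂ * W)) * hsum + mu * U * hdet
        - (a₁ * U + a₂ * W) * hprod)
    (fun m => by
      obtain ⟨e1, e2⟩ := hstep (m + 1)
      obtain ⟨e3, e4⟩ := hstep (m + 1 + 1)
      rw [e2, e3, e4]
      generalize u (-((m + 1 + 1 + 1 : ℕ) : ℝ) * (2 * b)) = U
      generalize w (-((m + 1 + 1 + 1 : ℕ) : ℝ) * (2 * b)) = W
      linear_combination (mu * (a₃ * U + a₄ * W)) * hsum + mu * W * hdet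
        - (a₃ * U + a₄ * W) * hprod)
    (fun m t ht => by
      have e1 := hhalf m t ht
      have e2 := hhalf (m + 1) t ht
      rw [show -((m + 1 + 1 : ℕ) : ℝ) * (2 * b) + t + 2 * b = -((m + 1 : ℕ) : ℝ) * (2 * b) + t by
        push_cast; ring, e1, e2]
      ring)
  obtain ⟨k1, k2⟩ := key
  obtain ⟨e1, e2⟩ := hstep 0
  obtain ⟨e3, e4⟩ := hstep 1
  have hx0 : -((0 : ℕ) : ℝ) * (2 * b) = 0 := by simp
  rw [hx0] at e1 e2
  simp only [zero_add, one_add_one_eq_two] at k1 k2 e1 e2 e3 e4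
  have hu : u 0 = mu * u (-((1 : ℕ) : ℝ) * (2 * b)) := by
    linear_combination e1 - mu * e3 + a₁ * k1 + a₂ * k2
  have hw : w 0 = mu * w (-((1 : ℕ) : ℝ) * (2 * b)) := by
    linear_combination e2 - mu * e4 + a₃ * k1 + a₄ * k2
  exact ⟨by linear_combination a₁ * hu + a₂ * hw - mu * e1,
    by linear_combination a₃ * hu + a₄ * hw - mu * e2⟩

end IsDefectPotential

namespace IsDefectPotential

variable {A b Q E p r κ lam mu : ℝ} {qp q u w : ℝ → ℝ}

lemma right_bound (h : IsDefectPotential A b Q qp q) (hp0 : 0 < p) (hr0 : 0 < r)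
    (hp : p ^ 2 = E + A) (hr : r ^ 2 = E - A)
    (hs : IsSolutionPair q E (defectJumpSet b) u w)
    (h1 : monodromy b p r 0 0 * u 1 + monodromy b p r 0 1 * w 1 = lam * u 1)
    (h2 : monodromy b p r 1 0 * u 1 + monodromy b p r 1 1 * w 1 = lam * w 1)
    (m : ℕ) {t : ℝ} (ht : t ∈ Set.Icc 0 (2 * b)) :
    |u (1 + m * (2 * b) + t)| ≤
      (1 + r + 1 / r) * (1 + p + 1 / p) * (|u 1| + |w 1|) * |lam| ^ m := by
  have hb := h.step.pos
  have hm : ∀ m : ℕ, u (1 + m * (2 * b)) = lam ^ m * u 1 ∧ w (1 + m * (2 * b)) = lam ^ m * w 1 :=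
      fun m => by
    induction m with
    | zero => simp
    | succ m ih =>
      obtain ⟨e1, e2⟩ :=
        (h.solvesCell_right hp hr hs m).step hb hp0.ne' hr0.ne' hs.deriv_fst hs.cont_snd
      rw [ih.1, ih.2] at e1 e2
      rw [show 1 + ((m + 1 : ℕ) : ℝ) * (2 * b) = 1 + m * (2 * b) + 2 * b by push_cast; ring, e1, e2,
        pow_succ]
      exact ⟨by linear_combination lam ^ m * h1, by linear_combination lam ^ m * h2⟩
  refine ((h.solvesCell_right hp hr hs m).bound hb hp0 hr0 hs.deriv_fst hs.cont_snd ht).trans_eq ?_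
  rw [(hm m).1, (hm m).2, abs_mul, abs_mul, abs_pow]
  ring

lemma left_bound (h : IsDefectPotential A b Q qp q) (hp0 : 0 < p) (hr0 : 0 < r)
    (hp : p ^ 2 = E + A) (hr : r ^ 2 = E - A)
    (hsum : lam + mu = monodromy b p r 0 0 + monodromy b p r 1 1)
    (hs : IsSolutionPair q E (defectJumpSet b) u w)
    (h1 : monodromy b p r 0 0 * u 0 + monodromy b p r 0 1 * w 0 = mu * u 0)
    (h2 : monodromy b p r 1 0 * u 0 + monodromy b p r 1 1 * w 0 = mu * w 0)
    (m : ℕ) {t : ℝ} (ht : t ∈ Set.Icc 0 (2 * b)) :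
    |u (-((m : ℝ) + 1) * (2 * b) + t)| ≤
      (1 + r + 1 / r) * (1 + p + 1 / p) * (|u 0| + |w 0|) * |lam| ^ (m + 1) := by
  have hb := h.step.pos
  have hdet := det_monodromy (b := b) hp0.ne' hr0.ne'
  have hm : ∀ m : ℕ, u (-(m : ℝ) * (2 * b)) = lam ^ m * u 0 ∧
      w (-(m : ℝ) * (2 * b)) = lam ^ m * w 0 := fun m => by
    induction m with
    | zero => simp
    | succ m ih =>
      obtain ⟨e1, e2⟩ :=
        (h.solvesCell_left hp hr hs m).step hb hp0.ne' hr0.ne' hs.deriv_fst hs.cont_snd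
      rw [show -((m : ℝ) + 1) * (2 * b) + 2 * b = -(m : ℝ) * (2 * b) by ring, ih.1] at e1
      rw [show -((m : ℝ) + 1) * (2 * b) + 2 * b = -(m : ℝ) * (2 * b) by ring, ih.2] at e2
      push_cast
      rw [neg_add, ← sub_eq_add_neg, show -(m : ℝ) - 1 = -((m : ℝ) + 1) by ring, pow_succ]
      generalize monodromy b p r 0 0 = a₁ at *
      generalize monodromy b p r 0 1 = a₂ at *
      generalize monodromy b p r 1 0 = a₃ at *
      generalize monodromy b p r 1 1 = a₄ at *
      generalize u (-((m : ℝ) + 1) * (2 * b)) = U at *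
      generalize w (-((m : ℝ) + 1) * (2 * b)) = W at *
      constructor
      · linear_combination -U * hdet - a₄ * e1 + a₂ * e2 - lam ^ m * h1 - lam ^ m * u 0 * hsum
      · linear_combination -W * hdet + a₃ * e1 - a₁ * e2 - lam ^ m * h2 - lam ^ m * w 0 * hsum
  have hcast : -((m : ℝ) + 1) * (2 * b) = -((m + 1 : ℕ) : ℝ) * (2 * b) := by push_cast; ring
  refine ((h.solvesCell_left hp hr hs m).bound hb hp0 hr0 hs.deriv_fst hs.cont_snd ht).trans_eq ?_
  rw [hcast, (hm (m + 1)).1, (hm (m + 1)).2, abs_mul, abs_mul, abs_pow]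
  ring

lemma mem_cell_right {b x : ℝ} (hb : 0 < b) (hx : 1 < x) :
    ∃ m : ℕ, x ∈ Set.Ioc (1 + (m : ℝ) * (2 * b)) (1 + m * (2 * b) + 2 * b) := by
  have h2 : 0 < 2 * b := by linarith
  have hpos : 0 < (x - 1) / (2 * b) := div_pos (by linarith) h2
  obtain ⟨m, hm⟩ := Nat.exists_eq_succ_of_ne_zero (Nat.ceil_pos.2 hpos).ne'
  obtain ⟨h3, h4⟩ := (Nat.ceil_eq_iff (Nat.succ_ne_zero m)).1 hm
  rw [Nat.succ_sub_one, lt_div_iff₀ h2] at h3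
  rw [div_le_iff₀ h2] at h4
  push_cast at h4
  exact ⟨m, by linarith, by linarith⟩

lemma mem_cell_left {b x : ℝ} (hb : 0 < b) (hx : x ≤ 0) :
    ∃ m : ℕ, x ∈ Set.Ioc (-((m : ℝ) + 1) * (2 * b)) (-((m : ℝ) + 1) * (2 * b) + 2 * b) := by
  have h2 : 0 < 2 * b := by linarith
  have hpos : 0 ≤ -x / (2 * b) := div_nonneg (by linarith) h2.le
  have h3 := (le_div_iff₀ h2).1 (Nat.floor_le hpos)
  have h4 := (div_lt_iff₀ h2).1 (Nat.lt_floor_add_one (-x / (2 * b)))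
  exact ⟨⌊-x / (2 * b)⌋₊, by linarith, by linarith⟩

lemma propagate_mid (h : IsDefectPotential A b Q qp q) (hκ0 : κ ≠ 0) (hκ : κ ^ 2 = E - Q)
    (hs : IsSolutionPair q E (defectJumpSet b) u w) {t : ℝ} (ht : t ∈ Set.Icc 0 1) :
    u t = Real.cos (κ * t) * u 0 + Real.sin (κ * t) / κ * w 0 ∧
      w t = -(κ * Real.sin (κ * t)) * u 0 + Real.cos (κ * t) * w 0 := by
  have := propagate hκ0 hs.deriv_fst hs.cont_snd (x₀ := 0) (l := 1) (fun x hx => ?_) ht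
  · simpa using this
  · rw [zero_add] at hx
    refine (hs.deriv_snd x fun hx' => hx'.2.1 hx).congr_deriv ?_
    rw [h.eq_mid hx.1 hx.2, hκ]
    ring

lemma eq_zero_of_initial (h : IsDefectPotential A b Q qp q) (hp0 : 0 < p) (hr0 : 0 < r)
    (hκ0 : κ ≠ 0) (hp : p ^ 2 = E + A) (hr : r ^ 2 = E - A) (hκ : κ ^ 2 = E - Q)
    (hs : IsSolutionPair q E (defectJumpSet b) u w) (hu : u 0 = 0) (hw : w 0 = 0) : u = 0 := by
  have hb := h.step.pos
  funext x
  rw [Pi.zero_apply, ← abs_nonpos_iff]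
  rcases le_or_gt x 0 with hx | hx
  · obtain ⟨m, h1, h2⟩ := mem_cell_left hb hx
    have := h.left_bound hp0 hr0 hp hr (sub_add_cancel _ 1) hs (by simp [hu, hw])
      (by simp [hu, hw]) m (t := x - -((m : ℝ) + 1) * (2 * b)) ⟨by linarith, by linarith⟩
    simpa [hu, hw] using this
  rcases le_or_gt x 1 with hx1 | hx1
  · rw [(h.propagate_mid hκ0 hκ hs ⟨hx.le, hx1⟩).1, hu, hw]
    simp
  · obtain ⟨e1, e2⟩ := h.propagate_mid hκ0 hκ hs (t := 1) ⟨zero_le_one, le_rfl⟩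
    rw [hu, hw, mul_zero, mul_zero, add_zero] at e1 e2
    obtain ⟨m, h1, h2⟩ := mem_cell_right hb hx1
    have := h.right_bound hp0 hr0 hp hr hs (lam := 1) (by simp [e1, e2])
      (by simp [e1, e2]) m (t := x - (1 + (m : ℝ) * (2 * b))) ⟨by linarith, by linarith⟩
    simpa [e1, e2] using this

lemma integrable_sq (h : IsDefectPotential A b Q qp q) (hp0 : 0 < p) (hr0 : 0 < r)
    (hp : p ^ 2 = E + A) (hr : r ^ 2 = E - A)
    (hsum : lam + mu = monodromy b p r 0 0 + monodromy b p r 1 1) (hlam : lam ^ 2 < 1)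
    (hs : IsSolutionPair q E (defectJumpSet b) u w)
    (h1 : monodromy b p r 0 0 * u 1 + monodromy b p r 0 1 * w 1 = lam * u 1)
    (h2 : monodromy b p r 1 0 * u 1 + monodromy b p r 1 1 * w 1 = lam * w 1)
    (h3 : monodromy b p r 0 0 * u 0 + monodromy b p r 0 1 * w 0 = mu * u 0)
    (h4 : monodromy b p r 1 0 * u 0 + monodromy b p r 1 1 * w 0 = mu * w 0) :
    Integrable fun x => u x ^ 2 := by
  have hb := h.step.pos
  have hc : Continuous fun x => u x ^ 2 := hs.cont_fst.pow 2
  set K := (1 + r + 1 / r) * (1 + p + 1 / p)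
  have hR := integrableOn_of_geometric hc (C := (K * (|u 1| + |w 1|)) ^ 2) (c := 2 * b)
    (by linarith) (sq_nonneg lam) hlam (fun m => 1 + m * (2 * b)) (fun m t ht => by
      rw [abs_pow]
      refine (pow_le_pow_left₀ (abs_nonneg _)
        (h.right_bound hp0 hr0 hp hr hs h1 h2 m ht) 2).trans_eq ?_
      rw [← sq_abs lam]
      ring)
  have hL := integrableOn_of_geometric hc (C := (K * (|u 0| + |w 0|) * |lam|) ^ 2) (c := 2 * b)
    (by linarith) (sq_nonneg lam) hlam (fun m => -((m : ℝ) + 1) * (2 * b)) (fun m t ht => by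
      rw [abs_pow]
      refine (pow_le_pow_left₀ (abs_nonneg _)
        (h.left_bound hp0 hr0 hp hr hsum hs h3 h4 m ht) 2).trans_eq ?_
      rw [← sq_abs lam]
      ring)
  have hM : IntegrableOn (fun x => u x ^ 2) (Set.Icc 0 1) := hc.integrableOn_Icc
  rw [← integrableOn_univ]
  refine ((hL.union hM).union hR).mono_set fun x _ => ?_
  rcases le_or_gt x 0 with hx | hx
  · exact .inl (.inl (Set.mem_iUnion.2 (mem_cell_left hb hx)))
  rcases le_or_gt x 1 with hx1 | hx1
  · exact .inl (.inr ⟨hx.le, hx1⟩)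
  · exact .inr (Set.mem_iUnion.2 (mem_cell_right hb hx1))

lemma exists_solution (h : IsDefectPotential A b Q qp q) (hκ0 : κ ≠ 0) (hκ : κ ^ 2 = E - Q)
    {W : ℝ → Matrix (Fin 2) (Fin 2) ℝ} (hW : IsFundamentalSolution qp E W) (v₁ v₂ : ℝ) :
    ∃ u w, IsSolutionPair q E (defectJumpSet b) u w ∧ u 0 = v₁ ∧ w 0 = v₂ := by
  have hcol := hW.column h.step.measurable h.step.intervalIntegrable
    (fun x hx => h.step.continuousAt hx)
  have hex : ∀ v₁ v₂ : ℝ, ∃ u w, IsSolutionPair qp E (jumpSet b) u w ∧ u 0 = v₁ ∧ w 0 = v₂ :=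
      fun v₁ v₂ => by
    refine ⟨_, _, (hcol 0).lin (hcol 1) v₁ v₂, ?_, ?_⟩
    · simp [hW.2 0]
    · simp [hW.2 0]
  obtain ⟨ul, wl, hl, hul, hwl⟩ := hex v₁ v₂
  obtain ⟨ur, wr, hr, hur, hwr⟩ := hex (Real.cos κ * v₁ + Real.sin κ / κ * v₂)
    (-(κ * Real.sin κ) * v₁ + Real.cos κ * v₂)
  set um : ℝ → ℝ := fun x => Real.cos (κ * x) * v₁ + Real.sin (κ * x) / κ * v₂ with hum
  set wm : ℝ → ℝ := fun x => -(κ * Real.sin (κ * x)) * v₁ + Real.cos (κ * x) * v₂ with hwm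
  have hlin : ∀ x, HasDerivAt (fun y => κ * y) κ x := fun x => by
    simpa using (hasDerivAt_id x).const_mul κ
  have dum : ∀ x, HasDerivAt um (wm x) x := fun x => by
    refine (((hlin x).cos.mul_const v₁).add
      (((hlin x).sin.div_const κ).mul_const v₂)).congr_deriv ?_
    rw [hwm]
    field_simp
  have dwm : ∀ x, HasDerivAt wm ((Q - E) * um x) x := fun x => by
    refine (((((hlin x).sin.const_mul κ).neg).mul_const v₁).add
      ((hlin x).cos.mul_const v₂)).congr_deriv ?_
    rw [hum, show Q - E = -κ ^ 2 by rw [hκ]; ring]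
    field_simp
    ring
  have dur : ∀ x, HasDerivAt (fun x => ur (x - 1)) (wr (x - 1)) x := fun x =>
    (hr.deriv_fst (x - 1)).comp_sub_const x 1
  have g1 := hasDerivAt_glue 0 hl.deriv_fst dum (by simp [hum, hul]) (by simp [hwm, hwl])
  have g2 := hasDerivAt_glue 1 g1 dur (by simp [hum, hur]) (by simp [hwm, hwr])
  refine ⟨_, _, ⟨g2, ?_, fun x hx => ?_⟩, ?_, ?_⟩
  · have c1 : Continuous fun x => if x ≤ 0 then wl x else wm x :=
      Continuous.if_le hl.cont_snd (by fun_prop) continuous_id continuous_const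
        (fun x hx => by subst hx; simp [hwm, hwl])
    exact Continuous.if_le c1 (hr.cont_snd.comp (continuous_sub_right 1)) continuous_id
      continuous_const (fun x hx => by subst hx; simp [hwm, hwr])
  · have hcases : (x < 0 ∧ x ∉ jumpSet b) ∨ (0 < x ∧ x < 1) ∨ (1 < x ∧ x - 1 ∉ jumpSet b) := by
      by_contra hc
      exact hx ⟨fun h => hc (.inl h), fun h => hc (.inr (.inl h)), fun h => hc (.inr (.inr h))⟩
    rcases hcases with ⟨h1, h2⟩ | ⟨h1, h2⟩ | ⟨h1, h2⟩
    · refine (hasDerivAt_glue_left (by linarith)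
        (hasDerivAt_glue_left h1 (hl.deriv_snd x h2))).congr_deriv ?_
      rw [if_pos (by linarith), if_pos h1.le, h.eq_left h1]
    · refine (hasDerivAt_glue_left h2 (hasDerivAt_glue_right h1 (dwm x))).congr_deriv ?_
      rw [if_pos h2.le, if_neg (by linarith), h.eq_mid h1 h2]
    · refine (hasDerivAt_glue_right h1 ((hr.deriv_snd (x - 1) h2).comp_sub_const x 1)).congr_deriv ?_
      rw [if_neg (by linarith), h.eq_right h1]
  · simp [hul]
  · simp [hwl]

/-- Criterion for a defect eigenvalue inside a spectral gap of the periodic problem. -/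
theorem isDefectEigenvalue_iff (h : IsDefectPotential A b Q qp q)
    {W : ℝ → Matrix (Fin 2) (Fin 2) ℝ} (hW : IsFundamentalSolution qp E W) (hp0 : 0 < p)
    (hr0 : 0 < r) (hκ0 : κ ≠ 0) (hp : p ^ 2 = E + A) (hr : r ^ 2 = E - A) (hκ : κ ^ 2 = E - Q)
    (hsum : lam + mu = monodromy b p r 0 0 + monodromy b p r 1 1) (hprod : lam * mu = 1)
    (hmu : 1 < mu ^ 2) :
    IsDefectEigenvalue q E ↔ Real.cos κ * (lam - mu) +
      Real.sin κ * (κ * monodromy b p r 0 1 - monodromy b p r 1 0 / κ) = 0 := by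
  have hdet := det_monodromy (b := b) hp0.ne' hr0.ne'
  have hlam : lam ^ 2 < 1 := by
    have : lam ^ 2 * mu ^ 2 = 1 := by rw [← mul_pow, hprod, one_pow]
    nlinarith [sq_nonneg lam]
  have eigen : ∀ {u w : ℝ → ℝ}, IsSolutionPair q E (defectJumpSet b) u w →
      monodromy b p r 0 0 * u 0 + monodromy b p r 0 1 * w 0 = mu * u 0 →
      monodromy b p r 1 0 * u 0 + monodromy b p r 1 1 * w 0 = mu * w 0 →
      (monodromy b p r 0 0 * u 1 + monodromy b p r 0 1 * w 1 - lam * u 1 =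
        -(Real.cos κ * (lam - mu) +
          Real.sin κ * (κ * monodromy b p r 0 1 - monodromy b p r 1 0 / κ)) * u 0 ∧
      monodromy b p r 1 0 * u 1 + monodromy b p r 1 1 * w 1 - lam * w 1 =
        -(Real.cos κ * (lam - mu) +
          Real.sin κ * (κ * monodromy b p r 0 1 - monodromy b p r 1 0 / κ)) * w 0) := by
    intro u w hs h1 h2
    obtain ⟨e1, e2⟩ := h.propagate_mid hκ0 hκ hs (t := 1) ⟨zero_le_one, le_rfl⟩
    rw [mul_one] at e1 e2
    rw [e1, e2]
    constructor
    · linear_combination Real.cos κ * h1 - Real.sin κ / κ * h2 - Real.sin κ / κ * w 0 * hsum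
    · linear_combination Real.cos κ * h2 + κ * Real.sin κ * h1 + κ * Real.sin κ * u 0 * hsum
  constructor
  · rintro ⟨u, hu, hne, hi, hw⟩
    have hs : IsSolutionPair q E (defectJumpSet b) u (deriv u) :=
      isSolutionPair_of_integral h.measurable h.intervalIntegrable
        (fun x hx => h.continuousAt hx) (fun x => (hu x).hasDerivAt) hw
    obtain ⟨h1, h2⟩ := h.right_data hp0 hr0 hp hr hsum hprod hmu.le hs hi
    obtain ⟨h3, h4⟩ := h.left_data hp0 hr0 hp hr hsum hprod hmu.le hs hi
    obtain ⟨e1, e2⟩ := eigen hs h3 h4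
    by_contra hX
    refine hne (h.eq_zero_of_initial hp0 hr0 hκ0 hp hr hκ hs ?_ ?_)
    · rw [h1, sub_self, eq_comm, mul_eq_zero] at e1
      exact e1.resolve_left (neg_ne_zero.2 hX)
    · rw [h2, sub_self, eq_comm, mul_eq_zero] at e2
      exact e2.resolve_left (neg_ne_zero.2 hX)
  · intro hX
    obtain ⟨v₁, v₂, hv, h1, h2⟩ : ∃ v₁ v₂ : ℝ, ¬(v₁ = 0 ∧ v₂ = 0) ∧
        monodromy b p r 0 0 * v₁ + monodromy b p r 0 1 * v₂ = mu * v₁ ∧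
        monodromy b p r 1 0 * v₁ + monodromy b p r 1 1 * v₂ = mu * v₂ := by
      generalize monodromy b p r 0 0 = a₁ at *
      generalize monodromy b p r 0 1 = a₂ at *
      generalize monodromy b p r 1 0 = a₃ at *
      generalize monodromy b p r 1 1 = a₄ at *
      by_cases hv : a₂ = 0 ∧ mu - a₁ = 0
      · refine ⟨mu - a₄, a₃, fun hv' => ?_, ?_, ?_⟩
        · have : lam = mu := by linarith [hv.2, hv'.1]
          rw [this] at hlam
          linarith
        · linear_combination hprod - hdet - mu * hsum
        · ring
      · refine ⟨a₂, mu - a₁, hv, by ring, ?_⟩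
        linear_combination hprod - hdet - mu * hsum
    obtain ⟨u, w, hs, rfl, rfl⟩ := h.exists_solution hκ0 hκ hW v₁ v₂
    have hw : deriv u = w := funext fun x => (hs.deriv_fst x).deriv
    obtain ⟨e1, e2⟩ := eigen hs h1 h2
    rw [hX, neg_zero, zero_mul, sub_eq_zero] at e1 e2
    refine ⟨u, fun x => (hs.deriv_fst x).differentiableAt, ?_,
      h.integrable_sq hp0 hr0 hp hr hsum hlam hs e1 e2 h1 h2, fun x => ?_⟩
    · rintro rfl
      refine hv ⟨rfl, ?_⟩
      rw [← hw]
      simp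
    · rw [hw]
      exact hs.integral_eq h.intervalIntegrable (countable_defectJumpSet b) x

end IsDefectPotential

/-- The trace of the monodromy matrix over one period. -/
lemma IsStepPotential.trace_fundamental {A b E p r : ℝ} {f : ℝ → ℝ} (h : IsStepPotential A b f)
    {W : ℝ → Matrix (Fin 2) (Fin 2) ℝ} (hW : IsFundamentalSolution f E W) (hp0 : 0 < p)
    (hr0 : 0 < r) (hp : p ^ 2 = E + A) (hr : r ^ 2 = E - A) :
    (W (2 * b)).trace = monodromy b p r 0 0 + monodromy b p r 1 1 := by
  have hcol := hW.column h.measurable h.intervalIntegrable (fun x hx => h.continuousAt hx)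
  have hst := fun j => (h.solvesCell hp hr (hcol j) 0).step h.pos hp0.ne' hr0.ne'
    (hcol j).deriv_fst (hcol j).cont_snd
  have h0 := (hst 0).1
  have h1 := (hst 1).2
  simp only [Int.cast_zero, zero_mul, zero_add] at h0 h1
  rw [Matrix.trace_fin_two, h0, h1]
  simp [hW.2 0]

section Window

variable {A b h s : ℝ}

/-- A small window around `h`, in the parameter `s` with `E = s ^ 2 / 4 + A ^ 2 / s ^ 2`. -/
noncomputable def windowRadius (A b h : ℝ) : ℝ := 8 * A / (b * h ^ 2)

lemma windowRadius_pos (hA : 0 < A) (hb : 0 < b) (hh : 0 < h) : 0 < windowRadius A b h := by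
  unfold windowRadius; positivity

lemma mul_windowRadius (hb : 0 < b) : b * windowRadius A b h = 8 * A / h ^ 2 := by
  unfold windowRadius
  field_simp

lemma tendsto_windowRadius (A b : ℝ) :
    Filter.Tendsto (windowRadius A b) Filter.atTop (nhds 0) := by
  have h1 : Filter.Tendsto (fun h : ℝ => 8 * A / b * (h ^ 2)⁻¹) Filter.atTop (nhds (8 * A / b * 0)) :=
    (tendsto_inv_atTop_zero.comp (Filter.tendsto_pow_atTop two_ne_zero)).const_mul _
  rw [mul_zero] at h1
  refine h1.congr fun h => ?_
  rw [windowRadius, ← div_div, div_eq_mul_inv (8 * A / b)]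

lemma abs_phase_le (hb : 0 < b) (hs : |s - h| ≤ windowRadius A b h) :
    |b * (s - h)| ≤ 8 * A / h ^ 2 := by
  rw [abs_mul, abs_of_pos hb, ← mul_windowRadius hb]
  gcongr

lemma eventually_window_bounds (A b : ℝ) : ∀ᶠ h in Filter.atTop, ∀ s,
    |s - h| ≤ windowRadius A b h → 99 / 100 * h ≤ s ∧ s ≤ 101 / 100 * h := by
  filter_upwards [(tendsto_windowRadius A b).eventually_le_const one_pos,
    Filter.eventually_ge_atTop 100] with h h1 h2 s hs
  obtain ⟨h3, h4⟩ := abs_le.1 hs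
  constructor <;> linarith

lemma Filter.Eventually.window {P : ℝ → Prop} (hP : ∀ᶠ s in Filter.atTop, P s) (A b : ℝ) :
    ∀ᶠ h in Filter.atTop, ∀ s, |s - h| ≤ windowRadius A b h → P s := by
  obtain ⟨S, hS⟩ := Filter.eventually_atTop.1 hP
  filter_upwards [eventually_window_bounds A b, Filter.eventually_ge_atTop (2 * |S|)]
    with h h1 h2 s hs
  have := (h1 s hs).1
  exact hS s (by linarith [le_abs_self S, abs_nonneg S])

/-- The strength of the deviation of the discriminant from `2 * cos (b * s)`. -/
noncomputable def couplingCoeff (A s : ℝ) : ℝ := 8 * A ^ 2 / (s ^ 4 - 4 * A ^ 2)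

/-- The Floquet discriminant near an odd gap, centred at `h`. -/
noncomputable def gapDisc (A b h s : ℝ) : ℝ :=
  -2 * Real.cos (b * (s - h)) -
    couplingCoeff A s * (Real.cos (b * (s - h)) + Real.cos (2 * A * b / s))

lemma hasDerivAt_couplingCoeff (hs : s ^ 4 - 4 * A ^ 2 ≠ 0) :
    HasDerivAt (couplingCoeff A) (-(32 * A ^ 2 * s ^ 3) / (s ^ 4 - 4 * A ^ 2) ^ 2) s := by
  have h1 : HasDerivAt (fun s : ℝ => s ^ 4 - 4 * A ^ 2) (4 * s ^ 3) s := by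
    simpa using (hasDerivAt_pow 4 s).sub_const (4 * A ^ 2)
  refine ((hasDerivAt_const s (8 * A ^ 2)).div h1 hs).congr_deriv ?_
  ring

lemma hasDerivAt_gapDisc (hs0 : s ≠ 0) (hs : s ^ 4 - 4 * A ^ 2 ≠ 0) :
    HasDerivAt (gapDisc A b h)
      ((2 + couplingCoeff A s) * b * Real.sin (b * (s - h)) +
        32 * A ^ 2 * s ^ 3 / (s ^ 4 - 4 * A ^ 2) ^ 2 *
          (Real.cos (b * (s - h)) + Real.cos (2 * A * b / s)) -
        couplingCoeff A s * (Real.sin (2 * A * b / s) * (2 * A * b / s ^ 2))) s := by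
  have h1 : HasDerivAt (fun s => b * (s - h)) b s := by
    simpa using ((hasDerivAt_id s).sub_const h).const_mul b
  have h2 : HasDerivAt (fun s => 2 * A * b / s) (-(2 * A * b / s ^ 2)) s := by
    refine ((hasDerivAt_const s (2 * A * b)).div (hasDerivAt_id s) hs0).congr_deriv ?_
    simp only [id]
    ring
  refine ((h1.cos.const_mul (-2)).sub
    ((hasDerivAt_couplingCoeff hs).mul (h1.cos.add h2.cos))).congr_deriv ?_
  simp only [Pi.add_apply]
  ring

/-- The window is so small, and `h` so large, that all error terms are controlled. -/
structure IsGoodWindow (A b h : ℝ) : Prop where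
  pos : 0 < h
  bounds : ∀ s, |s - h| ≤ windowRadius A b h → 99 / 100 * h ≤ s ∧ s ≤ 101 / 100 * h
  phase : 8 * A / h ^ 2 ≤ 1 / 10
  shift : ∀ s, |s - h| ≤ windowRadius A b h → 2 * A * b / s ≤ 1 / 10
  quartic : ∀ s, |s - h| ≤ windowRadius A b h → 400 * A ^ 2 ≤ s ^ 4
  large : 40 * A < b * h ^ 3

lemma eventually_isGoodWindow (hb : 0 < b) :
    ∀ᶠ h in Filter.atTop, IsGoodWindow A b h := by
  have h1 : ∀ᶠ s : ℝ in Filter.atTop, 2 * A * b / s ≤ 1 / 10 :=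
    (Filter.Tendsto.const_div_atTop Filter.tendsto_id (2 * A * b)).eventually_le_const
      (by norm_num)
  have h2 : ∀ᶠ s : ℝ in Filter.atTop, 400 * A ^ 2 ≤ s ^ 4 :=
    (Filter.tendsto_pow_atTop four_ne_zero).eventually_ge_atTop _
  have h3 : ∀ᶠ h : ℝ in Filter.atTop, 8 * A / h ^ 2 ≤ 1 / 10 :=
    (Filter.Tendsto.const_div_atTop (Filter.tendsto_pow_atTop two_ne_zero)
      (8 * A)).eventually_le_const (by norm_num)
  have h4 : ∀ᶠ h : ℝ in Filter.atTop, 40 * A < b * h ^ 3 :=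
    ((Filter.tendsto_pow_atTop three_ne_zero).const_mul_atTop hb).eventually_gt_atTop _
  filter_upwards [Filter.eventually_gt_atTop 0, eventually_window_bounds A b, h3, h1.window A b,
    h2.window A b, h4] with h g1 g2 g3 g4 g5 g6
  exact ⟨g1, g2, g3, g4, g5, g6⟩

namespace IsGoodWindow

lemma quartic_bounds (hw : IsGoodWindow A b h) (hs : |s - h| ≤ windowRadius A b h) :
    95 / 100 * h ^ 4 ≤ s ^ 4 - 4 * A ^ 2 ∧ s ^ 4 - 4 * A ^ 2 ≤ 105 / 100 * h ^ 4 := by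
  obtain ⟨h1, h2⟩ := hw.bounds s hs
  have h3 := hw.quartic s hs
  have hh := hw.pos
  have h4 : (99 / 100 * h) ^ 4 ≤ s ^ 4 := pow_le_pow_left₀ (by positivity) h1 4
  have h5 : s ^ 4 ≤ (101 / 100 * h) ^ 4 := pow_le_pow_left₀ (by linarith) h2 4
  have h6 : 0 < h ^ 4 := by positivity
  constructor
  · nlinarith
  · nlinarith [sq_nonneg A]

lemma couplingCoeff_bounds (hw : IsGoodWindow A b h) (hA : 0 < A)
    (hs : |s - h| ≤ windowRadius A b h) :
    15 / 2 * (A / h ^ 2) ^ 2 ≤ couplingCoeff A s ∧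
      couplingCoeff A s ≤ 17 / 2 * (A / h ^ 2) ^ 2 := by
  obtain ⟨h1, h2⟩ := hw.quartic_bounds hs
  have hh := hw.pos
  have h6 : 0 < h ^ 4 := by positivity
  have h7 : 0 < s ^ 4 - 4 * A ^ 2 := by nlinarith
  have h8 : A ^ 2 = (A / h ^ 2) ^ 2 * h ^ 4 := by field_simp
  have h9 : 0 < (A / h ^ 2) ^ 2 := by positivity
  rw [couplingCoeff, le_div_iff₀ h7, div_le_iff₀ h7]
  generalize s ^ 4 - 4 * A ^ 2 = q at *
  rw [h8]
  constructor <;> nlinarith [mul_le_mul_of_nonneg_left h1 h9.le, mul_le_mul_of_nonneg_left h2 h9.le]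

lemma shift_nonneg (hw : IsGoodWindow A b h) (hA : 0 < A) (hb : 0 < b)
    (hs : |s - h| ≤ windowRadius A b h) : 0 < 2 * A * b / s := by
  have := (hw.bounds s hs).1
  have := hw.pos
  have : 0 < s := by linarith
  positivity

lemma cos_phase (hw : IsGoodWindow A b h) (hb : 0 < b) (hs : |s - h| ≤ windowRadius A b h) :
    199 / 200 ≤ Real.cos (b * (s - h)) := by
  have h1 := (abs_phase_le hb hs).trans hw.phase
  have h2 := Real.one_sub_sq_div_two_le_cos (x := b * (s - h))
  have h3 : (b * (s - h)) ^ 2 ≤ (1 / 10) ^ 2 := sq_le_sq' (abs_le.1 h1).1 (abs_le.1 h1).2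
  linarith

lemma cos_shift (hw : IsGoodWindow A b h) (hA : 0 < A) (hb : 0 < b)
    (hs : |s - h| ≤ windowRadius A b h) : 199 / 200 ≤ Real.cos (2 * A * b / s) := by
  have h1 := hw.shift s hs
  have h0 := hw.shift_nonneg hA hb hs
  have h2 := Real.one_sub_sq_div_two_le_cos (x := 2 * A * b / s)
  have h3 : (2 * A * b / s) ^ 2 ≤ (1 / 10) ^ 2 := sq_le_sq' (by linarith) h1
  linarith

lemma gapDisc_end (hw : IsGoodWindow A b h) (hA : 0 < A) (hb : 0 < b)
    (hs : |s - h| = windowRadius A b h) : -2 < gapDisc A b h s := by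
  have hh := hw.pos
  have h0 : |b * (s - h)| = 8 * A / h ^ 2 := by
    rw [abs_mul, abs_of_pos hb, hs, mul_windowRadius hb]
  obtain ⟨h3, h4⟩ := hw.couplingCoeff_bounds hA hs.le
  have hε : 0 < A / h ^ 2 := by positivity
  have h5 : 0 ≤ couplingCoeff A s := le_trans (by positivity) h3
  have h6 := Real.cos_le_one (2 * A * b / s)
  have h7 : 2 * Real.sin (8 * A / h ^ 2 / 2) ^ 2 = 1 - Real.cos (b * (s - h)) := by
    rw [← Real.cos_abs, h0, Real.sin_sq_eq_half_sub, mul_div_cancel₀ _ two_ne_zero]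
    ring
  have h8 : 3 / 5 * (4 * (A / h ^ 2)) ≤ Real.sin (8 * A / h ^ 2 / 2) := by
    refine le_trans ?_ (Real.mul_le_sin (by positivity) ?_)
    · have : (3:ℝ) / 5 ≤ 2 / Real.pi := by
        rw [le_div_iff₀ Real.pi_pos]; linarith [Real.pi_lt_d2]
      rw [show 8 * A / h ^ 2 / 2 = 4 * (A / h ^ 2) by ring]
      gcongr
    · linarith [hw.phase, Real.pi_gt_three]
  have h9 : (3 / 5 * (4 * (A / h ^ 2))) ^ 2 ≤ Real.sin (8 * A / h ^ 2 / 2) ^ 2 :=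
    pow_le_pow_left₀ (by positivity) h8 2
  have h10 := Real.cos_le_one (b * (s - h))
  unfold gapDisc
  nlinarith [pow_pos hε 2]

lemma gapDisc_center (hw : IsGoodWindow A b h) (hA : 0 < A) (hb : 0 < b)
    (hs : |s - h| ≤ windowRadius A b h / 4) :
    gapDisc A b h s ≤ -2 - 6 * (A / h ^ 2) ^ 2 := by
  have hh := hw.pos
  have hY := windowRadius_pos hA hb hh
  have hs' : |s - h| ≤ windowRadius A b h := by linarith
  have h0 : |b * (s - h)| ≤ 2 * (A / h ^ 2) := by
    rw [abs_mul, abs_of_pos hb]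
    have := mul_le_mul_of_nonneg_left hs hb.le
    rw [mul_div_assoc', mul_windowRadius hb] at this
    linarith [show 8 * A / h ^ 2 / 4 = 2 * (A / h ^ 2) by ring]
  obtain ⟨h3, h4⟩ := hw.couplingCoeff_bounds hA hs'
  have h1 := hw.cos_phase hb hs'
  have h2 := hw.cos_shift hA hb hs'
  have h5 := Real.one_sub_sq_div_two_le_cos (x := b * (s - h))
  have h6 : (b * (s - h)) ^ 2 ≤ (2 * (A / h ^ 2)) ^ 2 := sq_le_sq' (abs_le.1 h0).1 (abs_le.1 h0).2
  have hε : 0 < (A / h ^ 2) ^ 2 := by positivity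
  unfold gapDisc
  nlinarith

lemma ne_zero (hw : IsGoodWindow A b h) (hs : |s - h| ≤ windowRadius A b h) :
    s ≠ 0 ∧ s ^ 4 - 4 * A ^ 2 ≠ 0 := by
  have hh := hw.pos
  have h1 := (hw.bounds s hs).1
  have h2 := (hw.quartic_bounds hs).1
  have : 0 < h ^ 4 := by positivity
  exact ⟨by nlinarith, by nlinarith⟩

lemma continuousAt_gapDisc (hw : IsGoodWindow A b h) (hs : |s - h| ≤ windowRadius A b h) :
    ContinuousAt (gapDisc A b h) s :=
  (hasDerivAt_gapDisc (hw.ne_zero hs).1 (hw.ne_zero hs).2).continuousAt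

lemma sin_ge (hw : IsGoodWindow A b h) (hA : 0 < A) (hb : 0 < b)
    (hs : windowRadius A b h / 4 ≤ s - h) (hs' : s - h ≤ windowRadius A b h) :
    6 / 5 * (A / h ^ 2) ≤ Real.sin (b * (s - h)) := by
  have hh := hw.pos
  have h0 := mul_le_mul_of_nonneg_left hs hb.le
  have h1 := mul_le_mul_of_nonneg_left hs' hb.le
  rw [mul_div_assoc', mul_windowRadius hb, show 8 * A / h ^ 2 / 4 = 2 * (A / h ^ 2) by ring] at h0
  rw [mul_windowRadius hb] at h1
  have hε : 0 < A / h ^ 2 := by positivity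
  have hπ : (3:ℝ) / 5 ≤ 2 / Real.pi := by
    rw [le_div_iff₀ Real.pi_pos]; linarith [Real.pi_lt_d2]
  have h2 := Real.mul_le_sin (x := b * (s - h)) (by linarith)
    (by linarith [hw.phase, Real.pi_gt_three])
  nlinarith

lemma strictMonoOn_gapDisc (hw : IsGoodWindow A b h) (hA : 0 < A) (hb : 0 < b) :
    StrictMonoOn (gapDisc A b h)
      (Set.Icc (h + windowRadius A b h / 4) (h + windowRadius A b h)) := by
  have hh := hw.pos
  have hY := windowRadius_pos hA hb hh
  have hmem : ∀ s ∈ Set.Icc (h + windowRadius A b h / 4) (h + windowRadius A b h),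
      |s - h| ≤ windowRadius A b h := fun s hs =>
    abs_le.2 ⟨by linarith [hs.1], by linarith [hs.2]⟩
  refine strictMonoOn_of_deriv_pos (convex_Icc _ _)
    (fun s hs => (hw.continuousAt_gapDisc (hmem s hs)).continuousWithinAt) fun s hs => ?_
  have hs := interior_subset hs
  have hs' := hmem s hs
  obtain ⟨hs0, hs4⟩ := hw.ne_zero hs'
  rw [(hasDerivAt_gapDisc hs0 hs4).deriv]
  have h1 := hw.sin_ge hA hb (s := s) (by linarith [hs.1]) (by linarith [hs.2])
  obtain ⟨h3, h4⟩ := hw.couplingCoeff_bounds hA hs'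
  have h5 := hw.cos_phase hb hs'
  have h6 := hw.cos_shift hA hb hs'
  obtain ⟨h7, h8⟩ := hw.bounds s hs'
  have hs0' : 0 < s := by linarith
  have hε : 0 < A / h ^ 2 := by positivity
  have hε' : A / h ^ 2 ≤ 1 / 80 := by
    have := hw.phase
    rw [mul_div_assoc] at this
    linarith
  have h9 : 0 ≤ 32 * A ^ 2 * s ^ 3 / (s ^ 4 - 4 * A ^ 2) ^ 2 *
      (Real.cos (b * (s - h)) + Real.cos (2 * A * b / s)) :=
    mul_nonneg (by positivity) (by linarith)
  have h10 : 2 * A * b / s ^ 2 ≤ 21 / 10 * (b * (A / h ^ 2)) := by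
    rw [mul_div_assoc', mul_div_assoc', div_le_div_iff₀ (by positivity) (by positivity)]
    have h11 : 98 / 100 * h ^ 2 ≤ s ^ 2 := by nlinarith
    have h12 : 0 < b * A := by positivity
    nlinarith
  have h11 : Real.sin (2 * A * b / s) * (2 * A * b / s ^ 2) ≤ 21 / 10 * (b * (A / h ^ 2)) :=
    (mul_le_of_le_one_left (by positivity) (Real.sin_le_one _)).trans h10
  have h12 : couplingCoeff A s * (Real.sin (2 * A * b / s) * (2 * A * b / s ^ 2)) ≤
      17 / 2 * (A / h ^ 2) ^ 2 * (21 / 10 * (b * (A / h ^ 2))) :=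
    mul_le_mul_of_nonneg h4 h11 (le_trans (by positivity) h3) (by positivity)
  have h13 : 0 ≤ couplingCoeff A s := le_trans (by positivity) h3
  have h14 : 2 * b * (6 / 5 * (A / h ^ 2)) ≤
      (2 + couplingCoeff A s) * b * Real.sin (b * (s - h)) := by
    gcongr
    linarith
  have h15 : (A / h ^ 2) ^ 2 ≤ (1 / 80) ^ 2 := pow_le_pow_left₀ hε.le hε' 2
  have h16 : 0 < b * (A / h ^ 2) := by positivity
  nlinarith

lemma strictAntiOn_gapDisc (hw : IsGoodWindow A b h) (hA : 0 < A) (hb : 0 < b) :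
    StrictAntiOn (gapDisc A b h)
      (Set.Icc (h - windowRadius A b h) (h - windowRadius A b h / 4)) := by
  have hh := hw.pos
  have hY := windowRadius_pos hA hb hh
  have hmem : ∀ s ∈ Set.Icc (h - windowRadius A b h) (h - windowRadius A b h / 4),
      |s - h| ≤ windowRadius A b h := fun s hs =>
    abs_le.2 ⟨by linarith [hs.1], by linarith [hs.2]⟩
  refine strictAntiOn_of_deriv_neg (convex_Icc _ _)
    (fun s hs => (hw.continuousAt_gapDisc (hmem s hs)).continuousWithinAt) fun s hs => ?_
  have hs := interior_subset hs
  have hs' := hmem s hs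
  obtain ⟨hs0, hs4⟩ := hw.ne_zero hs'
  rw [(hasDerivAt_gapDisc hs0 hs4).deriv]
  have h1 : 6 / 5 * (A / h ^ 2) ≤ -Real.sin (b * (s - h)) := by
    have := hw.sin_ge hA hb (s := 2 * h - s) (by linarith [hs.2]) (by linarith [hs.1])
    rwa [show b * (2 * h - s - h) = -(b * (s - h)) by ring, Real.sin_neg] at this
  obtain ⟨h3, h4⟩ := hw.couplingCoeff_bounds hA hs'
  have h5 := Real.cos_le_one (b * (s - h))
  have h6 := Real.cos_le_one (2 * A * b / s)
  obtain ⟨h7, h8⟩ := hw.bounds s hs'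
  have hs0' : 0 < s := by linarith
  have hε : 0 < A / h ^ 2 := by positivity
  have h13 : 0 ≤ couplingCoeff A s := le_trans (by positivity) h3
  have h9 : 32 * A ^ 2 * s ^ 3 / (s ^ 4 - 4 * A ^ 2) ^ 2 ≤ 37 * ((A / h ^ 2) ^ 2 / h) := by
    have e1 : s ^ 3 ≤ (101 / 100 * h) ^ 3 := pow_le_pow_left₀ hs0'.le h8 3
    have e2 : (95 / 100 * h ^ 4) ^ 2 ≤ (s ^ 4 - 4 * A ^ 2) ^ 2 :=
      pow_le_pow_left₀ (by positivity) (hw.quartic_bounds hs').1 2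
    calc 32 * A ^ 2 * s ^ 3 / (s ^ 4 - 4 * A ^ 2) ^ 2
        ≤ 32 * A ^ 2 * (101 / 100 * h) ^ 3 / (95 / 100 * h ^ 4) ^ 2 := by gcongr
      _ = 32 * (101 / 100) ^ 3 / (95 / 100) ^ 2 * ((A / h ^ 2) ^ 2 / h) := by field_simp
      _ ≤ 37 * ((A / h ^ 2) ^ 2 / h) := by gcongr; norm_num
  have h10 : 32 * A ^ 2 * s ^ 3 / (s ^ 4 - 4 * A ^ 2) ^ 2 *
      (Real.cos (b * (s - h)) + Real.cos (2 * A * b / s)) ≤ 37 * ((A / h ^ 2) ^ 2 / h) * 2 := by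
    refine (mul_le_mul_of_nonneg_left (by linarith : _ ≤ (2:ℝ)) (by positivity)).trans ?_
    gcongr
  have h11 : (A / h ^ 2) ^ 2 / h ≤ b * (A / h ^ 2) / 40 := by
    have := hw.large
    rw [div_pow, div_div, mul_div_assoc', div_div, div_le_div_iff₀ (by positivity) (by positivity)]
    have : 0 < A * h ^ 2 := by positivity
    nlinarith [mul_lt_mul_of_pos_left hw.large this]
  have h12 : 0 ≤ couplingCoeff A s * (Real.sin (2 * A * b / s) * (2 * A * b / s ^ 2)) := by
    have := hw.shift_nonneg hA hb hs'
    have := Real.sin_nonneg_of_nonneg_of_le_pi this.le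
      (by linarith [hw.shift s hs', Real.pi_gt_three])
    positivity
  have h14 : 2 * b * (6 / 5 * (A / h ^ 2)) ≤
      (2 + couplingCoeff A s) * b * -Real.sin (b * (s - h)) := by
    gcongr
    linarith
  have h16 : 0 < b * (A / h ^ 2) := by positivity
  nlinarith

end IsGoodWindow

end Window

lemma ContDiffAt.exists_hasDerivAt_comp_inv {G : ℝ → ℝ} (hG : ContDiffAt ℝ 1 G 0) :
    ∃ C, ∀ᶠ s in Filter.atTop, ∃ d, HasDerivAt (fun s => G s⁻¹) d s ∧ |d| ≤ C / s ^ 2 := by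
  have hc : ContinuousAt (deriv G) 0 := by
    have h := (hG.continuousAt_fderiv one_ne_zero).clm_apply (continuousAt_const (y := (1 : ℝ)))
    simpa only [fderiv_apply_one_eq_deriv] using h
  have hd : ∀ᶠ t in nhds 0, DifferentiableAt ℝ G t :=
    (hG.eventually (by simp)).mono fun t ht => ht.differentiableAt one_ne_zero
  refine ⟨|deriv G 0| + 1, ?_⟩
  have hb : ∀ᶠ t in nhds 0, |deriv G t| ≤ |deriv G 0| + 1 :=
    (hc.abs.tendsto.eventually_le_const (lt_add_one _))
  filter_upwards [tendsto_inv_atTop_zero.eventually hd, tendsto_inv_atTop_zero.eventually hb,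
    Filter.eventually_gt_atTop 0] with s h1 h2 h3
  refine ⟨_, h1.hasDerivAt.comp s (hasDerivAt_inv h3.ne'), ?_⟩
  rw [abs_mul, abs_neg, abs_of_pos (by positivity : 0 < (s ^ 2)⁻¹), div_eq_mul_inv]
  gcongr

lemma Filter.Eventually.eventually_nhds_of_atTop {P : ℝ → Prop}
    (hP : ∀ᶠ s in Filter.atTop, P s) : ∀ᶠ s in Filter.atTop, ∀ᶠ x in nhds s, P x := by
  obtain ⟨S, hS⟩ := Filter.eventually_atTop.1 hP
  filter_upwards [Filter.eventually_gt_atTop S] with s hs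
  filter_upwards [Ioi_mem_nhds hs] with x hx using hS x (le_of_lt hx)

/-- Coefficient of `sin (b * s)` in the matching condition. -/
noncomputable def shearCoeff (A Q s : ℝ) : ℝ := s ^ 3 * (2 * s ^ 2 - 4 * Q) / (s ^ 4 - 4 * A ^ 2)

/-- Non-oscillating part of the matching condition. -/
noncomputable def shearRest (A b Q s : ℝ) : ℝ :=
  8 * A * (Q * s ^ 2 - 2 * A ^ 2) * Real.sin (2 * A * b / s) / (s * (s ^ 4 - 4 * A ^ 2))

/-- The matching function near an odd gap, centred at `h`. -/
noncomputable def gapShear (A b Q h s : ℝ) : ℝ :=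
  -(shearCoeff A Q s * Real.sin (b * (s - h))) + shearRest A b Q s

lemma eventually_quartic_pos (A : ℝ) : ∀ᶠ s : ℝ in Filter.atTop, 0 < s ^ 4 - 4 * A ^ 2 := by
  filter_upwards [(Filter.tendsto_pow_atTop (α := ℝ) four_ne_zero).eventually_gt_atTop
    (4 * A ^ 2)] with s hs
  linarith

lemma eventually_shearCoeff (A Q : ℝ) : ∀ᶠ s : ℝ in Filter.atTop,
    s ≤ shearCoeff A Q s ∧ shearCoeff A Q s ≤ 3 * s ∧
      ∃ d, HasDerivAt (shearCoeff A Q) d s ∧ |d| ≤ 4 := by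
  set G : ℝ → ℝ := fun t => (2 - 4 * Q * t ^ 2) / (1 - 4 * A ^ 2 * t ^ 4) with hG
  have hGd : ContDiffAt ℝ 1 G 0 := by
    refine ContDiffAt.div (by fun_prop) (by fun_prop) (by simp)
  have hG0 : G 0 = 2 := by simp [hG]
  have hlim : Filter.Tendsto (fun s : ℝ => G s⁻¹) Filter.atTop (nhds 2) := by
    rw [← hG0]
    exact hGd.continuousAt.tendsto.comp tendsto_inv_atTop_zero
  have heq : ∀ᶠ s : ℝ in Filter.atTop, shearCoeff A Q s = s * G s⁻¹ := by
    filter_upwards [eventually_quartic_pos A, Filter.eventually_gt_atTop 0] with s h1 h2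
    have : 1 - 4 * A ^ 2 * s⁻¹ ^ 4 = (s ^ 4 - 4 * A ^ 2) / s ^ 4 := by field_simp
    rw [shearCoeff, hG]
    dsimp only
    rw [this]
    field_simp
  obtain ⟨C, hC⟩ := hGd.exists_hasDerivAt_comp_inv
  have hC' : ∀ᶠ s : ℝ in Filter.atTop, C / s ≤ 1 :=
    (Filter.Tendsto.const_div_atTop Filter.tendsto_id C).eventually_le_const one_pos
  filter_upwards [heq, heq.eventually_nhds_of_atTop, hlim.eventually_le_const (by norm_num : (2:ℝ) < 3),
    hlim.eventually_const_le (by norm_num : (1:ℝ) < 2), hC, hC', Filter.eventually_gt_atTop 0]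
    with s h1 h2 h3 h4 h5 h6 h7
  rw [h1]
  refine ⟨by nlinarith, by nlinarith, ?_⟩
  obtain ⟨d, hd, hd'⟩ := h5
  refine ⟨_, ((hasDerivAt_id s).mul hd).congr_of_eventuallyEq h2, ?_⟩
  have h8 : |s * d| ≤ 1 := by
    rw [abs_mul, abs_of_pos h7]
    refine le_trans (mul_le_mul_of_nonneg_left hd' h7.le) (le_of_eq_of_le ?_ h6)
    field_simp
  simp only [id, one_mul]
  refine (abs_add_le _ _).trans ?_
  rw [abs_of_nonneg (by linarith : 0 ≤ G s⁻¹)]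
  linarith

lemma eventually_shearRest (A b Q : ℝ) : ∀ᶠ s : ℝ in Filter.atTop,
    |shearRest A b Q s| ≤ 1 / s ^ 2 ∧ ∃ d, HasDerivAt (shearRest A b Q) d s ∧ |d| ≤ 1 := by
  set G : ℝ → ℝ := fun t =>
    8 * A * (Q - 2 * A ^ 2 * t ^ 2) * t * Real.sin (2 * A * b * t) / (1 - 4 * A ^ 2 * t ^ 4) with hG
  have hGd : ContDiffAt ℝ 1 G 0 := by
    refine ContDiffAt.div (by fun_prop) (by fun_prop) (by simp)
  have hG0 : G 0 = 0 := by simp [hG]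
  have hlim : Filter.Tendsto (fun s : ℝ => |G s⁻¹|) Filter.atTop (nhds 0) := by
    rw [← abs_zero, ← hG0]
    exact (hGd.continuousAt.tendsto.comp tendsto_inv_atTop_zero).abs
  have heq : ∀ᶠ s : ℝ in Filter.atTop, shearRest A b Q s = s⁻¹ ^ 2 * G s⁻¹ := by
    filter_upwards [eventually_quartic_pos A, Filter.eventually_gt_atTop 0] with s h1 h2
    have : 1 - 4 * A ^ 2 * s⁻¹ ^ 4 = (s ^ 4 - 4 * A ^ 2) / s ^ 4 := by field_simp
    rw [shearRest, hG]
    dsimp only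
    rw [this, ← div_eq_mul_inv (2 * A * b)]
    field_simp
  have hGd2 : ContDiffAt ℝ 1 (fun t => t ^ 2 * G t) 0 := by fun_prop
  obtain ⟨C, hC⟩ := hGd2.exists_hasDerivAt_comp_inv
  have hC' : ∀ᶠ s : ℝ in Filter.atTop, C / s ^ 2 ≤ 1 :=
    (Filter.Tendsto.const_div_atTop (Filter.tendsto_pow_atTop two_ne_zero)
      C).eventually_le_const one_pos
  filter_upwards [heq, heq.eventually_nhds_of_atTop, hlim.eventually_le_const one_pos, hC, hC',
    Filter.eventually_gt_atTop 0] with s h1 h2 h3 h5 h6 h7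
  obtain ⟨d, hd, hd'⟩ := h5
  refine ⟨?_, d, hd.congr_of_eventuallyEq h2, hd'.trans h6⟩
  rw [h1, abs_mul, abs_of_nonneg (by positivity), inv_pow, one_div]
  exact mul_le_of_le_one_right (by positivity) h3

/-- Properties of the matching function in the window. -/
structure IsGoodShear (A b Q h : ℝ) : Prop where
  anti : AntitoneOn (gapShear A b Q h)
    (Set.Icc (h - windowRadius A b h) (h + windowRadius A b h))
  cont : ContinuousOn (gapShear A b Q h)
    (Set.Icc (h - windowRadius A b h) (h + windowRadius A b h))
  pos : ∀ s ∈ Set.Icc (h - windowRadius A b h) (h - windowRadius A b h / 4), 0 < gapShear A b Q h s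
  neg : ∀ s ∈ Set.Icc (h + windowRadius A b h / 4) (h + windowRadius A b h), gapShear A b Q h s < 0
  abs_le : ∀ s ∈ Set.Icc (h - windowRadius A b h) (h + windowRadius A b h),
    |gapShear A b Q h s| ≤ 30 * A / h

lemma eventually_isGoodShear {A b : ℝ} (hA : 0 < A) (hb : 0 < b) (Q : ℝ) :
    ∀ᶠ h in Filter.atTop, IsGoodShear A b Q h := by
  have hlarge : ∀ᶠ h : ℝ in Filter.atTop, 10 ≤ b * h :=
    (Filter.tendsto_id.const_mul_atTop hb).eventually_ge_atTop _
  have hlarge' : ∀ᶠ h : ℝ in Filter.atTop, 2 < A * h :=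
    (Filter.tendsto_id.const_mul_atTop hA).eventually_gt_atTop _
  filter_upwards [eventually_isGoodWindow (A := A) hb, (eventually_shearCoeff A Q).window A b,
    (eventually_shearRest A b Q).window A b, hlarge, hlarge'] with h hw hα hγ h1 h2
  have hh := hw.pos
  have hY := windowRadius_pos hA hb hh
  have hmem : ∀ s ∈ Set.Icc (h - windowRadius A b h) (h + windowRadius A b h),
      |s - h| ≤ windowRadius A b h := fun s hs =>
    abs_le.2 ⟨by linarith [hs.1], by linarith [hs.2]⟩
  have hderiv : ∀ s ∈ Set.Icc (h - windowRadius A b h) (h + windowRadius A b h),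
      ∃ d, HasDerivAt (gapShear A b Q h) d s ∧ d ≤ 0 := fun s hs => by
    have hs' := hmem s hs
    obtain ⟨a1, a2, α', hα', a3⟩ := hα s hs'
    obtain ⟨c1, γ', hγ', c2⟩ := hγ s hs'
    have hlin : HasDerivAt (fun s => b * (s - h)) b s := by
      simpa using ((hasDerivAt_id s).sub_const h).const_mul b
    refine ⟨_, ((hα'.mul hlin.sin).neg).add hγ', ?_⟩
    have e1 := hw.cos_phase hb hs'
    have e2 := (hw.bounds s hs').1
    have e3 : |α' * Real.sin (b * (s - h))| ≤ 4 := by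
      rw [abs_mul]
      nlinarith [Real.abs_sin_le_one (b * (s - h)), abs_nonneg α']
    have e4 : 99 / 100 * h * (199 / 200 * b) ≤
        shearCoeff A Q s * (Real.cos (b * (s - h)) * b) := by
      have a4 := e2.trans a1
      have a5 : 0 ≤ shearCoeff A Q s := le_trans (by positivity) a4
      gcongr
    have := abs_le.1 e3
    have := abs_le.1 c2
    nlinarith
  have hrest : ∀ s, |s - h| ≤ windowRadius A b h → |shearRest A b Q s| < 11 / 10 * (A / h) := by
    intro s hs
    refine (hγ s hs).1.trans_lt ?_
    obtain ⟨e1, -⟩ := hw.bounds s hs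
    have e2 : (99 / 100 * h) ^ 2 ≤ s ^ 2 := pow_le_pow_left₀ (by positivity) e1 2
    rw [mul_div_assoc', div_lt_div_iff₀ (by nlinarith) hh]
    have : 0 < A * h := by positivity
    nlinarith
  refine ⟨?_, fun s hs => ?_, fun s hs => ?_, fun s hs => ?_, fun s hs => ?_⟩
  · refine antitoneOn_of_deriv_nonpos (convex_Icc _ _) (fun s hs => ?_) (fun s hs => ?_)
      (fun s hs => ?_)
    · obtain ⟨d, hd, -⟩ := hderiv s hs
      exact hd.continuousAt.continuousWithinAt
    · obtain ⟨d, hd, -⟩ := hderiv s (interior_subset hs)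
      exact hd.differentiableAt.differentiableWithinAt
    · obtain ⟨d, hd, hd'⟩ := hderiv s (interior_subset hs)
      rwa [hd.deriv]
  · obtain ⟨d, hd, -⟩ := hderiv s hs
    exact hd.continuousAt.continuousWithinAt
  · have hs' := hmem s ⟨hs.1, by linarith [hs.2]⟩
    have e1 : 6 / 5 * (A / h ^ 2) ≤ -Real.sin (b * (s - h)) := by
      have := hw.sin_ge hA hb (s := 2 * h - s) (by linarith [hs.2]) (by linarith [hs.1])
      rwa [show b * (2 * h - s - h) = -(b * (s - h)) by ring, Real.sin_neg] at this
    have e2 := (hα s hs').1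
    have e3 := (hw.bounds s hs').1
    have e4 : 99 / 100 * h * (6 / 5 * (A / h ^ 2)) ≤
        shearCoeff A Q s * -Real.sin (b * (s - h)) := by
      have a4 := e3.trans e2
      have a5 : 0 ≤ shearCoeff A Q s := le_trans (by positivity) a4
      gcongr
    rw [show 99 / 100 * h * (6 / 5 * (A / h ^ 2)) = 594 / 500 * (A / h) by field_simp; ring] at e4
    have e5 := abs_lt.1 (hrest s hs')
    have e6 : 0 < A / h := by positivity
    unfold gapShear
    nlinarith
  · have hs' := hmem s ⟨by linarith [hs.1], hs.2⟩
    have e1 := hw.sin_ge hA hb (s := s) (by linarith [hs.1]) (by linarith [hs.2])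
    have e2 := (hα s hs').1
    have e3 := (hw.bounds s hs').1
    have e4 : 99 / 100 * h * (6 / 5 * (A / h ^ 2)) ≤
        shearCoeff A Q s * Real.sin (b * (s - h)) := by
      have a4 := e3.trans e2
      have a5 : 0 ≤ shearCoeff A Q s := le_trans (by positivity) a4
      gcongr
    rw [show 99 / 100 * h * (6 / 5 * (A / h ^ 2)) = 594 / 500 * (A / h) by field_simp; ring] at e4
    have e5 := abs_lt.1 (hrest s hs')
    have e6 : 0 < A / h := by positivity
    unfold gapShear
    nlinarith
  · have hs' := hmem s hs
    have e1 : |Real.sin (b * (s - h))| ≤ 8 * (A / h ^ 2) := by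
      refine (Real.abs_sin_le_abs).trans ((abs_phase_le hb hs').trans_eq ?_)
      ring
    obtain ⟨e2, e3, -⟩ := hα s hs'
    obtain ⟨e4, e5⟩ := hw.bounds s hs'
    have e6 : |shearCoeff A Q s| ≤ 3 * (101 / 100 * h) := by
      rw [abs_of_nonneg (by linarith)]
      linarith
    have e7 := hrest s hs'
    have e8 : |shearCoeff A Q s| * |Real.sin (b * (s - h))| ≤
        3 * (101 / 100 * h) * (8 * (A / h ^ 2)) := by gcongr
    rw [show 3 * (101 / 100 * h) * (8 * (A / h ^ 2)) = 2424 / 100 * (A / h) by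
      field_simp; ring, ← abs_mul] at e8
    have e9 : 0 < A / h := by positivity
    unfold gapShear
    refine (abs_add_le _ _).trans ?_
    rw [abs_neg, mul_div_assoc]
    linarith

section Energy

variable {A b h s Q κ₀ : ℝ}

/-- The energy `E` with `√(E ± A) = s / 2 ± A / s`. -/
noncomputable def windowEnergy (A s : ℝ) : ℝ := s ^ 2 / 4 + A ^ 2 / s ^ 2

/-- The wave number inside the defect. -/
noncomputable def defectFreq (A Q s : ℝ) : ℝ := √(windowEnergy A s - Q)

/-- The energy `Q + κ₀ ^ 2` is so close to the center of the window that
the phase accumulated in the defect is controlled. -/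
structure IsGoodEnergy (A b Q κ₀ h : ℝ) : Prop where
  mono : StrictMonoOn (windowEnergy A) (Set.Icc (h - windowRadius A b h) (h + windowRadius A b h))
  cont : ContinuousOn (windowEnergy A) (Set.Icc (h - windowRadius A b h) (h + windowRadius A b h))
  left : windowEnergy A (h - windowRadius A b h / 4) < Q + κ₀ ^ 2
  right : Q + κ₀ ^ 2 < windowEnergy A (h + windowRadius A b h / 4)
  freq_ge : ∀ s ∈ Set.Icc (h - windowRadius A b h) (h + windowRadius A b h),
    h / 4 ≤ defectFreq A Q s
  freq_sq : ∀ s ∈ Set.Icc (h - windowRadius A b h) (h + windowRadius A b h),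
    defectFreq A Q s ^ 2 = windowEnergy A s - Q
  freq_near : ∀ s ∈ Set.Icc (h - windowRadius A b h) (h + windowRadius A b h),
    |defectFreq A Q s - κ₀| ≤ 1 / h

lemma IsGoodWindow.strictMonoOn_windowEnergy (hw : IsGoodWindow A b h) (hA : 0 < A) :
    StrictMonoOn (windowEnergy A)
      (Set.Icc (h - windowRadius A b h) (h + windowRadius A b h)) := by
  intro x hx y hy hxy
  have hx' : |x - h| ≤ windowRadius A b h := abs_le.2 ⟨by linarith [hx.1], by linarith [hx.2]⟩
  have hh := hw.pos
  have h1 := (hw.bounds x hx').1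
  have h2 := hw.quartic x hx'
  have hx0 : 0 < x := by linarith
  have hy0 : 0 < y := by linarith
  have h3 : x ^ 4 ≤ x ^ 2 * y ^ 2 := by
    have : x ^ 2 ≤ y ^ 2 := pow_le_pow_left₀ hx0.le hxy.le 2
    nlinarith [pow_pos hx0 2]
  have h4 : windowEnergy A y - windowEnergy A x =
      (y ^ 2 - x ^ 2) * (x ^ 2 * y ^ 2 - 4 * A ^ 2) / (4 * (x ^ 2 * y ^ 2)) := by
    unfold windowEnergy
    field_simp
    ring
  have h5 : 0 < windowEnergy A y - windowEnergy A x := by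
    rw [h4]
    have : 0 < y ^ 2 - x ^ 2 := by nlinarith
    have : 0 < x ^ 2 * y ^ 2 - 4 * A ^ 2 := by nlinarith [pow_pos hA 2]
    positivity
  linarith

lemma IsGoodWindow.continuousAt_windowEnergy (hw : IsGoodWindow A b h)
    (hs : |s - h| ≤ windowRadius A b h) : ContinuousAt (windowEnergy A) s := by
  have := (hw.ne_zero hs).1
  unfold windowEnergy
  fun_prop (disch := positivity)

lemma eventually_isGoodEnergy (hA : 0 < A) (hb : 0 < b) (Q C : ℝ) :
    ∀ᶠ h in Filter.atTop, ∀ κ₀ > 0, |Q + κ₀ ^ 2 - h ^ 2 / 4| ≤ C / h ^ 2 →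
      IsGoodEnergy A b Q κ₀ h := by
  have hlin : ∀ c > 0, ∀ d : ℝ, ∀ᶠ h : ℝ in Filter.atTop, d < c * h := fun c hc d =>
    (Filter.tendsto_id.const_mul_atTop hc).eventually_gt_atTop _
  filter_upwards [eventually_isGoodWindow (A := A) hb, hlin A hA (b * (1 + 2 * A ^ 2 + |C|)),
    hlin b hb A, hlin 1 one_pos (4 * (5 * A / b + 1)), hlin 1 one_pos (10 + 6 * |Q|),
    hlin 1 one_pos (2 * A ^ 2 + |C|)] with h hw hC1 hC2 hC3 hC4 hC5 κ₀ hκ₀ hE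
  have hh := hw.pos
  have hR := windowRadius_pos hA hb hh
  set R := windowRadius A b h with hRdef
  have hRh : h * R = 8 * (A / b) / h := by rw [hRdef, windowRadius]; field_simp
  have hRR : R ^ 2 / 64 = (A / (b * h)) ^ 2 / h ^ 2 := by
    rw [hRdef, windowRadius]; field_simp; norm_num
  have hAb : (A / (b * h)) ^ 2 ≤ 1 := by
    apply pow_le_one₀ (by positivity)
    rw [div_le_one (by positivity)]
    exact hC2.le
  have hRR' : R ^ 2 / 64 ≤ 1 / h ^ 2 := by rw [hRR]; gcongr
  have hC : C / h ^ 2 ≤ |C| / h ^ 2 := by gcongr; exact le_abs_self C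
  have hE' := abs_le.1 (hE.trans hC)
  have hmem : ∀ s ∈ Set.Icc (h - R) (h + R), |s - h| ≤ R := fun s hs =>
    abs_le.2 ⟨by linarith [hs.1], by linarith [hs.2]⟩
  have hkey : (1 + 2 * A ^ 2 + |C|) / h ^ 2 < A / b / h := by
    rw [div_div, div_lt_div_iff₀ (by positivity) (by positivity)]
    nlinarith
  have hkey2 : (2 * A ^ 2 + |C|) / h ^ 2 ≤ 1 / h := by
    rw [div_le_div_iff₀ (by positivity) (by positivity)]
    nlinarith
  have hpot : ∀ s, |s - h| ≤ R → A ^ 2 / s ^ 2 ≤ 2 * A ^ 2 / h ^ 2 := fun s hs => by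
    have h1 := (hw.bounds s hs).1
    have h2 : (99 / 100 * h) ^ 2 ≤ s ^ 2 := pow_le_pow_left₀ (by positivity) h1 2
    have h3 : 0 < s := by linarith
    rw [div_le_div_iff₀ (by positivity) (by positivity)]
    have h4 : 0 < A ^ 2 := by positivity
    nlinarith
  have hpos : ∀ s : ℝ, 0 ≤ A ^ 2 / s ^ 2 := fun s => by positivity
  have hge : ∀ s ∈ Set.Icc (h - R) (h + R), (h / 4) ^ 2 ≤ windowEnergy A s - Q := fun s hs => by
    have h1 := (hw.bounds s (hmem s hs)).1
    have h2 : (99 / 100 * h) ^ 2 ≤ s ^ 2 := pow_le_pow_left₀ (by positivity) h1 2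
    have h3 := hpos s
    unfold windowEnergy
    nlinarith [le_abs_self Q, abs_nonneg Q]
  have hfreq : ∀ s ∈ Set.Icc (h - R) (h + R), h / 4 ≤ defectFreq A Q s := fun s hs =>
    Real.le_sqrt_of_sq_le (hge s hs)
  have hsq : ∀ s ∈ Set.Icc (h - R) (h + R), defectFreq A Q s ^ 2 = windowEnergy A s - Q :=
    fun s hs => Real.sq_sqrt (le_trans (by positivity) (hge s hs))
  refine ⟨hw.strictMonoOn_windowEnergy hA, fun s hs =>
    (hw.continuousAt_windowEnergy (hmem s hs)).continuousWithinAt, ?_, ?_, hfreq, hsq,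
    fun s hs => ?_⟩
  · have h1 := hpot (h - R / 4) (by rw [abs_le]; constructor <;> linarith)
    have h2 : (1 + 2 * A ^ 2 + |C|) / h ^ 2 = 1 / h ^ 2 + 2 * A ^ 2 / h ^ 2 + |C| / h ^ 2 := by
      ring
    have h3 : (h - R / 4) ^ 2 / 4 = h ^ 2 / 4 - h * R / 8 + R ^ 2 / 64 := by ring
    unfold windowEnergy
    rw [← hRdef, h3, hRh, show 8 * (A / b) / h / 8 = A / b / h by ring]
    rw [h2] at hkey
    linarith [hE'.1]
  · have h1 := hpos (h + R / 4)
    have h2 : (1 + 2 * A ^ 2 + |C|) / h ^ 2 = 1 / h ^ 2 + 2 * A ^ 2 / h ^ 2 + |C| / h ^ 2 := by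
      ring
    have h3 : (h + R / 4) ^ 2 / 4 = h ^ 2 / 4 + h * R / 8 + R ^ 2 / 64 := by ring
    have h4 : 0 ≤ 1 / h ^ 2 + 2 * A ^ 2 / h ^ 2 := by positivity
    unfold windowEnergy
    rw [← hRdef, h3, hRh, show 8 * (A / b) / h / 8 = A / b / h by ring]
    rw [h2] at hkey
    linarith [hE'.2, sq_nonneg R]
  · have h1 := hmem s hs
    have h2 := hpot s h1
    have h3 := hpos s
    have h4 : (2 * A ^ 2 + |C|) / h ^ 2 = 2 * A ^ 2 / h ^ 2 + |C| / h ^ 2 := by ring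
    have h5 : |s ^ 2 - h ^ 2| ≤ 5 / 2 * (8 * (A / b) / h) := by
      rw [sq_sub_sq, abs_mul, ← hRh, abs_of_pos (by linarith [(hw.bounds s h1).1])]
      have := (hw.bounds s h1).2
      have : s + h ≤ 5 / 2 * h := by linarith
      calc (s + h) * |s - h| ≤ (5 / 2 * h) * R := by gcongr
        _ = _ := by ring
    have h5' := abs_le.1 h5
    have h6 : |windowEnergy A s - (Q + κ₀ ^ 2)| ≤ (5 * A / b + 1) / h := by
      have : (5 * A / b + 1) / h = 5 / 8 * (8 * (A / b) / h) + 1 / h := by ring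
      rw [this, windowEnergy, abs_le]
      constructor <;> linarith [hE'.1, hE'.2]
    have h7 : (defectFreq A Q s - κ₀) * (defectFreq A Q s + κ₀) =
        windowEnergy A s - (Q + κ₀ ^ 2) := by
      linear_combination hsq s hs
    have h8 := hfreq s hs
    rw [← h7, abs_mul, abs_of_pos (by linarith : 0 < defectFreq A Q s + κ₀)] at h6
    have h9 : |defectFreq A Q s - κ₀| * (h / 4) ≤ (h / 4) / h := by
      calc _ ≤ |defectFreq A Q s - κ₀| * (defectFreq A Q s + κ₀) := by gcongr; linarith
        _ ≤ _ := h6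
        _ ≤ _ := by gcongr; linarith
    refine le_of_mul_le_mul_right (h9.trans_eq ?_) (by positivity : 0 < h / 4)
    ring

end Energy

section TwoZeros

variable {K B T : ℝ → ℝ}

lemma exists_zero_right {m r : ℝ} (hm : m < r) (hK : StrictMonoOn K (Set.Icc m r))
    (hKc : ContinuousOn K (Set.Icc m r)) (hBc : ContinuousOn B (Set.Icc m r))
    (hTc : ContinuousOn T (Set.Icc m r)) (hKm : K m < -2) (hKr : -2 < K r)
    (hT : MonotoneOn T (Set.Icc m r)) (hB : AntitoneOn B (Set.Icc m r))
    (hT0 : ∀ s ∈ Set.Icc m r, 0 < T s) (hB0 : ∀ s ∈ Set.Icc m r, B s < 0)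
    (hm0 : 0 < √(K m ^ 2 - 4) + T m * B m) :
    ∃ e ∈ Set.Ioo m r, K e = -2 ∧ (∀ s ∈ Set.Ico m e, K s < -2) ∧
      ∃ z ∈ Set.Ioo m e, √(K z ^ 2 - 4) + T z * B z = 0 ∧
        ∀ s ∈ Set.Ico m e, √(K s ^ 2 - 4) + T s * B s = 0 → s = z := by
  obtain ⟨e, he, hKe⟩ := intermediate_value_Ioo hm.le hKc ⟨hKm, hKr⟩
  have hsub : Set.Icc m e ⊆ Set.Icc m r := Set.Icc_subset_Icc_right he.2.le
  have hlt : ∀ s ∈ Set.Ico m e, K s < -2 := fun s hs => by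
    rw [← hKe]
    exact hK ⟨hs.1, hs.2.le.trans he.2.le⟩ ⟨he.1.le, he.2.le⟩ hs.2
  set f : ℝ → ℝ := fun s => √(K s ^ 2 - 4) + T s * B s with hf
  have hfc : ContinuousOn f (Set.Icc m e) :=
    ((((hKc.pow 2).sub continuousOn_const).sqrt).add (hTc.mul hBc)).mono hsub
  have hfe : f e < 0 := by
    have h1 : f e = T e * B e := by simp only [hf, hKe]; norm_num
    rw [h1]
    have he' : e ∈ Set.Icc m r := ⟨he.1.le, he.2.le⟩
    exact mul_neg_of_pos_of_neg (hT0 e he') (hB0 e he')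
  have hanti : StrictAntiOn f (Set.Ico m e) := fun x hx y hy hxy => by
    have hx' : x ∈ Set.Icc m r := ⟨hx.1, hx.2.le.trans he.2.le⟩
    have hy' : y ∈ Set.Icc m r := ⟨hy.1, hy.2.le.trans he.2.le⟩
    have h1 := hK hx' hy' hxy
    have h2 := hlt y hy
    have h3 : √(K y ^ 2 - 4) < √(K x ^ 2 - 4) := Real.sqrt_lt_sqrt (by nlinarith) (by nlinarith)
    have h4 : T x * -B x ≤ T y * -B y :=
      mul_le_mul (hT hx' hy' hxy.le) (neg_le_neg (hB hx' hy' hxy.le))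
        (neg_nonneg.2 (hB0 x hx').le) (hT0 y hy').le
    simp only [hf]
    linarith
  obtain ⟨z, hz, hfz⟩ := intermediate_value_Ioo' he.1.le hfc ⟨hfe, hm0⟩
  exact ⟨e, he, hKe, hlt, z, hz, hfz, fun s hs hs0 =>
    hanti.injOn hs ⟨hz.1.le, hz.2⟩ (hs0.trans hfz.symm)⟩

lemma exists_zero_left {l m : ℝ} (hm : l < m) (hK : StrictAntiOn K (Set.Icc l m))
    (hKc : ContinuousOn K (Set.Icc l m)) (hBc : ContinuousOn B (Set.Icc l m))
    (hTc : ContinuousOn T (Set.Icc l m)) (hKm : K m < -2) (hKl : -2 < K l)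
    (hT : MonotoneOn T (Set.Icc l m)) (hB : AntitoneOn B (Set.Icc l m))
    (hT0 : ∀ s ∈ Set.Icc l m, T s < 0) (hB0 : ∀ s ∈ Set.Icc l m, 0 < B s)
    (hm0 : 0 < √(K m ^ 2 - 4) + T m * B m) :
    ∃ e ∈ Set.Ioo l m, K e = -2 ∧ (∀ s ∈ Set.Ioc e m, K s < -2) ∧
      ∃ z ∈ Set.Ioo e m, √(K z ^ 2 - 4) + T z * B z = 0 ∧
        ∀ s ∈ Set.Ioc e m, √(K s ^ 2 - 4) + T s * B s = 0 → s = z := by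
  have hneg : Set.MapsTo (fun s : ℝ => -s) (Set.Icc (-m) (-l)) (Set.Icc l m) := fun s hs =>
    ⟨by linarith [hs.2], by linarith [hs.1]⟩
  have hc : ContinuousOn (fun s : ℝ => -s) (Set.Icc (-m) (-l)) := continuous_neg.continuousOn
  obtain ⟨e, he, hKe, hlt, z, hz, hfz, huniq⟩ := exists_zero_right (m := -m) (r := -l)
    (K := fun s => K (-s)) (T := fun s => -T (-s)) (B := fun s => -B (-s)) (neg_lt_neg hm)
    (fun x hx y hy hxy => hK (hneg hy) (hneg hx) (neg_lt_neg hxy))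
    (hKc.comp hc hneg) (hBc.comp hc hneg).neg (hTc.comp hc hneg).neg (by simpa using hKm)
    (by simpa using hKl)
    (fun x hx y hy hxy => neg_le_neg (hT (hneg hy) (hneg hx) (neg_le_neg hxy)))
    (fun x hx y hy hxy => neg_le_neg (hB (hneg hy) (hneg hx) (neg_le_neg hxy)))
    (fun s hs => neg_pos.2 (hT0 _ (hneg hs))) (fun s hs => neg_neg_iff_pos.2 (hB0 _ (hneg hs)))
    (by simpa using hm0)
  simp only [neg_mul_neg] at hfz huniq
  refine ⟨-e, ⟨by linarith [he.2], by linarith [he.1]⟩, hKe, fun s hs => ?_, -z,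
    ⟨by linarith [hz.2], by linarith [hz.1]⟩, hfz, fun s hs hs0 => ?_⟩
  · simpa using hlt (-s) ⟨by linarith [hs.2], by linarith [hs.1]⟩
  · rw [← huniq (-s) ⟨by linarith [hs.2], by linarith [hs.1]⟩ (by simpa using hs0), neg_neg]

end TwoZeros

section NearPi

variable {κ : ℝ} {j : ℤ}

lemma cos_near_int_mul_pi (hκ : |κ - j * Real.pi| ≤ 1 / 2) : 1 / 2 < |Real.cos κ| := by
  have h2 := Real.one_sub_sq_div_two_le_cos (x := κ - j * Real.pi)
  have h3 : (κ - j * Real.pi) ^ 2 ≤ (1 / 2) ^ 2 := sq_le_sq' (abs_le.1 hκ).1 (abs_le.1 hκ).2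
  have h4 : |Real.cos κ| = |Real.cos (κ - j * Real.pi)| := by
    rw [Real.cos_sub_int_mul_pi, abs_mul, abs_zpow, abs_neg, abs_one, _root_.one_zpow, one_mul]
  rw [h4]
  refine lt_of_lt_of_le ?_ (le_abs_self _)
  linarith

lemma abs_tan_near_int_mul_pi (hκ : |κ - j * Real.pi| ≤ 1 / 2) :
    |Real.tan κ| ≤ 2 * |κ - j * Real.pi| := by
  have h1 : 1 / 2 < |Real.cos (κ - j * Real.pi)| :=
    cos_near_int_mul_pi (j := 0) (by simpa using hκ)
  rw [← Real.tan_sub_int_mul_pi κ j, Real.tan_eq_sin_div_cos, abs_div,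
    div_le_iff₀ (by linarith)]
  have := Real.abs_sin_le_abs (x := κ - j * Real.pi)
  nlinarith [abs_nonneg (κ - j * Real.pi)]

lemma tan_pos_near_int_mul_pi (hκ : |κ - j * Real.pi| ≤ 1 / 2) (h : j * Real.pi < κ) :
    0 < Real.tan κ := by
  rw [← Real.tan_sub_int_mul_pi κ j]
  refine Real.tan_pos_of_pos_of_lt_pi_div_two (by linarith) ?_
  linarith [(abs_le.1 hκ).2, Real.pi_gt_three]

lemma tan_neg_near_int_mul_pi (hκ : |κ - j * Real.pi| ≤ 1 / 2) (h : κ < j * Real.pi) :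
    Real.tan κ < 0 := by
  rw [← Real.tan_sub_int_mul_pi κ j]
  refine Real.tan_neg_of_neg_of_pi_div_two_lt (by linarith) ?_
  linarith [(abs_le.1 hκ).1, Real.pi_gt_three]

lemma hasDerivAt_tan_div (hκ : Real.cos κ ≠ 0) (hκ0 : κ ≠ 0) :
    HasDerivAt (fun κ => Real.tan κ / (2 * κ))
      ((κ - Real.sin κ * Real.cos κ) / (2 * κ ^ 2 * Real.cos κ ^ 2)) κ := by
  refine ((Real.hasDerivAt_tan hκ).div ((hasDerivAt_id κ).const_mul 2)
    (mul_ne_zero two_ne_zero hκ0)).congr_deriv ?_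
  simp only [id, Real.tan_eq_sin_div_cos]
  field_simp

lemma monotoneOn_tan_div (j : ℤ) : MonotoneOn (fun κ => Real.tan κ / (2 * κ))
    (Set.Ici 1 ∩ Set.Icc (j * Real.pi - 1 / 2) (j * Real.pi + 1 / 2)) := by
  have hd : ∀ κ ∈ Set.Ici (1 : ℝ) ∩ Set.Icc (j * Real.pi - 1 / 2) (j * Real.pi + 1 / 2),
      HasDerivAt (fun κ => Real.tan κ / (2 * κ))
      ((κ - Real.sin κ * Real.cos κ) / (2 * κ ^ 2 * Real.cos κ ^ 2)) κ := fun κ hκ => by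
    have h1 : (1 : ℝ) ≤ κ := hκ.1
    have h2 := cos_near_int_mul_pi (j := j) (κ := κ)
      (abs_le.2 ⟨by linarith [hκ.2.1], by linarith [hκ.2.2]⟩)
    exact hasDerivAt_tan_div (abs_pos.1 (by linarith)) (by linarith)
  refine monotoneOn_of_deriv_nonneg ((convex_Ici _).inter (convex_Icc _ _))
    (fun κ hκ => (hd κ hκ).continuousAt.continuousWithinAt)
    (fun κ hκ => (hd κ (interior_subset hκ)).differentiableAt.differentiableWithinAt)
    fun κ hκ => ?_
  have hκ := interior_subset hκ
  have h1 : (1 : ℝ) ≤ κ := hκ.1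
  rw [(hd κ hκ).deriv]
  refine div_nonneg ?_ (by positivity)
  nlinarith [sq_nonneg (Real.sin κ - Real.cos κ), Real.sin_sq_add_cos_sq κ]

end NearPi

/-- The matching function, up to a nonvanishing factor. -/
noncomputable def matching (A b Q h s : ℝ) : ℝ :=
  √(gapDisc A b h s ^ 2 - 4) +
    Real.tan (defectFreq A Q s) / (2 * defectFreq A Q s) * gapShear A b Q h s

lemma exists_gap_with_two_zeros {A b Q h : ℝ} {j : ℤ} (hA : 0 < A) (hb : 0 < b)
    (hw : IsGoodWindow A b h) (hs : IsGoodShear A b Q h) (he : IsGoodEnergy A b Q (j * Real.pi) h)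
    (hj : 0 < j) (hh : 30 < h) :
    ∃ e₁ z₁ z₂ e₂, h - windowRadius A b h < e₁ ∧ e₁ < z₁ ∧ z₁ < h - windowRadius A b h / 4 ∧
      h + windowRadius A b h / 4 < z₂ ∧ z₂ < e₂ ∧ e₂ < h + windowRadius A b h ∧
      gapDisc A b h e₁ = -2 ∧ gapDisc A b h e₂ = -2 ∧
      (∀ s ∈ Set.Ioo e₁ e₂, gapDisc A b h s < -2) ∧
      ∀ s ∈ Set.Ioo e₁ e₂, matching A b Q h s = 0 ↔ s = z₁ ∨ s = z₂ := by
  have hR := windowRadius_pos hA hb hw.pos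
  set R := windowRadius A b h with hRdef
  have hmem : ∀ s ∈ Set.Icc (h - R) (h + R), |s - h| ≤ R := fun s hs =>
    abs_le.2 ⟨by linarith [hs.1], by linarith [hs.2]⟩
  have hL : Set.Icc (h - R) (h - R / 4) ⊆ Set.Icc (h - R) (h + R) :=
    Set.Icc_subset_Icc_right (by linarith)
  have hU : Set.Icc (h + R / 4) (h + R) ⊆ Set.Icc (h - R) (h + R) :=
    Set.Icc_subset_Icc_left (by linarith)
  have hnear : ∀ s ∈ Set.Icc (h - R) (h + R), |defectFreq A Q s - j * Real.pi| ≤ 1 / 2 :=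
    fun s hs => (he.freq_near s hs).trans (by
      rw [div_le_div_iff₀ hw.pos two_pos]; linarith)
  have hge : ∀ s ∈ Set.Icc (h - R) (h + R), 1 ≤ defectFreq A Q s := fun s hs => by
    linarith [he.freq_ge s hs]
  have hin : ∀ s ∈ Set.Icc (h - R) (h + R), defectFreq A Q s ∈
      Set.Ici 1 ∩ Set.Icc (j * Real.pi - 1 / 2) (j * Real.pi + 1 / 2) := fun s hs =>
    ⟨hge s hs, by linarith [(abs_le.1 (hnear s hs)).1], by linarith [(abs_le.1 (hnear s hs)).2]⟩
  set T : ℝ → ℝ := fun s => Real.tan (defectFreq A Q s) / (2 * defectFreq A Q s) with hTdef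
  have hTmono : MonotoneOn T (Set.Icc (h - R) (h + R)) := fun x hx y hy hxy => by
    refine monotoneOn_tan_div j (hin x hx) (hin y hy) (Real.sqrt_le_sqrt ?_)
    linarith [he.mono.monotoneOn hx hy hxy]
  have hTcont : ContinuousOn T (Set.Icc (h - R) (h + R)) := fun s hs => by
    have h1 := cos_near_int_mul_pi (hnear s hs)
    have h2 := hasDerivAt_tan_div (abs_pos.1 (by linarith)) (by linarith [hge s hs])
    exact h2.continuousAt.comp_continuousWithinAt
      ((he.cont s hs).sub continuousWithinAt_const).sqrt
  have hjπ : 0 < (j : ℝ) * Real.pi := mul_pos (by exact_mod_cast hj) Real.pi_pos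
  have hTneg : ∀ s ∈ Set.Icc (h - R) (h - R / 4), T s < 0 := fun s hs => by
    have hs' := hL hs
    have h1 : defectFreq A Q s < j * Real.pi := by
      refine lt_of_pow_lt_pow_left₀ 2 hjπ.le ?_
      have h2 := he.mono.monotoneOn hs' (hL ⟨by linarith, le_rfl⟩) hs.2
      linarith [he.freq_sq s hs', he.left]
    exact div_neg_of_neg_of_pos (tan_neg_near_int_mul_pi (hnear s hs') h1)
      (by linarith [hge s hs'])
  have hTpos : ∀ s ∈ Set.Icc (h + R / 4) (h + R), 0 < T s := fun s hs => by
    have hs' := hU hs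
    have h0 := hge s hs'
    have h1 : j * Real.pi < defectFreq A Q s := by
      refine lt_of_pow_lt_pow_left₀ 2 (by linarith) ?_
      have h2 := he.mono.monotoneOn (hU ⟨le_rfl, by linarith⟩) hs' hs.1
      linarith [he.freq_sq s hs', he.right]
    exact div_pos (tan_pos_near_int_mul_pi (hnear s hs') h1) (by linarith)
  have hK : ContinuousOn (gapDisc A b h) (Set.Icc (h - R) (h + R)) := fun s hs =>
    (hw.continuousAt_gapDisc (hmem s hs)).continuousWithinAt
  have hKlt : ∀ s ∈ Set.Icc (h - R / 4) (h + R / 4), gapDisc A b h s ≤ -2 - 6 * (A / h ^ 2) ^ 2 :=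
    fun s hs => hw.gapDisc_center hA hb
      (abs_le.2 ⟨by linarith [hs.1], by linarith [hs.2]⟩)
  have hε : 0 < A / h ^ 2 := by have := hw.pos; positivity
  have hε2 : 0 < (A / h ^ 2) ^ 2 := by positivity
  have hmid : ∀ s ∈ Set.Icc (h - R / 4) (h + R / 4), 0 < √(gapDisc A b h s ^ 2 - 4) +
      T s * gapShear A b Q h s := fun s hsm => by
    have hs' : s ∈ Set.Icc (h - R) (h + R) := ⟨by linarith [hsm.1], by linarith [hsm.2]⟩
    have h1 : 4 * (A / h ^ 2) ≤ √(gapDisc A b h s ^ 2 - 4) := by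
      apply Real.le_sqrt_of_sq_le
      nlinarith [hKlt s hsm]
    have h2 : |T s| ≤ 4 / h ^ 2 := by
      have h3 := (abs_tan_near_int_mul_pi (hnear s hs')).trans
        (mul_le_mul_of_nonneg_left (he.freq_near s hs') zero_le_two)
      have h4 := he.freq_ge s hs'
      have h5 := hge s hs'
      rw [hTdef, abs_div, abs_of_pos (by linarith : 0 < 2 * defectFreq A Q s)]
      calc _ ≤ 2 * (1 / h) / (2 * (h / 4)) := by
            have := hw.pos
            gcongr
        _ = _ := by field_simp
    have h3 := hs.abs_le s hs'
    have h4 : |T s * gapShear A b Q h s| < 4 * (A / h ^ 2) := by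
      rw [abs_mul]
      have := hw.pos
      calc _ ≤ 4 / h ^ 2 * (30 * A / h) := by gcongr
        _ = 4 * (A / h ^ 2) * (30 / h) := by ring
        _ < 4 * (A / h ^ 2) * 1 := by
          gcongr
          rw [div_lt_one hw.pos]
          exact hh
        _ = _ := mul_one _
    linarith [(abs_lt.1 h4).1]
  obtain ⟨e₁, he₁, hK₁, hl₁, z₁, hz₁, hfz₁, hu₁⟩ := exists_zero_left (by linarith)
    (hw.strictAntiOn_gapDisc hA hb) (hK.mono hL) (hs.cont.mono hL) (hTcont.mono hL)
    (by linarith [hKlt (h - R / 4) ⟨le_rfl, by linarith⟩])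
    (hw.gapDisc_end hA hb (by rw [← hRdef, abs_eq hR.le]; right; ring)) (hTmono.mono hL)
    (hs.anti.mono hL) hTneg hs.pos (hmid _ ⟨le_rfl, by linarith⟩)
  obtain ⟨e₂, he₂, hK₂, hl₂, z₂, hz₂, hfz₂, hu₂⟩ := exists_zero_right (by linarith)
    (hw.strictMonoOn_gapDisc hA hb) (hK.mono hU) (hs.cont.mono hU) (hTcont.mono hU)
    (by linarith [hKlt (h + R / 4) ⟨by linarith, le_rfl⟩])
    (hw.gapDisc_end hA hb (by rw [← hRdef, abs_eq hR.le]; left; ring)) (hTmono.mono hU)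
    (hs.anti.mono hU) hTpos hs.neg (hmid _ ⟨by linarith, le_rfl⟩)
  refine ⟨e₁, z₁, z₂, e₂, he₁.1, hz₁.1, hz₁.2, hz₂.1, hz₂.2, he₂.2, hK₁, hK₂, fun s hs => ?_,
    fun s hs => ⟨fun h0 => ?_, ?_⟩⟩
  · rcases le_total s (h - R / 4) with h1 | h1
    · exact hl₁ s ⟨hs.1, h1⟩
    rcases le_total (h + R / 4) s with h2 | h2
    · exact hl₂ s ⟨h2, hs.2⟩
    linarith [hKlt s ⟨h1, h2⟩]
  · rcases le_total s (h - R / 4) with h1 | h1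
    · exact Or.inl (hu₁ s ⟨hs.1, h1⟩ h0)
    rcases le_total (h + R / 4) s with h2 | h2
    · exact Or.inr (hu₂ s ⟨h2, hs.2⟩ h0)
    exact absurd h0 (hmid s ⟨h1, h2⟩).ne'
  · rintro (rfl | rfl)
    exacts [hfz₁, hfz₂]

lemma connectedComponentIn_eq_Ioo {S : Set ℝ} {x y c : ℝ} (hx : x ∉ S) (hy : y ∉ S)
    (hS : Set.Ioo x y ⊆ S) (hc : c ∈ Set.Ioo x y) : connectedComponentIn S c = Set.Ioo x y := by
  refine subset_antisymm (fun z hz => ?_)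
    (isPreconnected_Ioo.subset_connectedComponentIn hc hS)
  have hord := (isPreconnected_connectedComponentIn (x := c) (F := S)).ordConnected
  have hcc : c ∈ connectedComponentIn S c := mem_connectedComponentIn (hS hc)
  refine ⟨?_, ?_⟩
  · by_contra! h
    exact hx (connectedComponentIn_subset S c (hord.out hz hcc ⟨h, hc.1.le⟩))
  · by_contra! h
    exact hy (connectedComponentIn_subset S c (hord.out hcc hz ⟨hc.2.le, h⟩))

section Bridge

variable {A b h s Q : ℝ} {n : ℤ}

lemma cos_phase_add (hn : Odd n) (hbh : b * h = n * Real.pi) :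
    Real.cos (b * s) = -Real.cos (b * (s - h)) := by
  rw [show b * s = b * (s - h) + n * Real.pi by rw [← hbh]; ring, Real.cos_add_int_mul_pi,
    hn.neg_one_zpow, neg_one_mul]

lemma sin_phase_add (hn : Odd n) (hbh : b * h = n * Real.pi) :
    Real.sin (b * s) = -Real.sin (b * (s - h)) := by
  rw [show b * s = b * (s - h) + n * Real.pi by rw [← hbh]; ring, Real.sin_add_int_mul_pi,
    hn.neg_one_zpow, neg_one_mul]

lemma trace_monodromy_eq (hs0 : s ≠ 0) (hs : s ^ 4 - 4 * A ^ 2 ≠ 0) (hn : Odd n)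
    (hbh : b * h = n * Real.pi) :
    monodromy b (s / 2 + A / s) (s / 2 - A / s) 0 0 +
      monodromy b (s / 2 + A / s) (s / 2 - A / s) 1 1 = gapDisc A b h s := by
  have h1 : s / 2 + A / s = (s ^ 2 + 2 * A) / (2 * s) := by field_simp
  have h2 : s / 2 - A / s = (s ^ 2 - 2 * A) / (2 * s) := by field_simp
  have h3 : (s ^ 2 + 2 * A) * (s ^ 2 - 2 * A) = s ^ 4 - 4 * A ^ 2 := by ring
  have h4 : s ^ 2 + 2 * A ≠ 0 := left_ne_zero_of_mul (h3 ▸ hs)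
  have h5 : s ^ 2 - 2 * A ≠ 0 := right_ne_zero_of_mul (h3 ▸ hs)
  have h6 := cos_phase_add (s := s) hn hbh
  have h7 : Real.cos (b * s) = Real.cos ((s / 2 - A / s) * b) * Real.cos ((s / 2 + A / s) * b) -
      Real.sin ((s / 2 - A / s) * b) * Real.sin ((s / 2 + A / s) * b) := by
    rw [← Real.cos_add]; ring_nf
  have h8 : Real.cos (2 * A * b / s) =
      Real.cos ((s / 2 - A / s) * b) * Real.cos ((s / 2 + A / s) * b) +
      Real.sin ((s / 2 - A / s) * b) * Real.sin ((s / 2 + A / s) * b) := by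
    rw [← Real.cos_neg, ← Real.cos_sub]; ring_nf
  have h9 : (s / 2 + A / s) / (s / 2 - A / s) + (s / 2 - A / s) / (s / 2 + A / s) =
      2 + 2 * couplingCoeff A s := by
    rw [h1, h2, couplingCoeff, ← h3]
    field_simp
    ring
  rw [h7] at h6
  simp only [monodromy, Matrix.of_apply, Matrix.cons_val', Matrix.cons_val_zero,
    Matrix.cons_val_one, Matrix.cons_val_fin_one, gapDisc]
  rw [h8]
  linear_combination -(Real.sin ((s / 2 - A / s) * b) * Real.sin ((s / 2 + A / s) * b)) * h9 +
    (2 + couplingCoeff A s) * h6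

lemma shear_monodromy_eq {κ : ℝ} (hκ0 : κ ≠ 0) (hκ : κ ^ 2 = windowEnergy A s - Q) (hs0 : s ≠ 0)
    (hs : s ^ 4 - 4 * A ^ 2 ≠ 0) (hn : Odd n) (hbh : b * h = n * Real.pi) :
    κ * monodromy b (s / 2 + A / s) (s / 2 - A / s) 0 1 -
      monodromy b (s / 2 + A / s) (s / 2 - A / s) 1 0 / κ = gapShear A b Q h s / (2 * κ) := by
  have h1 : s / 2 + A / s = (s ^ 2 + 2 * A) / (2 * s) := by field_simp
  have h2 : s / 2 - A / s = (s ^ 2 - 2 * A) / (2 * s) := by field_simp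
  have h3 : (s ^ 2 + 2 * A) * (s ^ 2 - 2 * A) = s ^ 4 - 4 * A ^ 2 := by ring
  have h4 : s ^ 2 + 2 * A ≠ 0 := left_ne_zero_of_mul (h3 ▸ hs)
  have h5 : s ^ 2 - 2 * A ≠ 0 := right_ne_zero_of_mul (h3 ▸ hs)
  have h6 := sin_phase_add (s := s) hn hbh
  have h7 : Real.sin (b * s) = Real.sin ((s / 2 - A / s) * b) * Real.cos ((s / 2 + A / s) * b) +
      Real.cos ((s / 2 - A / s) * b) * Real.sin ((s / 2 + A / s) * b) := by
    rw [← Real.sin_add]; ring_nf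
  have h8 : Real.sin (2 * A * b / s) =
      Real.sin ((s / 2 + A / s) * b) * Real.cos ((s / 2 - A / s) * b) -
      Real.cos ((s / 2 + A / s) * b) * Real.sin ((s / 2 - A / s) * b) := by
    rw [← Real.sin_sub]; ring_nf
  rw [h7] at h6
  rw [show κ * monodromy b (s / 2 + A / s) (s / 2 - A / s) 0 1 -
      monodromy b (s / 2 + A / s) (s / 2 - A / s) 1 0 / κ =
      (2 * (κ ^ 2 * monodromy b (s / 2 + A / s) (s / 2 - A / s) 0 1 -
      monodromy b (s / 2 + A / s) (s / 2 - A / s) 1 0)) / (2 * κ) by field_simp]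
  congr 1
  have h6' := neg_eq_iff_eq_neg.1 h6.symm
  rw [gapShear, h6', hκ]
  simp only [monodromy, Matrix.of_apply, Matrix.cons_val', Matrix.cons_val_zero,
    Matrix.cons_val_one, Matrix.cons_val_fin_one, shearRest, shearCoeff, windowEnergy]
  rw [h8]
  generalize Real.sin ((s / 2 - A / s) * b) = S₁
  generalize Real.sin ((s / 2 + A / s) * b) = S₂
  generalize Real.cos ((s / 2 - A / s) * b) = C₁
  generalize Real.cos ((s / 2 + A / s) * b) = C₂
  rw [h1, h2, ← h3]
  field_simp
  ring

lemma IsGoodWindow.isDefectEigenvalue_iff {qp q : ℝ → ℝ} {W : ℝ → Matrix (Fin 2) (Fin 2) ℝ}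
    (hw : IsGoodWindow A b h) (hA : 0 < A) (hd : IsDefectPotential A b Q qp q)
    (hs : |s - h| ≤ windowRadius A b h) (hW : IsFundamentalSolution qp (windowEnergy A s) W)
    (hn : Odd n) (hbh : b * h = n * Real.pi) :
    (W (2 * b)).trace = gapDisc A b h s ∧
      (gapDisc A b h s < -2 → 0 < defectFreq A Q s →
        defectFreq A Q s ^ 2 = windowEnergy A s - Q → Real.cos (defectFreq A Q s) ≠ 0 →
        (IsDefectEigenvalue q (windowEnergy A s) ↔ matching A b Q h s = 0)) := by
  obtain ⟨hs0, hs4⟩ := hw.ne_zero hs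
  have hh := hw.pos
  have hspos : 0 < s := by linarith [(hw.bounds s hs).1]
  have hp0 : 0 < s / 2 + A / s := by positivity
  have hr0 : 0 < s / 2 - A / s := by
    have h1 : 2 * A < s ^ 2 := by
      refine lt_of_pow_lt_pow_left₀ 2 (by positivity) ?_
      nlinarith [hw.quartic s hs, pow_pos hA 2]
    rw [show s / 2 - A / s = (s ^ 2 - 2 * A) / (2 * s) by field_simp]
    exact div_pos (by linarith) (by positivity)
  have hp : (s / 2 + A / s) ^ 2 = windowEnergy A s + A := by
    unfold windowEnergy; field_simp; ring
  have hr : (s / 2 - A / s) ^ 2 = windowEnergy A s - A := by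
    unfold windowEnergy; field_simp; ring
  have htr := trace_monodromy_eq (A := A) hs0 hs4 hn hbh
  refine ⟨(hd.step.trace_fundamental hW hp0 hr0 hp hr).trans htr, fun hK hκ0 hκ hcos => ?_⟩
  have hD := Real.sq_sqrt (show 0 ≤ gapDisc A b h s ^ 2 - 4 by nlinarith)
  have hD0 := Real.sqrt_nonneg (gapDisc A b h s ^ 2 - 4)
  rw [hd.isDefectEigenvalue_iff hW hp0 hr0 hκ0.ne' hp hr hκ
    (lam := (gapDisc A b h s + √(gapDisc A b h s ^ 2 - 4)) / 2)
    (mu := (gapDisc A b h s - √(gapDisc A b h s ^ 2 - 4)) / 2) (by rw [htr]; ring)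
    (by linear_combination -hD / 4) (by nlinarith),
    shear_monodromy_eq hκ0.ne' hκ hs0 hs4 hn hbh]
  have hm : Real.cos (defectFreq A Q s) * ((gapDisc A b h s + √(gapDisc A b h s ^ 2 - 4)) / 2 -
      (gapDisc A b h s - √(gapDisc A b h s ^ 2 - 4)) / 2) +
      Real.sin (defectFreq A Q s) * (gapShear A b Q h s / (2 * defectFreq A Q s)) =
      Real.cos (defectFreq A Q s) * matching A b Q h s := by
    rw [matching, Real.tan_eq_sin_div_cos]
    field_simp
    ring
  rw [hm, mul_eq_zero]
  exact or_iff_right hcos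

/-- A gap containing the prescribed energy `Q + (j * π) ^ 2` has exactly two defect eigenvalues. -/
lemma exists_gap_two_eigenvalues {j : ℤ} {qp q k : ℝ → ℝ}
    {U : ℝ → ℝ → Matrix (Fin 2) (Fin 2) ℝ} (hA : 0 < A) (hb : 0 < b)
    (hU : ∀ E, IsFundamentalSolution qp E (U E)) (hk : ∀ E, k E = (U E (2 * b)).trace)
    (hd : IsDefectPotential A b Q qp q) (hw : IsGoodWindow A b h) (hs : IsGoodShear A b Q h)
    (he : IsGoodEnergy A b Q (j * Real.pi) h) (hj : 0 < j) (hh : 30 < h) (hn : Odd n)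
    (hbh : b * h = n * Real.pi) :
    ∃ G, IsGap k G ∧ {E ∈ G | IsDefectEigenvalue q E}.encard = 2 ∧
      Q + (j * Real.pi) ^ 2 ∈ G := by
  obtain ⟨e₁, z₁, z₂, e₂, h1, h2, h3, h4, h5, h6, hK₁, hK₂, hlt, huniq⟩ :=
    exists_gap_with_two_zeros hA hb hw hs he hj hh
  have hR := windowRadius_pos hA hb hw.pos
  set R := windowRadius A b h with hRdef
  set F := windowEnergy A with hF
  have hsub : Set.Icc e₁ e₂ ⊆ Set.Icc (h - R) (h + R) := Set.Icc_subset_Icc h1.le h6.le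
  have hmem : ∀ s ∈ Set.Icc e₁ e₂, |s - h| ≤ R := fun s hs =>
    abs_le.2 ⟨by linarith [hs.1], by linarith [hs.2]⟩
  have h12 : e₁ < e₂ := by linarith
  have hmono := he.mono.mono hsub
  have hkF : ∀ s ∈ Set.Icc e₁ e₂, k (F s) = gapDisc A b h s := fun s hs => by
    rw [hk]
    exact (hw.isDefectEigenvalue_iff hA hd (hmem s hs) (hU _) hn hbh).1
  have hsurj : ∀ E ∈ Set.Ioo (F e₁) (F e₂), ∃ s ∈ Set.Ioo e₁ e₂, F s = E := fun E hE =>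
    intermediate_value_Ioo h12.le (he.cont.mono hsub) hE
  have hIoo : ∀ s ∈ Set.Ioo e₁ e₂, F s ∈ Set.Ioo (F e₁) (F e₂) := fun s hs =>
    ⟨hmono ⟨le_rfl, h12.le⟩ ⟨hs.1.le, hs.2.le⟩ hs.1,
      hmono ⟨hs.1.le, hs.2.le⟩ ⟨h12.le, le_rfl⟩ hs.2⟩
  have hE : Q + (j * Real.pi) ^ 2 ∈ Set.Ioo (F e₁) (F e₂) :=
    ⟨(hIoo (h - R / 4) ⟨by linarith, by linarith⟩).1.trans he.left,
      he.right.trans (hIoo (h + R / 4) ⟨by linarith, by linarith⟩).2⟩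
  have hS : Set.Ioo (F e₁) (F e₂) ⊆ {E | k E ^ 2 > 4} := fun E hE => by
    obtain ⟨s, hs, rfl⟩ := hsurj E hE
    have := hlt s hs
    rw [Set.mem_ofPred_eq, hkF s ⟨hs.1.le, hs.2.le⟩]
    nlinarith
  have hz₁ : z₁ ∈ Set.Ioo e₁ e₂ := ⟨h2, by linarith⟩
  have hz₂ : z₂ ∈ Set.Ioo e₁ e₂ := ⟨by linarith, h5⟩
  have heig : ∀ s ∈ Set.Ioo e₁ e₂, IsDefectEigenvalue q (F s) ↔ s = z₁ ∨ s = z₂ := fun s hs => by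
    have hs' : s ∈ Set.Icc e₁ e₂ := ⟨hs.1.le, hs.2.le⟩
    have hnear := cos_near_int_mul_pi ((he.freq_near s (hsub hs')).trans
      ((div_le_div_iff₀ hw.pos two_pos).2 (by linarith)))
    rw [← huniq s hs]
    exact (hw.isDefectEigenvalue_iff hA hd (hmem s hs') (hU _) hn hbh).2 (hlt s hs)
      (by linarith [he.freq_ge s (hsub hs')]) (he.freq_sq s (hsub hs'))
      (abs_pos.1 (by linarith))
  refine ⟨Set.Ioo (F e₁) (F e₂), ⟨Metric.isBounded_Ioo _ _, _, hS hE,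
    (connectedComponentIn_eq_Ioo ?_ ?_ hS hE).symm⟩, ?_, hE⟩
  · rw [Set.mem_ofPred_eq, hkF e₁ ⟨le_rfl, h12.le⟩, hK₁]; norm_num
  · rw [Set.mem_ofPred_eq, hkF e₂ ⟨h12.le, le_rfl⟩, hK₂]; norm_num
  · have : {E ∈ Set.Ioo (F e₁) (F e₂) | IsDefectEigenvalue q E} = {F z₁, F z₂} := by
      ext E
      constructor
      · rintro ⟨hE, hE'⟩
        obtain ⟨s, hs, rfl⟩ := hsurj E hE
        rcases (heig s hs).1 hE' with rfl | rfl <;> simp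
      · rintro (rfl | rfl)
        · exact ⟨hIoo _ hz₁, (heig _ hz₁).2 (Or.inl rfl)⟩
        · exact ⟨hIoo _ hz₂, (heig _ hz₂).2 (Or.inr rfl)⟩
    rw [this, Set.encard_pair]
    exact (hmono ⟨hz₁.1.le, hz₁.2.le⟩ ⟨hz₂.1.le, hz₂.2.le⟩ (by linarith)).ne

end Bridge

lemma exists_odd_fibonacci_norm (m : ℕ) : ∃ n N : ℤ, Odd n ∧ (m : ℤ) < n ∧ n < N ∧
    N ^ 2 - N * n - n ^ 2 = -11 := by
  induction m with
  | zero => exact ⟨23, 37, by decide, by norm_num, by norm_num, by norm_num⟩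
  | succ m ih =>
    obtain ⟨n, N, ⟨c, hc⟩, h1, h2, h3⟩ := ih
    refine ⟨5 * n + 8 * N, 8 * n + 13 * N, ⟨5 * c + 2 + 4 * N, by rw [hc]; ring⟩, ?_, by linarith,
      by linear_combination h3⟩
    push_cast
    linarith

/-- The energy of the defect is close to the center of a gap. -/
lemma golden_energy_estimate {φ n N : ℝ} (hφ : φ = (1 + √5) / 2) (hn : 0 < n) (hN : n < N)
    (h : N ^ 2 - N * n - n ^ 2 = -11) :
    |22 * Real.pi ^ 2 / (√5 * φ) + ((N - n) * Real.pi) ^ 2 - (2 * n * Real.pi / φ) ^ 2 / 4| ≤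
      484 * Real.pi ^ 4 / (2 * n * Real.pi / φ) ^ 2 := by
  have h5 : √5 ^ 2 = 5 := Real.sq_sqrt (by norm_num)
  have h50 : 2 < √5 := Real.lt_sqrt_of_sq_lt (by norm_num)
  have hφ1 : 1 < φ := by linarith
  have hφ2 : φ ^ 2 = φ + 1 := by rw [hφ]; linear_combination h5 / 4
  have hs : √5 = 2 * φ - 1 := by rw [hφ]; ring
  have hπ := Real.pi_pos
  set x := n * φ - N with hx
  have h1 : x * (N + n * (φ - 1)) = 11 := by
    rw [hx]; linear_combination n ^ 2 * hφ2 - h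
  have h2 : n < N + n * (φ - 1) := by nlinarith
  have hx0 : 0 < x := by
    by_contra! hc
    nlinarith
  have hxn : x * n ≤ 11 := by nlinarith
  have hs1 : 2 < √5 * φ := by nlinarith
  have hinv : φ⁻¹ = φ - 1 := inv_eq_of_mul_eq_one_right (by linear_combination hφ2)
  set i := (√5 * φ)⁻¹ with hi
  have hi1 : i * (2 * φ - 1) = φ - 1 := by
    rw [← hs, ← hinv, hi]
    field_simp
  have h3 : 22 * Real.pi ^ 2 / (√5 * φ) + ((N - n) * Real.pi) ^ 2 -
      (2 * n * Real.pi / φ) ^ 2 / 4 = Real.pi ^ 2 * x ^ 2 * (1 - 2 * i) := by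
    rw [div_eq_mul_inv, div_eq_mul_inv (2 * n * Real.pi), ← hi, hinv]
    linear_combination (-2 * Real.pi ^ 2 * i) * h1 + 2 * Real.pi ^ 2 * x * n * hi1
  have hi0 : 0 < i := by positivity
  have hi2 : 2 * i ≤ 1 := by
    rw [hi, ← div_eq_mul_inv, div_le_one (by positivity)]
    exact hs1.le
  have h4 : (x * n) ^ 2 ≤ 11 ^ 2 := pow_le_pow_left₀ (by positivity) hxn 2
  rw [h3, abs_of_nonneg (mul_nonneg (by positivity) (by linarith))]
  calc Real.pi ^ 2 * x ^ 2 * (1 - 2 * i) ≤ Real.pi ^ 2 * x ^ 2 * 1 := by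
        gcongr
        linarith
    _ = Real.pi ^ 2 * (x * n) ^ 2 * 1 / n ^ 2 := by field_simp
    _ ≤ Real.pi ^ 2 * 11 ^ 2 * φ ^ 2 / n ^ 2 := by
        gcongr
        nlinarith
    _ = 484 * Real.pi ^ 4 / (2 * n * Real.pi / φ) ^ 2 := by
        field_simp
        norm_num

theorem infinite_gaps_of_golden {φ : ℝ} (hφ : φ = (1 + √5) / 2) {A : ℝ} (hA : 0 < A)
    {qp q k : ℝ → ℝ} {U : ℝ → ℝ → Matrix (Fin 2) (Fin 2) ℝ}
    (hU : ∀ E, IsFundamentalSolution qp E (U E)) (hk : ∀ E, k E = (U E (2 * (φ / 2))).trace)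
    (hd : IsDefectPotential A (φ / 2) (22 * Real.pi ^ 2 / (√5 * φ)) qp q) :
    {G : Set ℝ | IsGap k G ∧ {E ∈ G | IsDefectEigenvalue q E}.encard = 2}.Infinite := by
  have hb := hd.step.pos
  have hφ0 : 0 < φ := by linarith
  set Q := 22 * Real.pi ^ 2 / (√5 * φ) with hQ
  set C := 484 * Real.pi ^ 4 with hC
  intro hfin
  have hbdd : BddAbove (⋃₀ {G : Set ℝ | IsGap k G ∧ {E ∈ G | IsDefectEigenvalue q E}.encard = 2}) :=
    ((Bornology.isBounded_sUnion hfin).2 fun G hG => hG.1.1).bddAbove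
  obtain ⟨M, hM⟩ := hbdd
  have hC1 : ∀ᶠ h : ℝ in Filter.atTop, C / h ^ 2 ≤ 1 :=
    (Filter.Tendsto.const_div_atTop (Filter.tendsto_pow_atTop two_ne_zero)
      C).eventually_le_const one_pos
  obtain ⟨H, hH⟩ := Filter.eventually_atTop.1 ((eventually_isGoodWindow (A := A) hb).and
    ((eventually_isGoodShear hA hb Q).and ((eventually_isGoodEnergy hA hb Q C).and
    (hC1.and ((Filter.eventually_gt_atTop (30 : ℝ)).and
    (Filter.eventually_gt_atTop (4 * (|M| + 1))))))))
  obtain ⟨m, hm⟩ := exists_nat_gt H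
  obtain ⟨n, N, hn, hmn, hnN, hnorm⟩ := exists_odd_fibonacci_norm m
  have hn0 : (0 : ℝ) < n := by exact_mod_cast (Int.natCast_nonneg m).trans_lt hmn
  have hnN' : (n : ℝ) < N := by exact_mod_cast hnN
  have hest := golden_energy_estimate hφ hn0 hnN' (by exact_mod_cast hnorm)
  set h := 2 * n * Real.pi / φ with hh
  have hφ3 : φ < 2 := by
    have : √5 < 3 := (Real.sqrt_lt' (by norm_num)).2 (by norm_num)
    linarith
  have hHh : H ≤ h := by
    have h1 : (m : ℝ) < n := by exact_mod_cast hmn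
    have h2 : (n : ℝ) ≤ h := by
      rw [hh, le_div_iff₀ hφ0]
      nlinarith [Real.pi_gt_three]
    linarith
  obtain ⟨g1, g2, g3, g4, g5, g6⟩ := hH h hHh
  have hj : 0 < N - n := by linarith
  have hjπ : 0 < ((N - n : ℤ) : ℝ) * Real.pi := mul_pos (by exact_mod_cast hj) Real.pi_pos
  rw [← Int.cast_sub] at hest
  obtain ⟨G, hG, hG2, hE⟩ := exists_gap_two_eigenvalues hA hb hU hk hd g1 g2 (g3 _ hjπ hest) hj g5
    hn (by rw [hh]; field_simp)
  have h1 := hM (Set.mem_sUnion_of_mem hE ⟨hG, hG2⟩)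
  have h2 := (abs_le.1 (hest.trans g4)).1
  nlinarith [le_abs_self M, abs_nonneg M]

/-- **Example with infinitely many gaps containing two eigenvalues.** Take `a = φ` the
golden mean, the Kronig–Penney periodic potential equal to `-A` on `[0, φ/2)` and `A` on
`[φ/2, φ)` (extended `φ`-periodically) with `A > 22π²/(√15 φ)`, and the constant defect
potential `q_def ≡ 22π²/(√5 φ)`. Then infinitely many gaps contain exactly two defect
eigenvalues. -/
theorem infinitely_many_gaps_with_two_eigenvalues
    (φ : ℝ) (hφ : φ = (1 + Real.sqrt 5) / 2)
    (A : ℝ) (hA : A > 22 * Real.pi ^ 2 / (Real.sqrt 15 * φ))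
    (q_per q_def : ℝ → ℝ)
    (hdef : ∀ x, q_def x = 22 * Real.pi ^ 2 / (Real.sqrt 5 * φ))
    (hper : ∀ x, q_per (x + φ) = q_per x)
    (hper1 : ∀ x, 0 ≤ x → x < φ / 2 → q_per x = -A)
    (hper2 : ∀ x, φ / 2 ≤ x → x < φ → q_per x = A)
    (U N : ℝ → ℝ → Matrix (Fin 2) (Fin 2) ℝ)
    (hU : ∀ E, IsFundamentalSolution q_per E (U E))
    (hN : ∀ E, IsFundamentalSolution q_def E (N E))
    (q : ℝ → ℝ)
    (hq : ∀ x, q x = if x ≤ 0 then q_per x else if x < 1 then q_def x else q_per (x - 1))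
    (k : ℝ → ℝ) (hk : ∀ E, k E = (U E φ).trace) :
    {G : Set ℝ | IsGap k G ∧
      {E ∈ G | IsDefectEigenvalue q E}.encard = 2}.Infinite := by
  have hφ0 : 0 < φ := by rw [hφ]; positivity
  have h2 : 2 * (φ / 2) = φ := by ring
  have hstep : IsStepPotential A (φ / 2) q_per :=
    ⟨by positivity, by rwa [h2], hper1, by rwa [h2]⟩
  refine infinite_gaps_of_golden hφ (lt_trans (by positivity) hA) hU (by rwa [h2])
    ⟨hstep, fun x => ?_⟩
  rw [hq, hdef]
end

section
/- Let n₁, n₂, n₃ be integers with n₁ ≠ 0 and gcd(n₁, n₂, n₃) = 1, and let a be an irrational real number with n₁·a² + n₂·a + n₃ = 0. Then 𝓕(a) = { j/(2·n₁·a + n₂) | j ∈ ℤ and there exist integers N, M, not both zero, with n₁·N² + n₂·N·M + n₃·M² = j }. -/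
/-- On the form with root `a`, the value `M (N - M a)` differs from the normalized value of the
form by a quadratic error in `N - M a`. -/
theorem quadratic_form_eq_of_root {n₁ n₂ n₃ : ℤ} {a : ℝ}
    (hroot : (n₁ : ℝ) * a ^ 2 + (n₂ : ℝ) * a + (n₃ : ℝ) = 0) (N M : ℤ) :
    ((n₁ * N ^ 2 + n₂ * N * M + n₃ * M ^ 2 : ℤ) : ℝ) =
      (2 * (n₁ : ℝ) * a + n₂) * ((M : ℝ) * (N - M * a)) + n₁ * (N - M * a) ^ 2 := by
  push_cast
  linear_combination (M : ℝ) ^ 2 * hroot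

theorem Irrational.int_sub_int_mul_ne_zero {a : ℝ} (ha : Irrational a) {N M : ℤ}
    (h : ¬(N = 0 ∧ M = 0)) : (N : ℝ) - M * a ≠ 0 := by
  intro h0
  by_cases hM : M = 0
  · subst hM
    simp at h0
    exact h ⟨h0, rfl⟩
  · have hM' : (M : ℝ) ≠ 0 := by exact_mod_cast hM
    refine ha ⟨(N : ℚ) / M, ?_⟩
    push_cast
    field_simp
    linarith

theorem Irrational.two_mul_int_mul_add_int_ne_zero {a : ℝ} (ha : Irrational a) {n₁ : ℤ}
    (hn₁ : n₁ ≠ 0) (m : ℤ) : 2 * (n₁ : ℝ) * a + m ≠ 0 := by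
  have h := ha.int_sub_int_mul_ne_zero (N := m) (M := -(2 * n₁)) (by omega)
  push_cast at h
  intro h0
  apply h
  linarith

/-- The Pell equation for the discriminant has a solution whose associated unit has absolute
value less than one. -/
theorem exists_pell_contraction {n₁ n₂ n₃ : ℤ} (hn₁ : n₁ ≠ 0) {a : ℝ} (ha : Irrational a)
    (hroot : (n₁ : ℝ) * a ^ 2 + (n₂ : ℝ) * a + (n₃ : ℝ) = 0) :
    ∃ t u : ℤ, t ^ 2 - (n₂ ^ 2 - 4 * n₁ * n₃) * u ^ 2 = 1 ∧
      |(t : ℝ) - (2 * (n₁ : ℝ) * a + n₂) * u| < 1 := by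
  have hD := ha.two_mul_int_mul_add_int_ne_zero hn₁ n₂
  have hDsq : (2 * (n₁ : ℝ) * a + n₂) ^ 2 = ((n₂ ^ 2 - 4 * n₁ * n₃ : ℤ) : ℝ) := by
    push_cast
    linear_combination 4 * (n₁ : ℝ) * hroot
  have hpos : 0 < n₂ ^ 2 - 4 * n₁ * n₃ := by
    have : (0 : ℝ) < ((n₂ ^ 2 - 4 * n₁ * n₃ : ℤ) : ℝ) := by
      rw [← hDsq]
      positivity
    exact_mod_cast this
  have hns : ¬IsSquare (n₂ ^ 2 - 4 * n₁ * n₃) := by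
    rintro ⟨s, hs⟩
    rw [hs] at hDsq
    push_cast at hDsq
    have hfac : (2 * (n₁ : ℝ) * a + (n₂ - s : ℤ)) * (2 * (n₁ : ℝ) * a + (n₂ + s : ℤ)) = 0 := by
      push_cast
      linear_combination hDsq
    exact mul_ne_zero (ha.two_mul_int_mul_add_int_ne_zero hn₁ _)
      (ha.two_mul_int_mul_add_int_ne_zero hn₁ _) hfac
  obtain ⟨x, y, hxy, hy⟩ := Pell.exists_of_not_isSquare hpos hns
  have hy' : (y : ℝ) ≠ 0 := by exact_mod_cast hy
  set D : ℝ := 2 * (n₁ : ℝ) * a + n₂ with hDdef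
  have hprod : ((x : ℝ) - D * y) * (x + D * y) = 1 := by
    have h : ((x ^ 2 - (n₂ ^ 2 - 4 * n₁ * n₃) * y ^ 2 : ℤ) : ℝ) = 1 := by exact_mod_cast hxy
    push_cast at h hDsq
    linear_combination h - (y : ℝ) ^ 2 * hDsq
  by_cases h1 : |(x : ℝ) - D * y| < 1
  · exact ⟨x, y, hxy, h1⟩
  · refine ⟨x, -y, by rw [← hxy]; ring, ?_⟩
    push_cast
    by_contra h2
    have h2' : 1 ≤ |(x : ℝ) + D * y| := by
      rw [not_lt] at h2
      simpa [sub_neg_eq_add] using h2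
    rw [not_lt] at h1
    have hs1 := (one_le_sq_iff_one_le_abs _).2 h1
    have hs2 := (one_le_sq_iff_one_le_abs _).2 h2'
    have hDy : 0 < (D * y) ^ 2 := by positivity
    have hsq : ((x : ℝ) - D * y) ^ 2 * (x + D * y) ^ 2 = 1 := by
      rw [← mul_pow, hprod, one_pow]
    nlinarith

/-- A nontrivially represented integer is represented at points arbitrarily close to the line
`N = M a`. -/
theorem exists_quadratic_form_eq_of_close {n₁ n₂ n₃ : ℤ} (hn₁ : n₁ ≠ 0) {a : ℝ}
    (ha : Irrational a) (hroot : (n₁ : ℝ) * a ^ 2 + (n₂ : ℝ) * a + (n₃ : ℝ) = 0) {j N₀ M₀ : ℤ}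
    (h₀ : ¬(N₀ = 0 ∧ M₀ = 0)) (hj : n₁ * N₀ ^ 2 + n₂ * N₀ * M₀ + n₃ * M₀ ^ 2 = j)
    {ε : ℝ} (hε : 0 < ε) :
    ∃ N M : ℤ, 1 ≤ M ∧ n₁ * N ^ 2 + n₂ * N * M + n₃ * M ^ 2 = j ∧ |(N : ℝ) - M * a| < ε := by
  obtain ⟨t, u, htu, hr⟩ := exists_pell_contraction hn₁ ha hroot
  set r : ℝ := (t : ℝ) - (2 * (n₁ : ℝ) * a + n₂) * u with hrdef
  have hr0 : r ≠ 0 := by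
    intro h
    have h' : r * (t + (2 * (n₁ : ℝ) * a + n₂) * u) = 1 := by
      have hcast : ((t ^ 2 - (n₂ ^ 2 - 4 * n₁ * n₃) * u ^ 2 : ℤ) : ℝ) = 1 := by exact_mod_cast htu
      push_cast at hcast
      rw [hrdef]
      linear_combination hcast - 4 * (n₁ : ℝ) * (u : ℝ) ^ 2 * hroot
    simp [h] at h'
  have hiter : ∀ k : ℕ, ∃ N M : ℤ, n₁ * N ^ 2 + n₂ * N * M + n₃ * M ^ 2 = j ∧
      (N : ℝ) - M * a = r ^ k * (N₀ - M₀ * a) := by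
    intro k
    induction k with
    | zero => exact ⟨N₀, M₀, hj, by simp⟩
    | succ k ih =>
      obtain ⟨N, M, hf, hNM⟩ := ih
      refine ⟨(t - n₂ * u) * N - 2 * n₃ * u * M, 2 * n₁ * u * N + (t + n₂ * u) * M, ?_, ?_⟩
      · linear_combination (n₁ * N ^ 2 + n₂ * N * M + n₃ * M ^ 2) * htu + hf
      · rw [pow_succ, mul_right_comm (r ^ k), ← hNM, hrdef]
        push_cast
        linear_combination (-2 * (u : ℝ) * M) * hroot
  have hc := ha.int_sub_int_mul_ne_zero h₀
  have hcpos := abs_pos.2 hc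
  obtain ⟨k, hk⟩ := exists_pow_lt_of_lt_one
    (div_pos (lt_min hε one_pos) hcpos) hr
  rw [lt_div_iff₀ hcpos, ← abs_pow, ← abs_mul] at hk
  obtain ⟨N, M, hf, hNM⟩ := hiter k
  rw [← hNM] at hk
  have hne : (N : ℝ) - M * a ≠ 0 := by
    rw [hNM]
    exact mul_ne_zero (pow_ne_zero _ hr0) hc
  have hM : M ≠ 0 := by
    rintro rfl
    have h1 := hk.trans_le (min_le_right _ _)
    simp only [Int.cast_zero, zero_mul, sub_zero] at h1 hne
    have h2 : |N| < 1 := by exact_mod_cast h1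
    exact hne (by exact_mod_cast Int.abs_lt_one_iff.1 h2)
  have hlt := hk.trans_le (min_le_left _ _)
  rcases lt_or_gt_of_ne hM with h | h
  · refine ⟨-N, -M, by omega, by rw [← hf]; ring, ?_⟩
    rw [← abs_neg] at hlt
    have hneg : ((-N : ℤ) : ℝ) - (-M : ℤ) * a = -((N : ℝ) - M * a) := by
      push_cast
      ring
    rwa [hneg]
  · exact ⟨N, M, h, hf, hlt⟩

/-- An infinite set of points near a hyperbola `M (N - M a) = y` has unbounded second
coordinates. -/
theorem exists_lt_of_infinite_near_hyperbola {a y δ : ℝ}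
    (h : {p : ℤ × ℤ | 1 ≤ p.2 ∧
      |y - (p.2 : ℝ) * ((p.1 : ℝ) - (p.2 : ℝ) * a)| < δ}.Infinite) (B : ℤ) :
    ∃ N M : ℤ, B < M ∧ 1 ≤ M ∧ |y - (M : ℝ) * ((N : ℝ) - M * a)| < δ := by
  by_contra! hcon
  set C : ℤ := ⌈|y| + δ + |(B : ℝ)| * |a|⌉
  refine h (((Set.finite_Icc (-C) C).prod (Set.finite_Icc 1 B)).subset ?_)
  rintro ⟨N, M⟩ ⟨hM, hy⟩
  simp only at hM hy
  have hMB : M ≤ B := by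
    by_contra hlt
    exact absurd hy (not_lt.2 (hcon N M (not_le.1 hlt) hM))
  have hM' : (1 : ℝ) ≤ M := by exact_mod_cast hM
  have hMB' : (M : ℝ) ≤ |(B : ℝ)| := le_trans (by exact_mod_cast hMB) (le_abs_self _)
  have h1 : |(M : ℝ) * ((N : ℝ) - M * a)| ≤ |y| + δ := by
    have := abs_sub_abs_le_abs_sub ((M : ℝ) * ((N : ℝ) - M * a)) y
    rw [abs_sub_comm] at this
    linarith
  rw [abs_mul, abs_of_pos (by linarith : (0 : ℝ) < M)] at h1
  have h2 : |(N : ℝ) - M * a| ≤ |y| + δ :=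
    (le_mul_of_one_le_left (abs_nonneg _) hM').trans h1
  have h3 : |(M : ℝ) * a| ≤ |(B : ℝ)| * |a| := by
    rw [abs_mul, abs_of_pos (by linarith : (0 : ℝ) < M)]
    gcongr
  have h4 : |(N : ℝ)| ≤ C := by
    have := abs_sub_abs_le_abs_sub (N : ℝ) (M * a)
    exact le_trans (by linarith) (Int.le_ceil _)
  have h5 : |N| ≤ C := by exact_mod_cast h4
  exact ⟨abs_le.1 h5, hM, hMB⟩

/-- If `y ∈ Fset a`, the values of the form come arbitrarily close to `(2 n₁ a + n₂) y`. -/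
theorem exists_quadratic_form_near_of_mem_Fset {n₁ n₂ n₃ : ℤ} {a : ℝ}
    (hroot : (n₁ : ℝ) * a ^ 2 + (n₂ : ℝ) * a + (n₃ : ℝ) = 0) {y : ℝ} (hy : y ∈ Fset a)
    {η : ℝ} (hη : 0 < η) :
    ∃ N M : ℤ, 1 ≤ M ∧ |(2 * (n₁ : ℝ) * a + n₂) * y -
      ((n₁ * N ^ 2 + n₂ * N * M + n₃ * M ^ 2 : ℤ) : ℝ)| < η := by
  set D : ℝ := 2 * (n₁ : ℝ) * a + n₂ with hD
  set δ : ℝ := min 1 (η / (2 * (|D| + 1)))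
  have hδ : 0 < δ := by positivity
  set K : ℝ := |(n₁ : ℝ)| * (|y| + 1) ^ 2
  have hK : 0 ≤ K := by positivity
  obtain ⟨N, M, hB, hM, hNM⟩ := exists_lt_of_infinite_near_hyperbola (hy δ hδ) ⌈2 * K / η⌉
  refine ⟨N, M, hM, ?_⟩
  have hM' : (1 : ℝ) ≤ M := by exact_mod_cast hM
  have hKM : K < η / 2 * M := by
    have := (Int.le_ceil (2 * K / η)).trans_lt (Int.cast_lt.2 hB)
    rw [div_lt_iff₀ hη] at this
    linarith
  rw [quadratic_form_eq_of_root hroot, ← hD]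
  set z : ℝ := (N : ℝ) - M * a
  have h1 : |(M : ℝ) * z| ≤ |y| + 1 := by
    have := abs_sub_abs_le_abs_sub ((M : ℝ) * z) y
    rw [abs_sub_comm] at this
    have := hNM.trans_le (min_le_left _ _)
    linarith
  have hsq : (M : ℝ) ^ 2 * z ^ 2 ≤ (|y| + 1) ^ 2 := by
    rw [← mul_pow, ← sq_abs]
    gcongr
  have hz : |(n₁ : ℝ)| * z ^ 2 < η / 2 := by
    have hle : |(n₁ : ℝ)| * z ^ 2 * M ≤ K := by
      calc |(n₁ : ℝ)| * z ^ 2 * M ≤ |(n₁ : ℝ)| * z ^ 2 * M ^ 2 := by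
            gcongr
            exact le_self_pow₀ hM' two_ne_zero
        _ = |(n₁ : ℝ)| * ((M : ℝ) ^ 2 * z ^ 2) := by ring
        _ ≤ K := mul_le_mul_of_nonneg_left hsq (abs_nonneg _)
    exact lt_of_mul_lt_mul_right (hle.trans_lt hKM) (by linarith)
  have hmain : |D| * |y - M * z| ≤ η / 2 := by
    have h2 := hNM.le.trans (min_le_right _ _)
    rw [le_div_iff₀ (by positivity)] at h2
    nlinarith [abs_nonneg (y - M * z), abs_nonneg D]
  calc |D * y - (D * (M * z) + n₁ * z ^ 2)| = |D * (y - M * z) - n₁ * z ^ 2| := by ring_nf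
    _ ≤ |D * (y - M * z)| + |n₁ * z ^ 2| := abs_sub _ _
    _ = |D| * |y - M * z| + |(n₁ : ℝ)| * z ^ 2 := by
        rw [abs_mul, abs_mul, abs_of_nonneg (sq_nonneg z)]
    _ < η := by linarith

/-- For a quadratic irrational `a`, root of `n₁ x² + n₂ x + n₃` with `n₁, n₂, n₃`
relatively prime integers, `𝓕(a)` consists exactly of the numbers `j / (2 n₁ a + n₂)`
where `j` is an integer representable as `n₁ N² + n₂ N M + n₃ M²` with `(N, M) ≠ (0, 0)`. -/
theorem Fset_of_quadratic_irrational (n₁ n₂ n₃ : ℤ) (hn₁ : n₁ ≠ 0)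
    (hgcd : Int.gcd n₁ (Int.gcd n₂ n₃) = 1)
    (a : ℝ) (ha : Irrational a)
    (hroot : (n₁ : ℝ) * a ^ 2 + (n₂ : ℝ) * a + (n₃ : ℝ) = 0) :
    Fset a = {y : ℝ | ∃ j : ℤ,
      (∃ N M : ℤ, ¬(N = 0 ∧ M = 0) ∧ n₁ * N ^ 2 + n₂ * N * M + n₃ * M ^ 2 = j) ∧
      y = (j : ℝ) / (2 * (n₁ : ℝ) * a + (n₂ : ℝ))} := by
  have hD := ha.two_mul_int_mul_add_int_ne_zero hn₁ n₂
  ext y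
  constructor
  · intro hy
    obtain ⟨N, M, hM, h⟩ :=
      exists_quadratic_form_near_of_mem_Fset hroot hy (by norm_num : (0 : ℝ) < 1 / 2)
    refine ⟨_, ⟨N, M, by omega, rfl⟩, ?_⟩
    rw [eq_div_iff hD, mul_comm]
    by_contra hne
    obtain ⟨N', M', -, h'⟩ := exists_quadratic_form_near_of_mem_Fset hroot hy
      (lt_min (by norm_num : (0 : ℝ) < 1 / 2) (abs_pos.2 (sub_ne_zero.2 hne)))
    generalize n₁ * N ^ 2 + n₂ * N * M + n₃ * M ^ 2 = j at *
    generalize n₁ * N' ^ 2 + n₂ * N' * M' + n₃ * M' ^ 2 = j' at *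
    obtain ⟨h1, h2⟩ := lt_min_iff.1 h'
    have hjj : |(j : ℝ) - j'| < 1 := by
      rw [abs_lt] at *
      constructor <;> linarith
    have hjj' : |j - j'| < 1 := by exact_mod_cast hjj
    have heq : j = j' := sub_eq_zero.1 (Int.abs_lt_one_iff.1 hjj')
    rw [heq] at h2
    exact lt_irrefl _ h2
  · rintro ⟨j, ⟨N₀, M₀, h₀, hj⟩, rfl⟩ δ hδ hfin
    set D : ℝ := 2 * (n₁ : ℝ) * a + n₂ with hDdef
    set c : ℝ := |(n₁ : ℝ)| / |D|
    have hc : 0 ≤ c := by positivity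
    set ε : ℝ := min 1 (δ / (c + 1))
    have hε : 0 < ε := by positivity
    have hmem : ∀ N M : ℤ, 1 ≤ M → n₁ * N ^ 2 + n₂ * N * M + n₃ * M ^ 2 = j →
        |(N : ℝ) - M * a| < ε → (N, M) ∈ {p : ℤ × ℤ | 1 ≤ p.2 ∧
          |(j : ℝ) / D - (p.2 : ℝ) * ((p.1 : ℝ) - (p.2 : ℝ) * a)| < δ} := by
      intro N M hM hf hlt
      refine ⟨hM, ?_⟩
      rw [← hf, quadratic_form_eq_of_root hroot, ← hDdef]
      simp only
      set z : ℝ := (N : ℝ) - M * a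
      have hz : (D * (M * z) + n₁ * z ^ 2) / D - M * z = n₁ / D * z ^ 2 := by
        field_simp
        ring
      rw [hz, abs_mul, abs_div, abs_pow]
      have h1 : |z| < 1 := hlt.trans_le (min_le_left _ _)
      have h2 : |z| < δ / (c + 1) := hlt.trans_le (min_le_right _ _)
      rw [lt_div_iff₀ (by positivity)] at h2
      calc c * |z| ^ 2 ≤ c * |z| := by
            gcongr
            exact pow_le_of_le_one (abs_nonneg _) h1.le two_ne_zero
        _ ≤ |z| * (c + 1) := by nlinarith [abs_nonneg z]
        _ < δ := h2
    obtain ⟨N₁, M₁, hM₁, hf₁, hlt₁⟩ :=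
      exists_quadratic_form_eq_of_close hn₁ ha hroot h₀ hj hε
    obtain ⟨⟨N₂, M₂⟩, hp, hmin⟩ := Set.exists_min_image _
      (fun p : ℤ × ℤ => |(p.1 : ℝ) - p.2 * a|) hfin ⟨_, hmem N₁ M₁ hM₁ hf₁ hlt₁⟩
    have hpos : 0 < |(N₂ : ℝ) - M₂ * a| := by
      have : 1 ≤ M₂ := hp.1
      exact abs_pos.2 (ha.int_sub_int_mul_ne_zero (by omega))
    obtain ⟨N, M, hM, hf, hlt⟩ :=
      exists_quadratic_form_eq_of_close hn₁ ha hroot h₀ hj (lt_min hε hpos)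
    obtain ⟨h1, h2⟩ := lt_min_iff.1 hlt
    exact (hmin _ (hmem N M hM hf h1)).not_gt h2
end

section
/- Let a ∈ ℝ and suppose there exist sequences of integers (P_k) and (Q_k) with Q_k ≥ 1, Q_k → ∞, P_k − a·Q_k < 0 for all k, and Q_k·(P_k − a·Q_k) → 0 as k → ∞ (such sequences exist when the even-indexed partial quotients of the continued fraction expansion of a are unbounded). Then (−∞, 0] ⊆ 𝓕(a). -/
/-- If there are integer sequences `P k`, `Q k` with `Q k ≥ 1`, `Q k → ∞`,
`P k - a * Q k < 0` and `Q k * (P k - a * Q k) → 0`, then `(-∞, 0] ⊆ 𝓕(a)`. -/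
theorem Iic_zero_subset_Fset (a : ℝ) (P Q : ℕ → ℤ)
    (hQ1 : ∀ k, 1 ≤ Q k)
    (hQtop : Filter.Tendsto (fun k => (Q k : ℝ)) Filter.atTop Filter.atTop)
    (hneg : ∀ k, (P k : ℝ) - a * (Q k : ℝ) < 0)
    (hlim : Filter.Tendsto (fun k => (Q k : ℝ) * ((P k : ℝ) - a * (Q k : ℝ)))
      Filter.atTop (nhds 0)) :
    Set.Iic (0 : ℝ) ⊆ Fset a := by
  intro y hy
  have hy0 : 0 ≤ -y := neg_nonneg.mpr hy
  intro δ hδ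
  set z := √(-y) with hz
  have hz0 : 0 ≤ z := Real.sqrt_nonneg _
  have hzsq : z ^ 2 = -y := Real.sq_sqrt hy0
  set s : ℕ → ℝ := fun k => √(-((Q k : ℝ) * ((P k : ℝ) - a * (Q k : ℝ)))) with hs
  have hs_lim : Filter.Tendsto s Filter.atTop (nhds 0) := by
    simpa using hlim.neg.sqrt
  have herr : Filter.Tendsto (fun k => 2 * z * s k + s k ^ 2) Filter.atTop (nhds 0) := by
    simpa using (hs_lim.const_mul (2 * z)).add (hs_lim.pow 2)
  intro hfin
  obtain ⟨B, hB⟩ := (hfin.image Prod.snd).bddAbove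
  obtain ⟨k, hk, hQk⟩ :=
    ((herr.eventually (gt_mem_nhds hδ)).and (hQtop.eventually_gt_atTop (B : ℝ))).exists
  have hQB : B < Q k := by exact_mod_cast hQk
  have hQ0 : (0 : ℝ) < Q k := by exact_mod_cast hQ1 k
  have hpos : 0 < -((Q k : ℝ) * ((P k : ℝ) - a * (Q k : ℝ))) :=
    neg_pos.mpr (mul_neg_of_pos_of_neg hQ0 (hneg k))
  have hsk : 0 < s k := Real.sqrt_pos.mpr hpos
  have hsq : s k ^ 2 = -((Q k : ℝ) * ((P k : ℝ) - a * (Q k : ℝ))) := Real.sq_sqrt hpos.le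
  obtain ⟨n, hn1, hlo, hhi⟩ : ∃ n : ℤ, 1 ≤ n ∧ z ≤ n * s k ∧ n * s k ≤ z + s k := by
    refine ⟨⌊z / s k⌋ + 1, ?_, ?_, ?_⟩
    · have : 0 ≤ ⌊z / s k⌋ := Int.floor_nonneg.mpr (by positivity)
      lia
    · push_cast
      exact (div_le_iff₀ hsk).mp (Int.lt_floor_add_one _).le
    · have := (le_div_iff₀ hsk).mp (Int.floor_le (z / s k))
      push_cast
      linarith
  have hMQ : Q k ≤ n * Q k := le_mul_of_one_le_left (by linarith [hQ1 k]) hn1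
  have hmem : (n * P k, n * Q k) ∈ {p : ℤ × ℤ | 1 ≤ p.2 ∧
      |y - (p.2 : ℝ) * ((p.1 : ℝ) - (p.2 : ℝ) * a)| < δ} := by
    refine ⟨(hQ1 k).trans hMQ, ?_⟩
    have hval : y - ((n * Q k : ℤ) : ℝ) * (((n * P k : ℤ) : ℝ) - ((n * Q k : ℤ) : ℝ) * a)
        = (n * s k) ^ 2 - z ^ 2 := by
      rw [mul_pow, hsq, hzsq]
      push_cast
      ring
    rw [hval, abs_of_nonneg (sub_nonneg.mpr (pow_le_pow_left₀ hz0 hlo 2))]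
    calc (n * s k) ^ 2 - z ^ 2 ≤ (z + s k) ^ 2 - z ^ 2 :=
          sub_le_sub_right (pow_le_pow_left₀ (hz0.trans hlo) hhi 2) _
      _ = 2 * z * s k + s k ^ 2 := by ring
      _ < δ := hk
  exact absurd (hB (Set.mem_image_of_mem Prod.snd hmem)) (not_le.mpr (hQB.trans_le hMQ))
end

section
/- Let a ∈ ℝ and suppose there exist sequences of integers (P_k) and (Q_k) with Q_k ≥ 1, Q_k → ∞, P_k − a·Q_k > 0 for all k, and Q_k·(P_k − a·Q_k) → 0 as k → ∞ (such sequences exist when the odd-indexed partial quotients of the continued fraction expansion of a are unbounded). Then [0, ∞) ⊆ 𝓕(a). -/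
/-- The dilated squares `c ^ 2 * e` with `c ≥ 1` come within `2 * √(y * e) + e` of any
`y ≥ 0`. -/
lemma exists_int_abs_sub_sq_mul_le {y e : ℝ} (hy : 0 ≤ y) (he : 0 < e) :
    ∃ c : ℤ, 1 ≤ c ∧ |y - (c : ℝ) ^ 2 * e| ≤ 2 * √(y * e) + e := by
  have hs : 0 ≤ √(y / e) := Real.sqrt_nonneg _
  have hsq : √(y / e) ^ 2 * e = y := by
    rw [Real.sq_sqrt (by positivity)]
    field_simp
  have hmul : √(y * e) = √(y / e) * e := by
    rw [show y * e = (√(y / e) * e) ^ 2 by rw [mul_pow, sq e, ← mul_assoc, hsq]]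
    exact Real.sqrt_sq (by positivity)
  refine ⟨⌊√(y / e)⌋ + 1, by linarith [Int.floor_nonneg.mpr hs], ?_⟩
  rw [hmul]
  generalize √(y / e) = s at *
  have h1 : s < (⌊s⌋ : ℝ) + 1 := Int.lt_floor_add_one s
  have h2 : (⌊s⌋ : ℝ) ≤ s := Int.floor_le s
  push_cast
  have hl : s ^ 2 * e ≤ ((⌊s⌋ : ℝ) + 1) ^ 2 * e := by gcongr
  have hu : ((⌊s⌋ : ℝ) + 1) ^ 2 * e ≤ (s + 1) ^ 2 * e := by gcongr
  rw [abs_le]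
  constructor <;> nlinarith [mul_nonneg hs he.le]

/-- If there are integer sequences `P k`, `Q k` with `Q k ≥ 1`, `Q k → ∞`,
`P k - a * Q k > 0` and `Q k * (P k - a * Q k) → 0`, then `[0, ∞) ⊆ 𝓕(a)`. -/
theorem Ici_zero_subset_Fset (a : ℝ) (P Q : ℕ → ℤ)
    (hQ1 : ∀ k, 1 ≤ Q k)
    (hQtop : Filter.Tendsto (fun k => (Q k : ℝ)) Filter.atTop Filter.atTop)
    (hpos : ∀ k, 0 < (P k : ℝ) - a * (Q k : ℝ))
    (hlim : Filter.Tendsto (fun k => (Q k : ℝ) * ((P k : ℝ) - a * (Q k : ℝ)))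
      Filter.atTop (nhds 0)) :
    Set.Ici (0 : ℝ) ⊆ Fset a := by
  intro y hy δ hδ hfin
  obtain ⟨B, hB⟩ := (hfin.image Prod.snd).bddAbove
  have hbound : Filter.Tendsto (fun k => 2 * √(y * ((Q k : ℝ) * ((P k : ℝ) - a * (Q k : ℝ))))
      + (Q k : ℝ) * ((P k : ℝ) - a * (Q k : ℝ))) Filter.atTop (nhds 0) := by
    simpa using (((hlim.const_mul y).sqrt).const_mul 2).add hlim
  obtain ⟨k, hk, hkB⟩ :=
    ((hbound.eventually_lt_const hδ).and (hQtop.eventually_gt_atTop (B : ℝ))).exists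
  have hQk : B < Q k := by exact_mod_cast hkB
  have he : 0 < (Q k : ℝ) * ((P k : ℝ) - a * (Q k : ℝ)) :=
    mul_pos (by exact_mod_cast hQ1 k) (hpos k)
  obtain ⟨c, hc, hcy⟩ := exists_int_abs_sub_sq_mul_le hy he
  have hle : Q k ≤ c * Q k := le_mul_of_one_le_left (by linarith [hQ1 k]) hc
  have hmem : c * Q k ≤ B := by
    refine hB ⟨(c * P k, c * Q k), ⟨(hQ1 k).trans hle, ?_⟩, rfl⟩
    refine lt_of_eq_of_lt ?_ (hcy.trans_lt hk)
    push_cast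
    congr 1
    ring
  linarith
end

section
/- Let a be an irrational real number whose regular continued fraction expansion a = [a₀; a₁, a₂, …] has bounded partial quotients, i.e. there is m ∈ ℕ with aᵢ ≤ m for all i ≥ 1. Then there exists ε > 0 such that 𝓕(a) ∩ (−ε, ε) = ∅; in particular 𝓕(a) does not contain any interval about the origin. -/
open GenContFract in
/-- The continued fraction expansion of an irrational number does not terminate. -/
theorem Irrational.not_terminatedAt_of {a : ℝ} (ha : Irrational a) (n : ℕ) :
    ¬(GenContFract.of a).TerminatedAt n := fun h =>
  let ⟨q, hq⟩ := (terminates_iff_rat a).1 ⟨n, h⟩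
  ha ⟨q, hq.symm⟩

namespace GenContFract

/-- The continuants of the regular continued fraction of an irrational number are integers. -/
theorem exists_int_nums_dens_of_irrational {a : ℝ} (ha : Irrational a) (n : ℕ) :
    ∃ p q : ℤ, (GenContFract.of a).nums n = p ∧ (GenContFract.of a).dens n = q := by
  induction n using Nat.twoStepInduction with
  | zero => exact ⟨⌊a⌋, 1, by simp [zeroth_num_eq_h, of_h_eq_floor], by simp⟩
  | one =>
    obtain ⟨gp, hgp⟩ := Option.ne_none_iff_exists'.1 (ha.not_terminatedAt_of 0)
    obtain ⟨h1, z, hz⟩ := of_partNum_eq_one_and_exists_int_partDen_eq hgp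
    refine ⟨z * ⌊a⌋ + 1, z, ?_, ?_⟩
    · simp [first_num_eq hgp, of_h_eq_floor, h1, hz]
    · simp [first_den_eq hgp, hz]
  | more n ih₀ ih₁ =>
    obtain ⟨gp, hgp⟩ := Option.ne_none_iff_exists'.1 (ha.not_terminatedAt_of (n + 1))
    obtain ⟨h1, z, hz⟩ := of_partNum_eq_one_and_exists_int_partDen_eq hgp
    obtain ⟨p₀, q₀, hp₀, hq₀⟩ := ih₀
    obtain ⟨p₁, q₁, hp₁, hq₁⟩ := ih₁
    refine ⟨z * p₁ + p₀, z * q₁ + q₀, ?_, ?_⟩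
    · simp [nums_recurrence hgp hp₀ hp₁, h1, hz]
    · simp [dens_recurrence hgp hq₀ hq₁, h1, hz]

theorem one_le_dens_of (a : ℝ) (n : ℕ) : 1 ≤ (GenContFract.of a).dens n := by
  induction n with
  | zero => simp
  | succ n ih => exact ih.trans of_den_mono

/-- If the partial quotients are bounded by `m`, consecutive denominators of convergents grow by a
factor of at most `m + 1`. -/
theorem dens_succ_le_of_partDens_le {a : ℝ} (ha : Irrational a) {m : ℝ}
    (hm : ∀ (n : ℕ) (b : ℝ), (GenContFract.of a).partDens.get? n = some b → b ≤ m) (n : ℕ) :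
    (GenContFract.of a).dens (n + 1) ≤ (m + 1) * (GenContFract.of a).dens n := by
  obtain ⟨gp, hgp⟩ := Option.ne_none_iff_exists'.1 (ha.not_terminatedAt_of n)
  have hb : gp.b ≤ m := hm n _ (partDen_eq_s_b hgp)
  have h1 := (of_partNum_eq_one_and_exists_int_partDen_eq hgp).1
  cases n with
  | zero => simp only [zero_add, first_den_eq hgp, zeroth_den_eq_one]; linarith
  | succ n =>
    rw [dens_recurrence hgp rfl rfl, h1]
    have hmono : (GenContFract.of a).dens n ≤ (GenContFract.of a).dens (n + 1) := of_den_mono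
    have hpos := one_le_dens_of a (n + 1)
    nlinarith

theorem exists_lt_dens_of_irrational {a : ℝ} (ha : Irrational a) (x : ℝ) :
    ∃ n, x < (GenContFract.of a).dens n := by
  obtain ⟨k, hk⟩ := exists_nat_gt x
  refine ⟨k + 5, hk.trans_le ?_⟩
  have hfib : ((k + 6).fib : ℝ) ≤ (GenContFract.of a).dens (k + 5) :=
    succ_nth_fib_le_of_nth_den (.inr (ha.not_terminatedAt_of _))
  have : k + 6 ≤ (k + 6).fib := Nat.le_fib_self (by lia)
  have : ((k + 6 : ℕ) : ℝ) ≤ (k + 6).fib := by exact_mod_cast this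
  push_cast at this
  linarith

theorem abs_dens_mul_sub_nums_le {a : ℝ} (ha : Irrational a) (n : ℕ) :
    |(GenContFract.of a).dens n * a - (GenContFract.of a).nums n| ≤
      1 / (GenContFract.of a).dens (n + 1) := by
  have h := abs_sub_convs_le (ha.not_terminatedAt_of n)
  have hq : 0 < (GenContFract.of a).dens n := zero_lt_one.trans_le (one_le_dens_of a n)
  have hq' : 0 < (GenContFract.of a).dens (n + 1) := zero_lt_one.trans_le (one_le_dens_of a (n + 1))
  rw [conv_eq_num_div_den] at h
  calc |(GenContFract.of a).dens n * a - (GenContFract.of a).nums n|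
      = (GenContFract.of a).dens n *
          |a - (GenContFract.of a).nums n / (GenContFract.of a).dens n| := by
        rw [← abs_of_pos hq, ← abs_mul, abs_of_pos hq]
        congr 1
        field_simp
    _ ≤ (GenContFract.of a).dens n *
          (1 / ((GenContFract.of a).dens n * (GenContFract.of a).dens (n + 1))) := by gcongr
    _ = 1 / (GenContFract.of a).dens (n + 1) := by field_simp

/-- A fraction `N / M` differs from at least one of two consecutive convergents. -/
theorem cross_ne_zero_or_cross_succ_ne_zero {a : ℝ} (ha : Irrational a) {N M : ℝ} (hM : M ≠ 0)
    (n : ℕ) : N * (GenContFract.of a).dens n - M * (GenContFract.of a).nums n ≠ 0 ∨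
      N * (GenContFract.of a).dens (n + 1) - M * (GenContFract.of a).nums (n + 1) ≠ 0 := by
  by_contra! h
  have hdet : (GenContFract.of a).nums n * (GenContFract.of a).dens (n + 1) -
      (GenContFract.of a).dens n * (GenContFract.of a).nums (n + 1) = (-1) ^ (n + 1) :=
    SimpContFract.determinant (s := SimpContFract.of a) (ha.not_terminatedAt_of n)
  have : M * (-1) ^ (n + 1) = 0 := by
    linear_combination (-M) * hdet + (GenContFract.of a).dens n * h.2 -
      (GenContFract.of a).dens (n + 1) * h.1
  simp [hM] at this

/-- If `p / q` is a convergent with a large denominator which differs from `N / M`, then `M * a`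
is not too close to `N`. -/
theorem one_le_two_mul_dens_mul_abs_sub {a : ℝ} (ha : Irrational a) {N M : ℤ} (hM : 1 ≤ M) {n : ℕ}
    (hn : 2 * (M : ℝ) < (GenContFract.of a).dens n)
    (hne : (N : ℝ) * (GenContFract.of a).dens n - M * (GenContFract.of a).nums n ≠ 0) :
    1 ≤ 2 * (GenContFract.of a).dens n * |(N : ℝ) - M * a| := by
  have hM' : (1 : ℝ) ≤ M := by exact_mod_cast hM
  have hq := one_le_dens_of a n
  have hmono : (GenContFract.of a).dens n ≤ (GenContFract.of a).dens (n + 1) := of_den_mono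
  have hint : 1 ≤ |(N : ℝ) * (GenContFract.of a).dens n - M * (GenContFract.of a).nums n| := by
    obtain ⟨p, q, hp, hq⟩ := exists_int_nums_dens_of_irrational ha n
    rw [hp, hq] at hne ⊢
    have : N * q - M * p ≠ 0 := by exact_mod_cast hne
    exact_mod_cast Int.one_le_abs this
  have herr : M * |(GenContFract.of a).dens n * a - (GenContFract.of a).nums n| ≤ 1 / 2 :=
    calc M * |(GenContFract.of a).dens n * a - (GenContFract.of a).nums n|
        ≤ M * (1 / (GenContFract.of a).dens (n + 1)) := by
          gcongr
          exact abs_dens_mul_sub_nums_le ha n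
      _ ≤ 1 / 2 := by
          rw [mul_one_div, div_le_div_iff₀ (by linarith) two_pos]
          linarith
  have htri : |(N : ℝ) * (GenContFract.of a).dens n - M * (GenContFract.of a).nums n| ≤
      (GenContFract.of a).dens n * |(N : ℝ) - M * a| +
        M * |(GenContFract.of a).dens n * a - (GenContFract.of a).nums n| := by
    rw [← abs_of_pos (zero_lt_one.trans_le hq), ← abs_of_pos (zero_lt_one.trans_le hM'),
      ← abs_mul, ← abs_mul, abs_of_pos (zero_lt_one.trans_le hq),
      abs_of_pos (zero_lt_one.trans_le hM')]
    refine le_trans (le_of_eq ?_) (abs_add_le _ _)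
    congr 1
    ring
  linarith

/-- An irrational number with partial quotients bounded by `m` is badly approximable. -/
theorem one_le_mul_abs_mul_sub_of_partDens_le {a : ℝ} (ha : Irrational a) {m : ℝ} (hm₀ : 0 ≤ m)
    (hm : ∀ (n : ℕ) (b : ℝ), (GenContFract.of a).partDens.get? n = some b → b ≤ m)
    {N M : ℤ} (hM : 1 ≤ M) :
    1 ≤ 4 * (m + 1) ^ 2 * |(M : ℝ) * (N - M * a)| := by
  classical
  have hM' : (1 : ℝ) ≤ M := by exact_mod_cast hM
  have hex := exists_lt_dens_of_irrational ha (2 * M)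
  obtain ⟨n, hn⟩ : ∃ n, Nat.find hex = n + 1 := Nat.exists_eq_succ_of_ne_zero fun h0 => by
    have := Nat.find_spec hex
    rw [h0, zeroth_den_eq_one] at this
    linarith
  have hlt : 2 * (M : ℝ) < (GenContFract.of a).dens (n + 1) := hn ▸ Nat.find_spec hex
  have hle : (GenContFract.of a).dens n ≤ 2 * M := not_lt.1 (Nat.find_min hex (by lia))
  have h1 : (GenContFract.of a).dens (n + 1) ≤ (m + 1) * (2 * M) :=
    (dens_succ_le_of_partDens_le ha hm n).trans (by gcongr)
  have h2 : (GenContFract.of a).dens (n + 2) ≤ (m + 1) ^ 2 * (2 * M) :=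
    (dens_succ_le_of_partDens_le ha hm (n + 1)).trans (by rw [sq, mul_assoc]; gcongr)
  have hmono : (GenContFract.of a).dens (n + 1) ≤ (GenContFract.of a).dens (n + 2) := of_den_mono
  have key : ∃ k, (GenContFract.of a).dens k ≤ (m + 1) ^ 2 * (2 * M) ∧
      1 ≤ 2 * (GenContFract.of a).dens k * |(N : ℝ) - M * a| := by
    rcases cross_ne_zero_or_cross_succ_ne_zero ha (N := N) (M := M) (by positivity) (n + 1)
      with h | h
    · exact ⟨n + 1, hmono.trans h2, one_le_two_mul_dens_mul_abs_sub ha hM hlt h⟩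
    · exact ⟨n + 2, h2, one_le_two_mul_dens_mul_abs_sub ha hM (hlt.trans_le hmono) h⟩
  obtain ⟨k, hk, hk'⟩ := key
  calc (1 : ℝ) ≤ 2 * (GenContFract.of a).dens k * |(N : ℝ) - M * a| := hk'
    _ ≤ 2 * ((m + 1) ^ 2 * (2 * M)) * |(N : ℝ) - M * a| := by gcongr
    _ = 4 * (m + 1) ^ 2 * |(M : ℝ) * (N - M * a)| := by
      rw [abs_mul, abs_of_pos (zero_lt_one.trans_le hM')]; ring

end GenContFract

/-- If `a` is irrational and its regular continued fraction expansion (computed by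
`GenContFract.of`) has partial quotients bounded by `m`, then `𝓕(a)` omits an
interval about the origin. -/
theorem Fset_avoids_interval_of_bounded_partial_quotients (a : ℝ) (ha : Irrational a)
    (m : ℕ)
    (hbound : ∀ (n : ℕ) (b : ℝ), (GenContFract.of a).partDens.get? n = some b → b ≤ m) :
    ∃ ε > 0, Fset a ∩ Set.Ioo (-ε) ε = ∅ := by
  set c : ℝ := 1 / (4 * ((m : ℝ) + 1) ^ 2) with hc
  have hc₀ : 0 < c := by positivity
  refine ⟨c / 2, half_pos hc₀, Set.eq_empty_of_forall_notMem ?_⟩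
  rintro y ⟨hy, hyc⟩
  obtain ⟨⟨N, M⟩, hM, hNM⟩ := (hy (c / 2) (half_pos hc₀)).nonempty
  have hlow : c ≤ |(M : ℝ) * (N - M * a)| := by
    rw [hc, div_le_iff₀' (by positivity)]
    exact GenContFract.one_le_mul_abs_mul_sub_of_partDens_le ha m.cast_nonneg hbound hM
  have hyabs : |y| < c / 2 := abs_lt.2 hyc
  have htri := abs_sub_abs_le_abs_sub ((M : ℝ) * (N - M * a)) y
  rw [abs_sub_comm] at htri
  dsimp only at hNM
  linarith
end

section
/- For Lebesgue-almost every real number a, 𝓕(a) = ℝ. -/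
open Filter Metric MeasureTheory Topology

/-- An irrational number has approximations `|a - N / q| < 1 / q ^ 2` with arbitrarily large `q`. -/
theorem Irrational.frequently_exists_abs_sub_div_lt {a : ℝ} (ha : Irrational a) :
    ∃ᶠ q : ℕ in atTop, 1 ≤ q ∧ ∃ N : ℤ, |a - N / q| < 1 / (q : ℝ) ^ 2 := by
  refine frequently_atTop.2 fun B => ?_
  by_contra! hB
  refine Real.infinite_rat_abs_sub_lt_one_div_den_sq_of_irrational ha ?_
  have hinj : Function.Injective fun r : ℚ => (r.num, r.den) := fun r s h =>
    Rat.ext (congrArg Prod.fst h) (congrArg Prod.snd h)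
  obtain ⟨K, hK⟩ := exists_nat_gt ((|a| + 1) * B)
  refine (((Set.finite_Icc (-(K : ℤ)) K).prod (Set.finite_Iic B)).preimage
    hinj.injOn).subset fun r hr => ?_
  simp only [Set.mem_ofPred_eq] at hr
  have hd1 : (1 : ℝ) ≤ r.den := by exact_mod_cast r.pos
  have hd0 : (0 : ℝ) < r.den := by linarith
  have hcast : (r : ℝ) = r.num / r.den := Rat.cast_def r
  have hden : r.den ≤ B := by
    by_contra! h
    have := hB r.den h.le r.pos r.num
    rw [hcast] at hr
    linarith
  have hle : 1 / (r.den : ℝ) ^ 2 ≤ 1 := by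
    rw [div_le_one (by positivity)]
    nlinarith
  have hr1 : |(r : ℝ)| ≤ |a| + 1 := by
    have := abs_sub_abs_le_abs_sub (r : ℝ) a
    rw [abs_sub_comm] at this
    linarith
  have hnum : |(r.num : ℝ)| ≤ K := by
    have h : (r.num : ℝ) = r * r.den := by rw [hcast]; field_simp
    have hB' : (r.den : ℝ) ≤ B := by exact_mod_cast hden
    rw [h, abs_mul, abs_of_pos hd0]
    calc |(r : ℝ)| * r.den ≤ (|a| + 1) * B := by gcongr
      _ ≤ K := hK.le
  have hnum' : |r.num| ≤ (K : ℤ) := by exact_mod_cast hnum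
  exact ⟨abs_le.1 hnum', hden⟩

/-- The solutions `a` of `M * (N - M * a) = y` with `M = q` fixed and `N` an arbitrary integer. -/
def shiftedFractions (y : ℝ) (q : ℕ) : Set ℝ :=
  Set.range fun N : ℤ => (N / q - y / (q : ℝ) ^ 2 : ℝ)

theorem ae_frequently_mem_cthickening_shiftedFractions (y : ℝ) {c : ℝ} (hc : 0 < c) :
    ∀ᵐ a : ℝ, ∃ᶠ q : ℕ in atTop, a ∈ cthickening (c / (q : ℝ) ^ 2) (shiftedFractions y q) := by
  have hr : Tendsto (fun q : ℕ => c / (q : ℝ) ^ 2) atTop (𝓝 0) :=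
    tendsto_const_nhds.div_atTop
      ((tendsto_pow_atTop two_ne_zero).comp tendsto_natCast_atTop_atTop)
  have hM : 0 < (1 + |y|) / c := by positivity
  have key := blimsup_cthickening_mul_ae_eq volume (fun _ => True) (shiftedFractions y) hM _ hr
  filter_upwards [key.mem_iff, (Set.countable_range ((↑) : ℚ → ℝ)).ae_notMem volume] with a hiff ha
  rw [blimsup_true, blimsup_true, mem_limsup_iff_frequently_mem,
    mem_limsup_iff_frequently_mem] at hiff
  refine hiff.1 ((Irrational.frequently_exists_abs_sub_div_lt ha).mono ?_)
  rintro q ⟨hq, N, hN⟩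
  have hq0 : (0 : ℝ) < q := by exact_mod_cast hq
  refine mem_cthickening_of_dist_le _ _ _ _ ⟨N, rfl⟩ ?_
  calc dist a (N / q - y / (q : ℝ) ^ 2) = |(a - N / q) + y / (q : ℝ) ^ 2| := by
        rw [Real.dist_eq]; ring_nf
    _ ≤ |a - N / q| + |y / (q : ℝ) ^ 2| := abs_add_le _ _
    _ ≤ 1 / (q : ℝ) ^ 2 + |y| / (q : ℝ) ^ 2 := by
        rw [abs_div, abs_of_pos (pow_pos hq0 2)]; gcongr
    _ = (1 + |y|) / c * (c / (q : ℝ) ^ 2) := by field_simp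

theorem ae_infinite_setOf_abs_sub_lt (y : ℝ) {δ : ℝ} (hδ : 0 < δ) :
    ∀ᵐ a : ℝ,
      {p : ℤ × ℤ | 1 ≤ p.2 ∧ |y - (p.2 : ℝ) * ((p.1 : ℝ) - (p.2 : ℝ) * a)| < δ}.Infinite := by
  filter_upwards [ae_frequently_mem_cthickening_shiftedFractions y (half_pos hδ)] with a ha
  have hfreq : ∃ᶠ q : ℕ in atTop, (q : ℤ) ∈ Prod.snd ''
      {p : ℤ × ℤ | 1 ≤ p.2 ∧ |y - (p.2 : ℝ) * ((p.1 : ℝ) - (p.2 : ℝ) * a)| < δ} := by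
    refine (ha.and_eventually (eventually_ge_atTop 1)).mono ?_
    rintro q ⟨hmem, hq⟩
    have hq0 : (0 : ℝ) < q := by exact_mod_cast hq
    have hlt : δ / 2 / (q : ℝ) ^ 2 < δ / (q : ℝ) ^ 2 := by gcongr; linarith
    obtain ⟨_, ⟨N, rfl⟩, hN⟩ :=
      mem_thickening_iff.1 (cthickening_subset_thickening' (by positivity) hlt _ hmem)
    refine ⟨(N, q), ⟨Int.ofNat_le.2 hq, ?_⟩, rfl⟩
    rw [Real.dist_eq, lt_div_iff₀ (by positivity)] at hN
    have hmul : y - ((q : ℤ) : ℝ) * ((N : ℝ) - ((q : ℤ) : ℝ) * a) =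
        (a - (N / q - y / (q : ℝ) ^ 2)) * (q : ℝ) ^ 2 := by
      push_cast
      field_simp
      ring
    simpa only [hmul, abs_mul, abs_of_pos (pow_pos hq0 2)] using hN
  have hinf := Nat.frequently_atTop_iff_infinite.1 hfreq
  exact .of_image Prod.snd
    ((hinf.image Nat.cast_injective.injOn).mono (Set.image_subset_iff.2 fun _ h => h))

/-- For Lebesgue-almost every real number `a`, `𝓕(a) = ℝ`. -/
theorem Fset_ae_eq_univ :
    ∀ᵐ a ∂(MeasureTheory.volume : MeasureTheory.Measure ℝ), Fset a = Set.univ := by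
  have h : ∀ᵐ a : ℝ, ∀ (z : ℚ) (k : ℕ), {p : ℤ × ℤ | 1 ≤ p.2 ∧
      |(z : ℝ) - (p.2 : ℝ) * ((p.1 : ℝ) - (p.2 : ℝ) * a)| < 1 / ((k : ℝ) + 1)}.Infinite :=
    ae_all_iff.2 fun z => ae_all_iff.2 fun k =>
      ae_infinite_setOf_abs_sub_lt z Nat.one_div_pos_of_nat
  filter_upwards [h] with a ha
  refine Set.eq_univ_of_forall fun y δ hδ => ?_
  obtain ⟨k, hk⟩ := exists_nat_one_div_lt (half_pos hδ)
  obtain ⟨z, hyz, hz⟩ := exists_rat_btwn (lt_add_of_pos_right y (half_pos hδ))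
  refine (ha z k).mono fun p hp => ⟨hp.1, ?_⟩
  have hyz' : |y - z| < δ / 2 := by rw [abs_lt]; constructor <;> linarith
  have := abs_sub_le y z ((p.2 : ℝ) * ((p.1 : ℝ) - (p.2 : ℝ) * a))
  linarith [hp.2]
end

section
/- For every real number a the set 𝓕(a) is nonempty; moreover, if a is rational then 𝓕(a) = {0}. -/
/-- A real-valued function that is bounded on an infinite set has a value that it approximates
infinitely often. -/
theorem Set.Infinite.exists_infinite_abs_sub_lt {α : Type*} {S : Set α} (hS : S.Infinite)
    (f : α → ℝ) {C : ℝ} (hC : ∀ x ∈ S, |f x| ≤ C) :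
    ∃ y : ℝ, ∀ δ > 0, {x | x ∈ S ∧ |y - f x| < δ}.Infinite := by
  have hne : (Filter.cofinite ⊓ Filter.principal S).NeBot :=
    Filter.cofinite_inf_principal_neBot_iff.2 hS
  have hle : Filter.map f (Filter.cofinite ⊓ Filter.principal S) ≤
      Filter.principal (Set.Icc (-C) C) := by
    rw [Filter.le_principal_iff, Filter.mem_map]
    exact Filter.mem_inf_of_right fun x hx => abs_le.1 (hC x hx)
  obtain ⟨y, -, hy⟩ := isCompact_Icc hle
  refine ⟨y, fun δ hδ => ?_⟩
  have hfreq := (mapClusterPt_iff_frequently.1 hy) _ (Metric.ball_mem_nhds y hδ)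
  rw [Filter.frequently_inf_principal, Filter.frequently_cofinite_iff_infinite] at hfreq
  refine hfreq.mono fun x hx => ⟨hx.1, ?_⟩
  have := hx.2
  rwa [Metric.mem_ball, Real.dist_eq, abs_sub_comm] at this

theorem Fset_nonempty_of_irrational {a : ℝ} (ha : Irrational a) : (Fset a).Nonempty := by
  let S : Set (ℤ × ℤ) := {p | 1 ≤ p.2 ∧ |(p.2 : ℝ) * ((p.1 : ℝ) - (p.2 : ℝ) * a)| ≤ 1}
  have hS : S.Infinite := by
    have hinj : Function.Injective (fun q : ℚ => ((q.num, (q.den : ℤ)) : ℤ × ℤ)) := by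
      intro q r h
      simp only [Prod.mk.injEq, Nat.cast_inj] at h
      exact Rat.ext h.1 h.2
    refine ((Real.infinite_rat_abs_sub_lt_one_div_den_sq_of_irrational ha).image
      hinj.injOn).mono ?_
    rintro _ ⟨q, hq, rfl⟩
    have hd : (0 : ℝ) < q.den := by exact_mod_cast q.den_pos
    refine ⟨Int.natCast_pos.2 q.den_pos, ?_⟩
    have hq' : |a - q| < 1 / (q.den : ℝ) ^ 2 := hq
    have hnum : (q.num : ℝ) = q * q.den := by exact_mod_cast (Rat.mul_den_eq_num q).symm
    have heq : (q.den : ℝ) * (q.num - q.den * a) = -((q.den : ℝ) ^ 2 * (a - q)) := by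
      rw [hnum]; ring
    rw [lt_div_iff₀ (by positivity)] at hq'
    simp only [Int.cast_natCast]
    rw [heq, abs_neg, abs_mul, abs_of_pos (by positivity : (0 : ℝ) < (q.den : ℝ) ^ 2)]
    linarith
  obtain ⟨y, hy⟩ := hS.exists_infinite_abs_sub_lt
    (fun p => (p.2 : ℝ) * ((p.1 : ℝ) - (p.2 : ℝ) * a)) fun _ hp => hp.2
  exact ⟨y, fun δ hδ => (hy δ hδ).mono fun p hp => ⟨hp.1.1, hp.2⟩⟩

theorem zero_mem_Fset_ratCast (r : ℚ) : (0 : ℝ) ∈ Fset r := by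
  intro δ hδ
  have hd : (r.den : ℤ) ≠ 0 := by exact_mod_cast r.den_nz
  have hinj : Function.Injective
      (fun k : ℕ => ((r.num * (k + 1), (r.den : ℤ) * (k + 1)) : ℤ × ℤ)) := by
    intro k l h
    simp only [Prod.mk.injEq] at h
    have := mul_left_cancel₀ hd h.2
    omega
  refine (Set.infinite_range_of_injective hinj).mono ?_
  rintro _ ⟨k, rfl⟩
  have hnum : (r.num : ℝ) = r * r.den := by exact_mod_cast (Rat.mul_den_eq_num r).symm
  refine ⟨?_, ?_⟩
  · have : (0 : ℤ) < r.den := by exact_mod_cast r.den_pos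
    have hpos : 0 < (r.den : ℤ) * (k + 1) := by positivity
    exact Int.add_one_le_iff.2 hpos
  · push_cast
    rw [hnum]
    ring_nf
    simpa using hδ

theorem eq_zero_of_mem_Fset_ratCast {r : ℚ} {y : ℝ} (hy : y ∈ Fset r) : y = 0 := by
  by_contra hne
  refine hy (|y|) (abs_pos.2 hne) ?_
  have hd : (0 : ℝ) < r.den := by exact_mod_cast r.den_pos
  have hdz : (r.den : ℤ) ≠ 0 := by exact_mod_cast r.den_nz
  have hnum : (r.num : ℝ) = r * r.den := by exact_mod_cast (Rat.mul_den_eq_num r).symm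
  let g : ℤ × ℤ → ℤ × ℤ := fun p => (p.1 * r.den - p.2 * r.num, p.2)
  have hg : Function.Injective g := by
    rintro ⟨N, M⟩ ⟨N', M'⟩ h
    simp only [g, Prod.mk.injEq] at h
    obtain ⟨h1, rfl⟩ := h
    simpa [hdz] using h1
  obtain ⟨B, hB⟩ := exists_int_gt (2 * |y| * r.den)
  refine (((Set.finite_Icc (-B) B).prod (Set.finite_Icc 1 B)).preimage hg.injOn).subset ?_
  rintro ⟨N, M⟩ ⟨hM, hlt⟩
  simp only at hM hlt
  set K : ℤ := N * r.den - M * r.num with hK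
  have hval : (M : ℝ) * (N - M * r) * r.den = ((M * K : ℤ) : ℝ) := by
    rw [hK]; push_cast; rw [hnum]; ring
  have hK0 : K ≠ 0 := by
    intro h0
    rw [h0, mul_zero, Int.cast_zero, mul_eq_zero, or_iff_left hd.ne'] at hval
    rw [hval, sub_zero] at hlt
    exact lt_irrefl _ hlt
  have hbound : |(M : ℝ) * (N - M * r)| ≤ 2 * |y| := by
    have := abs_sub_abs_le_abs_sub ((M : ℝ) * (N - M * r)) y
    rw [abs_sub_comm] at this
    linarith
  have hMK : |M * K| < B := by
    have : ((|M * K| : ℤ) : ℝ) < B := by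
      rw [Int.cast_abs, ← hval, abs_mul, abs_of_pos hd]
      exact (mul_le_mul_of_nonneg_right hbound hd.le).trans_lt hB
    exact_mod_cast this
  rw [abs_mul, abs_of_pos (by omega : 0 < M)] at hMK
  have hK1 : 1 ≤ |K| := Int.one_le_abs hK0
  have hKB : |K| ≤ B := by nlinarith
  have hMB : M ≤ B := by nlinarith
  exact ⟨abs_le.1 hKB, hM, hMB⟩

/-- For every real number `a` the set `𝓕(a)` is nonempty; moreover, if `a` is rational
then `𝓕(a) = {0}`. -/
theorem Fset_nonempty_and_eq_singleton_zero_of_rational (a : ℝ) :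
    (Fset a).Nonempty ∧ (¬ Irrational a → Fset a = {0}) := by
  by_cases ha : Irrational a
  · exact ⟨Fset_nonempty_of_irrational ha, fun h => absurd ha h⟩
  · obtain ⟨r, rfl⟩ := not_not.1 ha
    exact ⟨⟨0, zero_mem_Fset_ratCast r⟩, fun _ => Set.eq_singleton_iff_unique_mem.2
      ⟨zero_mem_Fset_ratCast r, fun _ hy => eq_zero_of_mem_Fset_ratCast hy⟩⟩
end
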